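/- arXiv:2308.02319 — 3 statements merged into one kernel-verified Lean document; each statement's English description precedes it below -/
import Mathlib

section
/- There exist constants $A_1, A_2, A_3, A_4, K > 0$ such that, as $n \to \infty$, $r(n) \sim \frac{K}{n^{3/5}} \exp\left(A_1 n^{2/5} - A_2 n^{3/10} - A_3 n^{1/5} - A_4 n^{1/10}\right)$. -/
open Filter Asymptotics


/-- `r n` is the number of `n`-dimensional representations of `su(3)`, i.e. the number of
finitely supported functions `f` from pairs of positive integers to `ℕ` with
`∑ f (j, k) * (j * k * (j + k) / 2) = n` (stated multiplied through by `2`). -/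
noncomputable def suThreeRep (n : ℕ) : ℕ :=
  Nat.card {f : (ℕ × ℕ) →₀ ℕ //
    (∀ p ∈ f.support, 0 < p.1 ∧ 0 < p.2) ∧
      (f.sum fun p m => m * (p.1 * p.2 * (p.1 + p.2))) = 2 * n}

namespace SU3
open MeasureTheory Set Topology

theorem EM_loc {f f1 f2 f3 : ℝ → ℝ} (h1 : ∀ x, HasDerivAt f (f1 x) x)
    (h2 : ∀ x, HasDerivAt f1 (f2 x) x) (h3 : ∀ x, HasDerivAt f2 (f3 x) x) (hc : Continuous f3)
    (a : ℝ) : |(f a + f (a + 1)) / 2 - (∫ x in a..(a+1), f x) - (f1 (a + 1) - f1 a) / 12|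
      ≤ ∫ x in a..(a+1), |f3 x| := by
  have hfc : Continuous f := continuous_iff_continuousAt.2 fun x => (h1 x).continuousAt
  let K : ℝ → ℝ := fun x => ((x-a)^3 - 3/2*(x-a)^2 + (x-a)/2)/6
  have hK : ∀ x, HasDerivAt K (((x-a)^2 - (x-a) + 1/6)/2) x := by
    intro x
    have := ((((hasDerivAt_id x).sub_const a).pow 3).sub
      ((((hasDerivAt_id x).sub_const a).pow 2).const_mul (3/2))).add
      (((hasDerivAt_id x).sub_const a).div_const 2) |>.div_const 6
    exact this.congr_deriv (by norm_num; ring)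
  have hK1 : ∀ x, HasDerivAt (fun x => ((x-a)^2 - (x-a) + 1/6)/2) ((x-a) - 1/2) x := by
    intro x
    have := ((((hasDerivAt_id x).sub_const a).pow 2).sub
      ((hasDerivAt_id x).sub_const a)).add_const (1/6) |>.div_const 2
    exact this.congr_deriv (by norm_num; ring)
  have hK2 : ∀ x, HasDerivAt (fun x => ((x-a) - 1/2)) 1 x := by
    intro x
    exact ((hasDerivAt_id x).sub_const a).sub_const _
  have hKc : Continuous K := by fun_prop
  have key := intervalIntegral.integral_eq_sub_of_hasDerivAt (a := a) (b := a+1)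
    (f := fun x => f2 x * K x - f1 x * (((x-a)^2 - (x-a) + 1/6)/2) + f x * ((x-a) - 1/2))
    (f' := fun x => f3 x * K x + f x)
    (fun x _ => by
      have := (((h3 x).mul (hK x)).sub ((h2 x).mul (hK1 x))).add ((h1 x).mul (hK2 x))
      exact this.congr_deriv (by ring)) ((by fun_prop : Continuous fun x => f3 x * K x + f x).intervalIntegrable _ _)
  rw [intervalIntegral.integral_add ((by fun_prop : Continuous fun x => f3 x * K x).intervalIntegrable _ _)
    (hfc.intervalIntegrable _ _)] at key
  have e : (f a + f (a + 1)) / 2 - (∫ x in a..(a+1), f x) - (f1 (a + 1) - f1 a) / 12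
      = ∫ x in a..(a+1), f3 x * K x := by
    simp only [K] at key ⊢
    rw [eq_sub_of_add_eq key]; ring_nf
  rw [e]
  refine (intervalIntegral.abs_integral_le_integral_abs (by linarith)).trans ?_
  refine intervalIntegral.integral_mono_on (by linarith) ((by fun_prop : Continuous fun x => |f3 x * K x|).intervalIntegrable _ _)
    (hc.abs.intervalIntegrable _ _) fun x hx => ?_
  rw [abs_mul]
  refine mul_le_of_le_one_right (abs_nonneg _) ?_
  have hx0 : 0 ≤ x - a := by linarith [hx.1]
  have hx1 : x - a ≤ 1 := by linarith [hx.2]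
  simp only [K]
  generalize x - a = y at *
  rw [abs_le]; constructor <;> nlinarith [pow_nonneg hx0 3, pow_nonneg hx0 2, mul_nonneg hx0 (sub_nonneg.2 hx1), pow_le_one₀ hx0 hx1 (n := 3), pow_le_one₀ hx0 hx1 (n := 2)]

theorem EM {f f1 f2 f3 : ℝ → ℝ} (h1 : ∀ x, HasDerivAt f (f1 x) x)
    (h2 : ∀ x, HasDerivAt f1 (f2 x) x) (h3 : ∀ x, HasDerivAt f2 (f3 x) x) (hc : Continuous f3)
    (a : ℝ) (hi : IntegrableOn f (Ioi a)) (hi3 : IntegrableOn f3 (Ioi a))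
    (hs : Summable fun k : ℕ => f (a + k)) (hl : Tendsto (fun k : ℕ => f1 (a + k)) atTop (𝓝 0)) :
    |(∑' k : ℕ, f (a + k)) - f a / 2 + f1 a / 12 - ∫ x in Ioi a, f x| ≤ ∫ x in Ioi a, |f3 x| := by
  have hfc : Continuous f := continuous_iff_continuousAt.2 fun x => (h1 x).continuousAt
  have fin : ∀ N : ℕ, |(∑ k ∈ Finset.range N, f (a + k)) - f a / 2 + f (a + N) / 2
      - (∫ x in a..(a+N), f x) - (f1 (a + N) - f1 a) / 12| ≤ ∫ x in a..(a+N), |f3 x| := by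
    intro N
    induction N with
    | zero => simp
    | succ N ih =>
      have l := EM_loc h1 h2 h3 hc (a + N)
      rw [Finset.sum_range_succ]
      have e1 := intervalIntegral.integral_add_adjacent_intervals
        (hfc.intervalIntegrable (μ := volume) a (a+N)) (hfc.intervalIntegrable (a+N) (a+N+1))
      have e2 := intervalIntegral.integral_add_adjacent_intervals
        (hc.abs.intervalIntegrable (μ := volume) a (a+N)) (hc.abs.intervalIntegrable (a+N) (a+N+1))
      push_cast
      rw [← add_assoc a, ← e1, ← e2]
      refine le_trans (le_of_eq ?_) ((abs_add_le _ _).trans (add_le_add ih l))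
      congr 1; ring
  have tN : Tendsto (fun N : ℕ => a + (N:ℝ)) atTop atTop :=
    tendsto_atTop_add_const_left _ _ tendsto_natCast_atTop_atTop
  have lim1 := ((((hs.hasSum.tendsto_sum_nat.sub_const (f a / 2)).add
    (hs.tendsto_atTop_zero.div_const 2)).sub
    (intervalIntegral_tendsto_integral_Ioi a hi tN)).sub ((hl.sub_const (f1 a)).div_const 12)).abs
  have lim2 := intervalIntegral_tendsto_integral_Ioi a hi3.abs tN
  refine le_trans (le_of_eq ?_) (le_of_tendsto_of_tendsto' lim1 lim2 fin)
  congr 1; ring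

end SU3

namespace SU3
open MeasureTheory Set Topology

theorem int_pow (q : ℕ) {τ : ℝ} (hτ : 0 < τ) :
    IntegrableOn (fun s : ℝ => s ^ q * Real.exp (-(τ * s ^ 3))) (Ioi 0) ∧
    ∫ s in Ioi (0:ℝ), s ^ q * Real.exp (-(τ * s ^ 3))
      = τ ^ (-((q:ℝ) + 1) / 3) * (1 / 3) * Real.Gamma (((q:ℝ) + 1) / 3) := by
  have hq : (-1:ℝ) < q := by linarith [(Nat.cast_nonneg q : (0:ℝ) ≤ q)]
  have e : ∀ s : ℝ, s ^ q * Real.exp (-(τ * s ^ 3)) =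
      s ^ (q:ℝ) * Real.exp (-τ * s ^ (3:ℝ)) := by
    intro s
    rw [Real.rpow_natCast, show (3:ℝ) = ((3:ℕ):ℝ) by norm_num, Real.rpow_natCast, neg_mul]
  simp_rw [e]
  exact ⟨integrableOn_rpow_mul_exp_neg_mul_rpow hq (by norm_num) hτ,
    integral_rpow_mul_exp_neg_mul_rpow (by norm_num) hq hτ⟩

theorem sum_pow (q : ℕ) {τ : ℝ} (hτ : 0 < τ) :
    Summable fun k : ℕ => (k:ℝ) ^ q * Real.exp (-(τ * k ^ 3)) := by
  refine Summable.of_nonneg_of_le (fun k => by positivity) (fun k => ?_)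
    (Real.summable_pow_mul_exp_neg_nat_mul q hτ)
  have : (k:ℝ) ≤ (k:ℝ) ^ 3 := by exact_mod_cast Nat.le_self_pow (by norm_num) k
  gcongr
  nlinarith

theorem lim_pow (q : ℕ) {τ : ℝ} (hτ : 0 < τ) :
    Tendsto (fun k : ℕ => (k:ℝ) ^ q * Real.exp (-(τ * k ^ 3))) atTop (𝓝 0) :=
  (sum_pow q hτ).tendsto_atTop_zero

theorem hd_pow (q : ℕ) (τ x : ℝ) : HasDerivAt (fun s : ℝ => s ^ q * Real.exp (-(τ * s ^ 3)))
    (q * x ^ (q - 1) * Real.exp (-(τ * x ^ 3)) - 3 * τ * x ^ (q + 2) * Real.exp (-(τ * x ^ 3))) x := by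
  have := (hasDerivAt_pow q x).mul (((hasDerivAt_pow 3 x).const_mul τ).neg.exp)
  exact this.congr_deriv (by simp only [Pi.neg_apply]; push_cast; ring)

/-- abbreviation -/
noncomputable def gp (τ : ℝ) (q : ℕ) (s : ℝ) : ℝ := s ^ q * Real.exp (-(τ * s ^ 3))

theorem gp_d (τ : ℝ) (q : ℕ) (x : ℝ) :
    HasDerivAt (gp τ q) (q * gp τ (q - 1) x - 3 * τ * gp τ (q + 2) x) x := by
  refine (hd_pow q τ x).congr_deriv ?_
  simp only [gp]; ring

theorem gp_c (τ : ℝ) (q : ℕ) : Continuous (gp τ q) := by unfold gp; fun_prop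

noncomputable def Cg (q : ℕ) : ℝ := (1 / 3) * Real.Gamma (((q:ℝ) + 1) / 3)

theorem gp_i {τ : ℝ} (hτ : 0 < τ) (q : ℕ) : IntegrableOn (gp τ q) (Ioi 0) := (int_pow q hτ).1
theorem gp_v {τ : ℝ} (hτ : 0 < τ) (q : ℕ) :
    ∫ s in Ioi 0, gp τ q s = τ ^ (-((q:ℝ) + 1) / 3) * Cg q := by
  rw [Cg, ← mul_assoc]; exact (int_pow q hτ).2

theorem gp_i3 {τ : ℝ} (hτ : 0 < τ) (A B C : ℝ) (p q r : ℕ) :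
    IntegrableOn (fun s => A * gp τ p s + B * gp τ q s + C * gp τ r s) (Ioi 0) :=
  (((gp_i hτ p).const_mul A).add ((gp_i hτ q).const_mul B)).add ((gp_i hτ r).const_mul C)

theorem abs3 {τ : ℝ} (hτ : 0 < τ) (A B C : ℝ) (p q r : ℕ) :
    ∫ s in Ioi (0:ℝ), |A * gp τ p s + B * gp τ q s + C * gp τ r s| ≤
     |A| * (τ ^ (-((p:ℝ) + 1) / 3) * Cg p) + |B| * (τ ^ (-((q:ℝ) + 1) / 3) * Cg q)
      + |C| * (τ ^ (-((r:ℝ) + 1) / 3) * Cg r) := by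
  rw [← gp_v hτ, ← gp_v hτ, ← gp_v hτ, ← integral_const_mul, ← integral_const_mul,
    ← integral_const_mul, ← integral_add, ← integral_add]
  rotate_left
  · exact ((gp_i hτ _).const_mul _).add ((gp_i hτ _).const_mul _)
  · exact (gp_i hτ _).const_mul _
  · exact (gp_i hτ _).const_mul _
  · exact (gp_i hτ _).const_mul _
  refine setIntegral_mono_on (((((gp_i hτ p).const_mul A).add ((gp_i hτ q).const_mul B)).add
    ((gp_i hτ r).const_mul C)).abs) ((((gp_i hτ p).const_mul _).add ((gp_i hτ q).const_mul _)).add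
    ((gp_i hτ r).const_mul _)) measurableSet_Ioi fun x hx => ?_
  have hx : 0 < x := hx
  have : ∀ q, 0 ≤ gp τ q x := fun q => by unfold gp; positivity
  refine (abs_add_three _ _ _).trans ?_
  simp [abs_mul, abs_of_nonneg (this _)]

noncomputable def Sg (τ : ℝ) : ℝ := ∑' k : ℕ, (k:ℝ) * Real.exp (-(τ * k ^ 3))

theorem Sg_em : ∃ C : ℝ, 0 < C ∧ ∀ τ : ℝ, 0 < τ →
    |Sg τ + 1 / 12 - Cg 1 * τ ^ (-(2:ℝ) / 3)| ≤ C * τ ^ ((1:ℝ) / 3) := by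
  have hC : ∀ q, 0 < Cg q := fun q => mul_pos (by norm_num) (Real.Gamma_pos_of_pos (by positivity))
  refine ⟨24 * Cg 1 + 81 * Cg 4 + 27 * Cg 7, by linarith [hC 1, hC 4, hC 7], fun τ hτ => ?_⟩
  have h := EM (f := gp τ 1) (f1 := fun x => gp τ 0 x - 3 * τ * gp τ 3 x)
    (f2 := fun x => -12 * τ * gp τ 2 x + 9 * τ^2 * gp τ 5 x)
    (f3 := fun x => -24 * τ * gp τ 1 x + 81 * τ^2 * gp τ 4 x + -27 * τ^3 * gp τ 7 x)
    (fun x => (gp_d τ 1 x).congr_deriv (by norm_num))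
    (fun x => ((gp_d τ 0 x).sub ((gp_d τ 3 x).const_mul (3 * τ))).congr_deriv (by norm_num; ring))
    (fun x => (((gp_d τ 2 x).const_mul (-12 * τ)).add
      ((gp_d τ 5 x).const_mul (9 * τ^2))).congr_deriv (by norm_num; ring))
    (by have := gp_c τ; fun_prop) 0 (gp_i hτ 1)
    (gp_i3 hτ _ _ _ _ _ _)
    (by simpa [gp] using sum_pow 1 hτ)
    (by simpa [gp] using (lim_pow 0 hτ).sub ((lim_pow 3 hτ).const_mul (3 * τ)))
  have h2 := h.trans (abs3 hτ _ _ _ _ _ _)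
  rw [gp_v hτ] at h2
  have e1 : τ * τ ^ (-(((1:ℕ):ℝ) + 1) / 3) = τ ^ ((1:ℝ)/3) := by
    nth_rw 1 [← Real.rpow_one τ]; rw [← Real.rpow_add hτ]; norm_num
  have e2 : τ^2 * τ ^ (-(((4:ℕ):ℝ) + 1) / 3) = τ ^ ((1:ℝ)/3) := by
    rw [← Real.rpow_natCast, ← Real.rpow_add hτ]; norm_num
  have e3 : τ^3 * τ ^ (-(((7:ℕ):ℝ) + 1) / 3) = τ ^ ((1:ℝ)/3) := by
    rw [← Real.rpow_natCast, ← Real.rpow_add hτ]; norm_num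
  have a1 : |-24 * τ| = 24 * τ := by rw [abs_mul, abs_of_pos hτ]; norm_num
  have a2 : |81 * τ^2| = 81 * τ^2 := abs_of_pos (by positivity)
  have a3 : |-27 * τ^3| = 27 * τ^3 := by rw [abs_mul, abs_of_pos (pow_pos hτ 3)]; norm_num
  rw [a1, a2, a3] at h2
  have hS : ∑' k : ℕ, gp τ 1 (0 + k) = Sg τ := by simp [Sg, gp]
  rw [hS] at h2
  have e4 : (-(((1:ℕ):ℝ) + 1) / 3) = -(2:ℝ)/3 := by norm_num
  calc _ = _ := by congr 1; simp only [gp]; rw [← e4]; norm_num; ring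
    _ ≤ _ := h2
    _ = _ := by linear_combination (24 * Cg 1) * e1 + 81 * Cg 4 * e2 + 27 * Cg 7 * e3

theorem T_em : ∃ C : ℝ, 0 < C ∧ ∀ τ : ℝ, 0 < τ →
    |τ * (∑' k : ℕ, (k:ℝ)^2 * Real.exp (-(τ * k ^ 3))) - 1 / 3| ≤ C * τ := by
  have hC : ∀ q, 0 < Cg q := fun q => mul_pos (by norm_num) (Real.Gamma_pos_of_pos (by positivity))
  refine ⟨60 * Cg 2 + 108 * Cg 5 + 27 * Cg 8, by linarith [hC 2, hC 5, hC 8], fun τ hτ => ?_⟩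
  have h := EM (f := gp τ 2) (f1 := fun x => 2 * gp τ 1 x - 3 * τ * gp τ 4 x)
    (f2 := fun x => 2 * gp τ 0 x - 18 * τ * gp τ 3 x + 9 * τ^2 * gp τ 6 x)
    (f3 := fun x => -60 * τ * gp τ 2 x + 108 * τ^2 * gp τ 5 x + -27 * τ^3 * gp τ 8 x)
    (fun x => (gp_d τ 2 x).congr_deriv (by norm_num))
    (fun x => (((gp_d τ 1 x).const_mul 2).sub ((gp_d τ 4 x).const_mul (3 * τ))).congr_deriv (by norm_num; ring))
    (fun x => ((((gp_d τ 0 x).const_mul 2).sub ((gp_d τ 3 x).const_mul (18 * τ))).add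
      ((gp_d τ 6 x).const_mul (9 * τ^2))).congr_deriv (by norm_num; ring))
    (by have := gp_c τ; fun_prop) 0 (gp_i hτ 2)
    (gp_i3 hτ _ _ _ _ _ _)
    (by simpa [gp] using sum_pow 2 hτ)
    (by simpa [gp] using ((lim_pow 1 hτ).const_mul 2).sub ((lim_pow 4 hτ).const_mul (3 * τ)))
  have h2 := h.trans (abs3 hτ _ _ _ _ _ _)
  rw [gp_v hτ] at h2
  have e1 : τ * τ ^ (-(((2:ℕ):ℝ) + 1) / 3) = 1 := by
    nth_rw 1 [← Real.rpow_one τ]; rw [← Real.rpow_add hτ]; norm_num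
  have e2 : τ^2 * τ ^ (-(((5:ℕ):ℝ) + 1) / 3) = 1 := by
    rw [← Real.rpow_natCast, ← Real.rpow_add hτ]; norm_num
  have e3 : τ^3 * τ ^ (-(((8:ℕ):ℝ) + 1) / 3) = 1 := by
    rw [← Real.rpow_natCast, ← Real.rpow_add hτ]; norm_num
  have a1 : |-60 * τ| = 60 * τ := by rw [abs_mul, abs_of_pos hτ]; norm_num
  have a2 : |108 * τ^2| = 108 * τ^2 := abs_of_pos (by positivity)
  have a3 : |-27 * τ^3| = 27 * τ^3 := by rw [abs_mul, abs_of_pos (pow_pos hτ 3)]; norm_num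
  rw [a1, a2, a3] at h2
  have c2 : Cg 2 = 1 / 3 := by simp [Cg]; norm_num
  have hS : ∑' k : ℕ, gp τ 2 (0 + k) = ∑' k : ℕ, (k:ℝ)^2 * Real.exp (-(τ * k ^ 3)) := by simp [gp]
  rw [hS] at h2
  have h3 := mul_le_mul_of_nonneg_left h2 hτ.le
  nth_rw 1 [← abs_of_pos hτ] at h3
  rw [← abs_mul] at h3
  refine le_trans (le_of_eq ?_) (h3.trans (le_of_eq ?_))
  · congr 1
    rw [show ∀ x y : ℝ, τ * (x - y) = τ * x - τ * y by intros; ring, ← mul_assoc τ (τ ^ _), e1, c2]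
    simp [gp]
  · linear_combination τ * (60 * Cg 2) * e1 + τ * 108 * Cg 5 * e2 + τ * 27 * Cg 8 * e3

theorem Sg_nonneg (τ : ℝ) : 0 ≤ Sg τ := tsum_nonneg fun k => by positivity

theorem Sg_le : ∃ C : ℝ, 0 < C ∧ ∀ τ : ℝ, 0 < τ → Sg τ ≤ C * τ⁻¹ := by
  have hs : Summable fun k : ℕ => 1 / (k:ℝ)^2 := Real.summable_one_div_nat_pow.2 (by norm_num)
  refine ⟨(∑' k : ℕ, 1 / (k:ℝ)^2) + 1, by positivity, fun τ hτ => ?_⟩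
  have : Sg τ ≤ ∑' k : ℕ, (1 / (k:ℝ)^2) * τ⁻¹ := by
    refine Summable.tsum_le_tsum (fun k => ?_) (by simpa using sum_pow 1 hτ) (hs.mul_right _)
    rcases Nat.eq_zero_or_pos k with rfl | hk
    · simp
    have hk' : (0:ℝ) < k := by exact_mod_cast hk
    rw [Real.exp_neg, one_div, ← mul_inv, ← div_eq_mul_inv, div_le_iff₀ (Real.exp_pos _)]
    have := Real.add_one_le_exp (τ * k ^ 3)
    rw [inv_mul_eq_div, le_div_iff₀ (by positivity)]
    nlinarith
  rw [tsum_mul_right] at this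
  refine this.trans ?_
  gcongr; linarith

theorem Sg_cont : ContinuousOn Sg (Ioi 0) := by
  intro τ hτ
  have hτ : 0 < τ := hτ
  have : ContinuousOn Sg (Ioi (τ/2)) := by
    unfold Sg
    refine continuousOn_tsum (u := fun k : ℕ => (k:ℝ) * Real.exp (-(τ/2 * k ^ 3)))
      (fun k => by fun_prop) (by simpa using sum_pow 1 (half_pos hτ)) fun k x hx => ?_
    have hx : τ/2 < x := hx
    rw [Real.norm_of_nonneg (by positivity)]
    gcongr
  exact (this.continuousAt (Ioi_mem_nhds (by linarith))).continuousWithinAt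

end SU3

namespace SU3
open MeasureTheory Set Topology

noncomputable def rho (τ : ℝ) : ℝ := Sg τ - Cg 1 * τ ^ (-(2:ℝ) / 3)

theorem Cg_pos (q : ℕ) : 0 < Cg q := mul_pos (by norm_num) (Real.Gamma_pos_of_pos (by positivity))

theorem fract_int {f f1 : ℝ → ℝ} (h1 : ∀ x, HasDerivAt f (f1 x) x) (hc : Continuous f1) (N : ℕ) :
    IntervalIntegrable (fun s => f1 s * Int.fract s) volume 0 N ∧
    ∫ s in (0:ℝ)..N, f1 s * Int.fract s = (∑ k ∈ Finset.range N, f (k + 1)) - ∫ s in (0:ℝ)..N, f s := by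
  have hfc : Continuous f := continuous_iff_continuousAt.2 fun x => (h1 x).continuousAt
  induction N with
  | zero => simp
  | succ N ih =>
    have hae : ∀ᵐ s : ℝ, s ∈ Set.uIoc (N:ℝ) (N+1) → f1 s * (s - N) = f1 s * Int.fract s := by
      have : ∀ᵐ s : ℝ, s ≠ N + 1 := by simp [ae_iff, measure_singleton]
      filter_upwards [this] with s hs hs2
      rw [uIoc_of_le (by linarith)] at hs2
      have hfl : ⌊s⌋ = (N:ℤ) := by
        rw [Int.floor_eq_iff]
        exact ⟨by exact_mod_cast hs2.1.le, by exact_mod_cast lt_of_le_of_ne hs2.2 hs⟩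
      rw [Int.fract, hfl]; simp
    have hc1 : Continuous fun s => f1 s * (s - N) := by fun_prop
    have ii : IntervalIntegrable (fun s => f1 s * Int.fract s) volume N (N+1) :=
      (hc1.intervalIntegrable _ _).congr_ae ((ae_restrict_iff' measurableSet_uIoc).2 hae)
    have e : ∫ s in (N:ℝ)..(N+1), f1 s * Int.fract s = f (N+1) - ∫ s in (N:ℝ)..(N+1), f s := by
      rw [← intervalIntegral.integral_congr_ae hae]
      have := intervalIntegral.integral_eq_sub_of_hasDerivAt (a := (N:ℝ)) (b := N+1)
        (f := fun s => f s * (s - N)) (f' := fun s => f1 s * (s - N) + f s)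
        (fun x _ => ((h1 x).mul ((hasDerivAt_id x).sub_const (N:ℝ))).congr_deriv (by simp))
        ((by fun_prop : Continuous fun s => f1 s * (s - N) + f s).intervalIntegrable _ _)
      rw [intervalIntegral.integral_add (hc1.intervalIntegrable _ _) (hfc.intervalIntegrable _ _)] at this
      rw [eq_sub_of_add_eq this]; ring
    push_cast
    refine ⟨ih.1.trans ii, ?_⟩
    rw [← intervalIntegral.integral_add_adjacent_intervals ih.1 ii, ih.2, e, Finset.sum_range_succ,
      ← intervalIntegral.integral_add_adjacent_intervals
        (hfc.intervalIntegrable (μ := volume) 0 N) (hfc.intervalIntegrable N (N+1))]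
    ring

theorem rho_fract {τ : ℝ} (hτ : 0 < τ) :
    rho τ = ∫ s in Ioi (0:ℝ), (gp τ 0 s - 3 * τ * gp τ 3 s) * Int.fract s := by
  have hint : IntegrableOn (fun s => (gp τ 0 s - 3 * τ * gp τ 3 s) * Int.fract s) (Ioi 0) := by
    have h0 : IntegrableOn (fun s => gp τ 0 s - 3 * τ * gp τ 3 s) (Ioi 0) :=
      (gp_i hτ 0).sub ((gp_i hτ 3).const_mul _)
    refine Integrable.mono h0 (h0.1.mul (measurable_fract.aestronglyMeasurable)) (ae_of_all _ fun s => ?_)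
    rw [norm_mul]
    refine mul_le_of_le_one_right (norm_nonneg _) ?_
    rw [Real.norm_of_nonneg (Int.fract_nonneg _)]; exact (Int.fract_lt_one _).le
  have t1 := intervalIntegral_tendsto_integral_Ioi 0 hint tendsto_natCast_atTop_atTop
  have t2 := intervalIntegral_tendsto_integral_Ioi 0 (gp_i hτ 1) tendsto_natCast_atTop_atTop
  have hs : Summable fun k : ℕ => gp τ 1 k := by simpa [gp] using sum_pow 1 hτ
  have hS : Sg τ = ∑' k : ℕ, gp τ 1 (k + 1) := by
    have := hs.tsum_eq_zero_add
    simp only [gp] at this ⊢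
    simpa [Sg] using this
  have hs' : Summable fun k : ℕ => gp τ 1 (k + 1) := by
    have := (summable_nat_add_iff 1).2 hs
    simpa using this
  have t3 := hs'.hasSum.tendsto_sum_nat.sub t2
  have hd : ∀ x, HasDerivAt (gp τ 1) (gp τ 0 x - 3 * τ * gp τ 3 x) x :=
    fun x => (gp_d τ 1 x).congr_deriv (by norm_num)
  have hc : Continuous (fun x => gp τ 0 x - 3 * τ * gp τ 3 x) := by have := gp_c τ; fun_prop
  have := tendsto_nhds_unique t1 (t3.congr fun N => (fract_int hd hc N).2.symm)
  rw [this, rho, hS, gp_v hτ]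
  norm_num; ring

noncomputable def wf (v : ℝ) : ℝ := rho (v ^ 2 / 2)

theorem gauss_in {c : ℝ} (hc : 0 < c) (A : ℝ) :
    IntegrableOn (fun v : ℝ => (1 + A * (c * v ^ 2)) * Real.exp (-(c * v ^ 2))) (Ioi 0) ∧
    ∫ v in Ioi (0:ℝ), (1 + A * (c * v ^ 2)) * Real.exp (-(c * v ^ 2)) =
      (1 + A / 2) * (Real.Gamma (1/2) / 2) * c ^ (-(1:ℝ)/2) := by
  have i0 := integrableOn_rpow_mul_exp_neg_mul_rpow (s := 0) (p := 2) (b := c) (by norm_num) (by norm_num) hc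
  have i2 := integrableOn_rpow_mul_exp_neg_mul_rpow (s := 2) (p := 2) (b := c) (by norm_num) (by norm_num) hc
  have e : ∀ v : ℝ, (1 + A * (c * v ^ 2)) * Real.exp (-(c * v ^ 2)) =
      v ^ (0:ℝ) * Real.exp (-c * v ^ (2:ℝ)) + A * c * (v ^ (2:ℝ) * Real.exp (-c * v ^ (2:ℝ))) := by
    intro v
    simp only [Real.rpow_zero, Real.rpow_two]; ring_nf
  simp_rw [e]
  refine ⟨i0.add (i2.const_mul _), ?_⟩
  rw [integral_add i0 (i2.const_mul _), integral_const_mul,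
    integral_rpow_mul_exp_neg_mul_rpow (by norm_num) (by norm_num) hc,
    integral_rpow_mul_exp_neg_mul_rpow (by norm_num) (by norm_num) hc,
    show ((2:ℝ)+1)/2 = 1/2 + 1 by norm_num, Real.Gamma_add_one (by norm_num)]
  have : c ^ (-(1:ℝ)/2) = c * c ^ (-((2:ℝ)+1)/2) := by
    nth_rw 2 [← Real.rpow_one c]; rw [← Real.rpow_add hc]; norm_num
  rw [zero_add, this]; ring

theorem B_neg : ∫ v in Ioi (0:ℝ), wf v < 0 := by
  let μ := volume.restrict (Ioi (0:ℝ))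
  have hg : 0 < Real.Gamma (1/2) := Real.Gamma_pos_of_pos (by norm_num)
  let H : ℝ → ℝ → ℝ → ℝ := fun A s v =>
    Int.fract s * ((1 + A * (s^3/2 * v^2)) * Real.exp (-(s^3/2 * v^2)))
  have hcp : ∀ s : ℝ, s ∈ Ioi (0:ℝ) → 0 < s^3/2 := fun s hs => by
    have : 0 < s := hs
    positivity
  have HI : ∀ A : ℝ, ∀ s ∈ Ioi (0:ℝ), Integrable (H A s) μ ∧
      ∫ v, H A s v ∂μ = Int.fract s * ((1 + A / 2) * (Real.Gamma (1/2) / 2) * (s^3/2) ^ (-(1:ℝ)/2)) := by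
    intro A s hs
    have := gauss_in (hcp s hs) A
    exact ⟨this.1.const_mul _, by rw [← this.2, ← integral_const_mul]⟩
  have hmeas : ∀ A, AEStronglyMeasurable (Function.uncurry (H A)) (μ.prod μ) := by
    intro A
    apply Measurable.aestronglyMeasurable
    simp only [Function.uncurry_def, H]
    fun_prop
  have hsint : Integrable (fun s : ℝ => Int.fract s * (s^3/2) ^ (-(1:ℝ)/2)) μ := by
    have hm : Measurable (fun s : ℝ => Int.fract s * (s^3/2) ^ (-(1:ℝ)/2)) := by fun_prop
    have hpw : ∀ s : ℝ, 0 < s → (s^3/2) ^ (-(1:ℝ)/2) = 2 ^ ((1:ℝ)/2) * s ^ (-(3:ℝ)/2) := by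
      intro s hs
      rw [Real.div_rpow (by positivity) (by norm_num), ← Real.rpow_natCast, ← Real.rpow_mul hs.le,
        div_eq_mul_inv, ← Real.rpow_neg (by norm_num), mul_comm]
      norm_num
    have : IntegrableOn (fun s : ℝ => Int.fract s * (s^3/2) ^ (-(1:ℝ)/2)) (Ioc 0 1 ∪ Ioi 1) := by
      refine IntegrableOn.union ?_ ?_
      · have h0 : IntegrableOn (fun s : ℝ => 2 ^ ((1:ℝ)/2) * s ^ (-(1:ℝ)/2)) (Ioc 0 1) := by
          refine Integrable.const_mul ?_ _
          rw [← IntegrableOn, ← intervalIntegrable_iff_integrableOn_Ioc_of_le (by norm_num)]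
          exact intervalIntegral.intervalIntegrable_rpow' (by norm_num)
        refine h0.mono' hm.aestronglyMeasurable ?_
        refine (ae_restrict_iff' measurableSet_Ioc).2 (ae_of_all _ fun s hs => ?_)
        have hs0 := hs.1
        rw [hpw s hs0, Real.norm_of_nonneg (mul_nonneg (Int.fract_nonneg _) (by positivity))]
        have : Int.fract s ≤ s := by
          rw [Int.fract]; have : (0:ℝ) ≤ ⌊s⌋ := by exact_mod_cast Int.floor_nonneg.2 hs0.le
          linarith
        have e : s ^ (-(1:ℝ)/2) = s * s ^ (-(3:ℝ)/2) := by
          nth_rw 2 [← Real.rpow_one s]; rw [← Real.rpow_add hs0]; norm_num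
        rw [e]
        have h2 : (0:ℝ) ≤ 2 ^ ((1:ℝ)/2) * s ^ (-(3:ℝ)/2) := by positivity
        nlinarith
      · have h0 : IntegrableOn (fun s : ℝ => 2 ^ ((1:ℝ)/2) * s ^ (-(3:ℝ)/2)) (Ioi 1) :=
          (integrableOn_Ioi_rpow_of_lt (by norm_num) (by norm_num)).const_mul _
        refine h0.mono' hm.aestronglyMeasurable ?_
        refine (ae_restrict_iff' measurableSet_Ioi).2 (ae_of_all _ fun s hs => ?_)
        have hs0 : 0 < s := lt_trans one_pos hs
        rw [hpw s hs0, Real.norm_of_nonneg (mul_nonneg (Int.fract_nonneg _) (by positivity))]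
        exact mul_le_of_le_one_left (by positivity) (Int.fract_lt_one _).le
    rwa [Ioc_union_Ioi_eq_Ioi (by norm_num)] at this
  have hpos : ∀ s v : ℝ, s ∈ Ioi (0:ℝ) → 0 ≤ H 3 s v := by
    intro s v hs
    have := hcp s hs
    exact mul_nonneg (Int.fract_nonneg _) (by positivity)
  have hint3 : Integrable (Function.uncurry (H 3)) (μ.prod μ) := by
    rw [integrable_prod_iff (hmeas 3)]
    refine ⟨(ae_restrict_iff' measurableSet_Ioi).2 (ae_of_all _ fun s hs => (HI 3 s hs).1), ?_⟩
    refine (hsint.const_mul ((1 + 3 / 2) * (Real.Gamma (1/2) / 2))).congr ?_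
    refine (ae_restrict_iff' measurableSet_Ioi).2 (ae_of_all _ fun s hs => ?_)
    simp only [Function.uncurry_apply_pair]
    have : ∀ v, ‖H 3 s v‖ = H 3 s v := fun v => Real.norm_of_nonneg (hpos s v hs)
    simp_rw [this]
    rw [(HI 3 s hs).2]; ring
  have hint : Integrable (Function.uncurry (H (-3))) (μ.prod μ) := by
    refine hint3.mono (hmeas _) ?_
    have hae : ∀ᵐ p ∂(μ.prod μ), p ∈ Ioi (0:ℝ) ×ˢ Ioi (0:ℝ) := by
      rw [Measure.prod_restrict]
      exact ae_restrict_mem (measurableSet_Ioi.prod measurableSet_Ioi)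
    filter_upwards [hae] with p hp
    have := hcp p.1 hp.1
    simp only [Function.uncurry_def, H, norm_mul]
    gcongr
    rw [Real.norm_eq_abs, Real.norm_eq_abs, abs_of_nonneg (a := 1 + 3 * _) (by positivity), abs_le]
    have : 0 ≤ p.1^3/2 * p.2^2 := by positivity
    constructor <;> linarith
  have e1 : ∫ v in Ioi (0:ℝ), wf v = ∫ v, ∫ s, H (-3) s v ∂μ ∂μ := by
    refine setIntegral_congr_fun measurableSet_Ioi fun v hv => ?_
    have hv : 0 < v := hv
    simp only [wf]
    rw [rho_fract (by positivity)]
    refine integral_congr_ae (ae_of_all _ fun s => ?_)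
    simp only [gp, H]; ring_nf
  rw [e1, integral_integral_swap (f := fun v s => H (-3) s v) hint.swap]
  have e2 : ∫ s, ∫ v, H (-3) s v ∂μ ∂μ = -((Real.Gamma (1/2) / 4) * ∫ s, Int.fract s * (s^3/2) ^ (-(1:ℝ)/2) ∂μ) := by
    rw [← integral_const_mul, ← integral_neg]
    refine setIntegral_congr_fun measurableSet_Ioi fun s hs => ?_
    rw [(HI (-3) s hs).2]; ring
  rw [e2]
  have : 0 < ∫ s, Int.fract s * (s^3/2) ^ (-(1:ℝ)/2) ∂μ := by
    rw [setIntegral_pos_iff_support_of_nonneg_ae _ hsint]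
    · refine lt_of_lt_of_le ?_ (measure_mono (s := Ioo (0:ℝ) 1) ?_)
      · simp
      · intro s hs
        refine ⟨?_, hs.1⟩
        have := hcp s hs.1
        rw [Function.mem_support, Int.fract_eq_self.2 ⟨hs.1.le, hs.2⟩]
        have := hs.1
        positivity
    · refine (ae_restrict_iff' measurableSet_Ioi).2 (ae_of_all _ fun s hs => ?_)
      have := hcp s hs
      exact mul_nonneg (Int.fract_nonneg _) (by positivity)
  have := mul_pos (div_pos hg (by norm_num : (0:ℝ) < 4)) this
  linarith

end SU3

namespace SU3
open MeasureTheory Set Topology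

noncomputable def kf (v : ℝ) : ℝ := v / √(v ^ 2 + 1 / 4)

theorem sqrt94 : √(√2 ^ 2 + 1 / 4) = 3 / 2 := by
  rw [Real.sq_sqrt (by norm_num), show (2:ℝ) + 1/4 = (3/2)^2 by norm_num, Real.sqrt_sq (by norm_num)]

theorem kf_d (v : ℝ) : HasDerivAt (fun v : ℝ => √(v ^ 2 + 1 / 4)) (kf v) v := by
  have := ((hasDerivAt_pow 2 v).add_const (1/4)).sqrt (by positivity)
  exact this.congr_deriv (by rw [kf]; push_cast; field_simp)

theorem kf_c : Continuous kf := by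
  unfold kf
  exact continuous_id.div (by fun_prop) fun x => by positivity

theorem kf_nonneg {v : ℝ} (hv : 0 ≤ v) : 0 ≤ kf v := by unfold kf; positivity

theorem kf_le {v : ℝ} (hv : 0 < v) : kf v ≤ 1 ∧ 1 - kf v ≤ v ^ (-(2:ℝ)) := by
  have h1 : v ≤ √(v ^ 2 + 1 / 4) := Real.le_sqrt_of_sq_le (by linarith)
  have hs := Real.sq_sqrt (by positivity : 0 ≤ v ^ 2 + 1 / 4)
  have hp : 0 < √(v ^ 2 + 1 / 4) := by positivity
  unfold kf
  generalize √(v ^ 2 + 1 / 4) = S at *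
  refine ⟨(div_le_one hp).2 h1, ?_⟩
  rw [Real.rpow_neg hv.le, Real.rpow_two, one_sub_div hp.ne', ← one_div, div_le_div_iff₀ hp (by positivity)]
  have : (S - v) * (S + v) = 1/4 := by nlinarith
  have h2 : 0 ≤ S - v := by linarith
  have h3 : (S - v) * v ≤ 1/4 := by nlinarith
  nlinarith

noncomputable def Ij (t j : ℝ) : ℝ := ∫ x in Ioi j, Real.exp (-(t * (j * x * (j + x) / 2)))

theorem Ij_int {t j : ℝ} (ht : 0 < t) (hj : 0 < j) :
    IntegrableOn (fun x => Real.exp (-(t * (j * x * (j + x) / 2)))) (Ici j) := by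
  have h0 : IntegrableOn (fun x => Real.exp (-(t * j * j / 2) * x)) (Ioi j) :=
    integrableOn_exp_mul_Ioi (by have : 0 < t * j * j / 2 := by positivity
                                 linarith) j
  rw [← integrableOn_Ici_iff_integrableOn_Ioi] at h0
  refine Integrable.mono' h0 (by fun_prop) ?_
  refine (ae_restrict_iff' measurableSet_Ici).2 (ae_of_all _ fun x hx => ?_)
  have hx : j ≤ x := hx
  rw [Real.norm_of_nonneg (Real.exp_pos _).le]
  gcongr
  have : 0 ≤ t * j * x * x := by have := hj.le.trans hx; positivity
  nlinarith

theorem Fk_int {c : ℝ} (hc : 0 < c) :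
    IntegrableOn (fun v => Real.exp (-(c * v ^ 2)) * kf v) (Ici √2) := by
  have h0 : Integrable (fun v : ℝ => Real.exp (-c * v ^ 2)) := integrable_exp_neg_mul_sq hc
  refine Integrable.mono' h0.integrableOn (by have := kf_c; fun_prop) ?_
  refine (ae_restrict_iff' measurableSet_Ici).2 (ae_of_all _ fun v hv => ?_)
  have hv : 0 < v := lt_of_lt_of_le (by positivity) hv
  rw [Real.norm_of_nonneg (mul_nonneg (Real.exp_pos _).le (kf_nonneg hv.le)), neg_mul]
  exact mul_le_of_le_one_right (Real.exp_pos _).le (kf_le hv).1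

theorem Ij_sub {t j : ℝ} (ht : 0 < t) (hj : 0 < j) :
    Ij t j = ∫ v in Ioi √2, j * (Real.exp (-(t * j ^ 3 / 2 * v ^ 2)) * kf v) := by
  have key := integral_comp_mul_deriv_Ioi (f := fun v => j * (√(v ^ 2 + 1 / 4) - 1 / 2))
    (f' := fun v => j * kf v) (g := fun x => Real.exp (-(t * (j * x * (j + x) / 2)))) (a := √2)
    (by fun_prop)
    (by
      refine Tendsto.const_mul_atTop hj (tendsto_atTop_add_const_right _ _ ?_)
      refine tendsto_atTop_mono' _ ?_ tendsto_id
      filter_upwards [eventually_ge_atTop 0] with v hv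
      exact Real.le_sqrt_of_sq_le (by simp))
    (fun x _ => (((kf_d x).sub_const _).const_mul j).hasDerivWithinAt) (by fun_prop)
    ((Ij_int ht hj).mono_set (by
      rintro _ ⟨v, hv, rfl⟩
      have : √(√2 ^ 2 + 1 / 4) ≤ √(v ^ 2 + 1 / 4) :=
        Real.sqrt_le_sqrt (by have : √2 ≤ v := hv
                              gcongr)
      rw [sqrt94] at this
      simp only [mem_Ici]; nlinarith))
    (by
      have := (Fk_int (c := t * j ^ 3 / 2) (by positivity)).const_mul j
      refine this.congr (ae_of_all _ fun v => ?_)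
      simp only [Function.comp]
      have hs := Real.sq_sqrt (by positivity : 0 ≤ v ^ 2 + 1 / 4)
      rw [show t * (j * (j * (√(v ^ 2 + 1 / 4) - 1 / 2)) * (j + j * (√(v ^ 2 + 1 / 4) - 1 / 2)) / 2)
        = t * j^3/2 * v^2 by linear_combination (t * j^3/2) * hs]
      ring)
  rw [sqrt94, show j * (3/2 - 1/2) = j by ring] at key
  rw [Ij, ← key]
  refine integral_congr_ae (ae_of_all _ fun v => ?_)
  simp only [Function.comp]
  have hs := Real.sq_sqrt (by positivity : 0 ≤ v ^ 2 + 1 / 4)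
  rw [show t * (j * (j * (√(v ^ 2 + 1 / 4) - 1 / 2)) * (j + j * (√(v ^ 2 + 1 / 4) - 1 / 2)) / 2)
        = t * j^3/2 * v^2 by linear_combination (t * j^3/2) * hs]
  ring

theorem Ij_sum {t : ℝ} (ht : 0 < t) :
    HasSum (fun k : ℕ => Ij t ((k:ℝ) + 1)) (∫ v in Ioi √2, Sg (t * (v ^ 2 / 2)) * kf v) := by
  let Fk : ℕ → ℝ → ℝ := fun k v => k * (Real.exp (-(t * k ^ 3 / 2 * v ^ 2)) * kf v)
  have h2 : (0:ℝ) < √2 := by positivity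
  have hFi : ∀ k : ℕ, Integrable (Fk k) (volume.restrict (Ioi √2)) := by
    intro k
    rcases Nat.eq_zero_or_pos k with rfl | hk
    · simp [Fk]
    · have : (0:ℝ) < k := by exact_mod_cast hk
      exact ((Fk_int (c := t * k ^ 3 / 2) (by positivity)).mono_set Ioi_subset_Ici_self).const_mul _
  have hsum : Summable fun k : ℕ => ∫ v in Ioi √2, ‖Fk k v‖ := by
    have hb : IntegrableOn (fun v : ℝ => v ^ (-(2:ℝ))) (Ioi √2) :=
      integrableOn_Ioi_rpow_of_lt (by norm_num) h2
    refine Summable.of_nonneg_of_le (fun k => integral_nonneg fun v => norm_nonneg _) (fun k => ?_)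
      ((Real.summable_one_div_nat_pow (p := 2)).2 (by norm_num) |>.mul_right
        ((2 / t) * ∫ v in Ioi √2, v ^ (-(2:ℝ))))
    rw [← mul_assoc, ← integral_const_mul]
    refine setIntegral_mono_on (hFi k).norm (hb.const_mul _) measurableSet_Ioi fun v hv => ?_
    have hv : 0 < v := h2.trans hv
    have hn : 0 ≤ Real.exp (-(t * k ^ 3 / 2 * v ^ 2)) * kf v :=
      mul_nonneg (Real.exp_pos _).le (kf_nonneg hv.le)
    rw [Real.norm_of_nonneg (mul_nonneg (Nat.cast_nonneg _) hn)]
    rcases Nat.eq_zero_or_pos k with rfl | hk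
    · simp
    have hk' : (0:ℝ) < k := by exact_mod_cast hk
    have h3 : Real.exp (-(t * k ^ 3 / 2 * v ^ 2)) * kf v ≤ (t * k ^ 3 / 2 * v ^ 2)⁻¹ := by
      refine (mul_le_of_le_one_right (Real.exp_pos _).le (kf_le hv).1).trans ?_
      rw [Real.exp_neg]
      gcongr
      linarith [Real.add_one_le_exp (t * k ^ 3 / 2 * v ^ 2)]
    calc _ ≤ (k:ℝ) * (t * k ^ 3 / 2 * v ^ 2)⁻¹ := by gcongr
      _ = _ := by rw [Real.rpow_neg hv.le, Real.rpow_two]; field_simp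
  have hs := hasSum_integral_of_summable_integral_norm hFi hsum
  have e : ∀ v, ∑' k, Fk k v = Sg (t * (v ^ 2 / 2)) * kf v := by
    intro v
    rw [Sg, ← tsum_mul_right]
    refine tsum_congr fun k => ?_
    simp only [Fk]; ring_nf
  simp_rw [e] at hs
  rw [← hasSum_nat_add_iff' 1] at hs
  simp only [Finset.sum_range_one] at hs
  have e0 : (fun k : ℕ => Ij t ((k:ℝ) + 1)) = fun n => ∫ a in Ioi √2, Fk (n+1) a := by
    funext k
    rw [Ij_sub ht (by positivity)]
    simp [Fk]
  have e00 : ∫ a in Ioi √2, Fk 0 a = 0 := by simp [Fk]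
  rw [e0]
  rwa [e00, sub_zero] at hs

theorem rho_cont : ContinuousOn rho (Ioi 0) := by
  unfold rho
  refine Sg_cont.sub (continuousOn_const.mul ?_)
  intro x hx
  exact (Real.continuousAt_rpow_const _ _ (Or.inl (ne_of_gt hx))).continuousWithinAt

theorem wf_int : IntegrableOn wf (Ioi 0) := by
  obtain ⟨C, hC, h⟩ := Sg_em
  obtain ⟨D, hD, h'⟩ := Sg_le
  have hm : ∀ s ⊆ Ioi (0:ℝ), MeasurableSet s → AEStronglyMeasurable wf (volume.restrict s) := by
    intro s hs hms
    refine ContinuousOn.aestronglyMeasurable ?_ hms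
    refine (rho_cont.comp (f := fun v : ℝ => v ^ 2 / 2) (s := Ioi 0) (by fun_prop) ?_).mono hs
    intro v hv
    have : (0:ℝ) < v := hv
    simp only [mem_Ioi]; positivity
  rw [← Ioc_union_Ioi_eq_Ioi (show (0:ℝ) ≤ 2 by norm_num)]
  refine IntegrableOn.union ?_ ?_
  · refine Integrable.mono' (g := fun _ => C * 2 ^ ((1:ℝ)/3) + 1) (by simp) (hm _ Ioc_subset_Ioi_self measurableSet_Ioc) ?_
    refine (ae_restrict_iff' measurableSet_Ioc).2 (ae_of_all _ fun v hv => ?_)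
    have h0 := hv.1
    have := h (v^2/2) (by positivity)
    have h3 : C * (v^2/2) ^ ((1:ℝ)/3) ≤ C * 2 ^ ((1:ℝ)/3) := by
      gcongr
      nlinarith [hv.2]
    rw [Real.norm_eq_abs, wf, rho]
    rw [abs_le] at this ⊢
    constructor <;> linarith [this.1, this.2]
  · have h0 : IntegrableOn (fun v : ℝ => 2 * D * v ^ (-(2:ℝ)) + Cg 1 * (2 ^ ((2:ℝ)/3) * v ^ (-(4:ℝ)/3))) (Ioi 2) :=
      ((integrableOn_Ioi_rpow_of_lt (by norm_num) (by norm_num)).const_mul _).add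
       (((integrableOn_Ioi_rpow_of_lt (by norm_num) (by norm_num)).const_mul _).const_mul _)
    refine Integrable.mono' h0 (hm _ (Ioi_subset_Ioi (by norm_num)) measurableSet_Ioi) ?_
    refine (ae_restrict_iff' measurableSet_Ioi).2 (ae_of_all _ fun v hv => ?_)
    have hv0 : 0 < v := lt_trans (by norm_num) hv
    rw [wf, rho]
    refine (norm_sub_le _ _).trans (add_le_add ?_ ?_)
    · rw [Real.norm_of_nonneg (Sg_nonneg _)]
      refine (h' _ (by positivity)).trans (le_of_eq ?_)
      rw [Real.rpow_neg hv0.le, Real.rpow_two]; field_simp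
    · rw [Real.norm_of_nonneg (mul_nonneg (Cg_pos 1).le (by positivity))]
      refine le_of_eq ?_
      congr 1
      rw [Real.div_rpow (by positivity) (by norm_num), ← Real.rpow_natCast, ← Real.rpow_mul hv0.le,
        div_eq_mul_inv, ← Real.rpow_neg (by norm_num), mul_comm]
      norm_num

theorem Isum : ∃ a b C : ℝ, 0 < a ∧ 0 < b ∧ 0 < C ∧ ∀ t : ℝ, 0 < t →
    |(∑' k : ℕ, Ij t ((k:ℝ) + 1)) - a * t ^ (-(2:ℝ)/3) + b * t ^ (-(1:ℝ)/2) - 1 / 8|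
      ≤ C * t ^ ((1:ℝ)/3) := by
  obtain ⟨C, hC, h⟩ := Sg_em
  have h2 : (0:ℝ) < √2 := by positivity
  have hpw : ∀ v : ℝ, 0 < v → (v^2/2) ^ (-(2:ℝ)/3) = 2 ^ ((2:ℝ)/3) * v ^ (-(4:ℝ)/3) := by
    intro v hv0
    rw [Real.div_rpow (by positivity) (by norm_num), ← Real.rpow_natCast, ← Real.rpow_mul hv0.le,
        div_eq_mul_inv, ← Real.rpow_neg (by norm_num), mul_comm]
    norm_num
  have iA : IntegrableOn (fun v : ℝ => Cg 1 * (v^2/2) ^ (-(2:ℝ)/3) * kf v) (Ioi √2) := by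
    have h0 : IntegrableOn (fun v : ℝ => Cg 1 * (2 ^ ((2:ℝ)/3) * v ^ (-(4:ℝ)/3))) (Ioi √2) :=
      ((integrableOn_Ioi_rpow_of_lt (by norm_num) h2).const_mul _).const_mul _
    have hkm : Measurable kf := kf_c.measurable
    refine Integrable.mono' h0 (by fun_prop) ?_
    refine (ae_restrict_iff' measurableSet_Ioi).2 (ae_of_all _ fun v hv => ?_)
    have hv0 : 0 < v := h2.trans hv
    have hn : 0 ≤ Cg 1 * (v^2/2) ^ (-(2:ℝ)/3) := mul_nonneg (Cg_pos 1).le (by positivity)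
    rw [Real.norm_of_nonneg (mul_nonneg hn (kf_nonneg hv0.le)), ← hpw v hv0]
    exact mul_le_of_le_one_right hn (kf_le hv0).1
  -- the function `1 - kf`
  have hW := integrableOn_Ioi_deriv_of_nonneg' (a := √2) (l := 0)
    (g := fun v : ℝ => v - √(v ^ 2 + 1 / 4)) (g' := fun v => 1 - kf v)
    (fun v _ => (hasDerivAt_id v).sub (kf_d v))
    (fun v hv => by linarith [(kf_le (h2.trans hv)).1])
  have tW : Tendsto (fun v : ℝ => v - √(v ^ 2 + 1 / 4)) atTop (𝓝 0) := by
    refine squeeze_zero_norm' (a := fun v : ℝ => v⁻¹) ?_ tendsto_inv_atTop_zero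
    filter_upwards [eventually_gt_atTop 0] with v hv
    have h1 : v ≤ √(v ^ 2 + 1 / 4) := Real.le_sqrt_of_sq_le (by linarith)
    have hs := Real.sq_sqrt (by positivity : 0 ≤ v ^ 2 + 1 / 4)
    rw [Real.norm_eq_abs, abs_sub_comm, abs_of_nonneg (by linarith), ← one_div, le_div_iff₀ hv]
    nlinarith
  have iW := hW tW
  have vW : ∫ v in Ioi √2, (1 - kf v) = 3/2 - √2 := by
    rw [integral_Ioi_of_hasDerivAt_of_nonneg' (g := fun v : ℝ => v - √(v ^ 2 + 1 / 4))
      (fun v _ => (hasDerivAt_id v).sub (kf_d v))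
      (fun v hv => by linarith [(kf_le (h2.trans hv)).1]) tW, sqrt94]; ring
  have iW3 : IntegrableOn (fun v : ℝ => (v^2/2) ^ ((1:ℝ)/3) * (1 - kf v)) (Ioi √2) := by
    have h0 : IntegrableOn (fun v : ℝ => v ^ (-(4:ℝ)/3)) (Ioi √2) :=
      (integrableOn_Ioi_rpow_of_lt (by norm_num) h2)
    have hkm : Measurable kf := kf_c.measurable
    refine Integrable.mono' h0 (by fun_prop) ?_
    refine (ae_restrict_iff' measurableSet_Ioi).2 (ae_of_all _ fun v hv => ?_)
    have hv0 : 0 < v := h2.trans hv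
    have := kf_le hv0
    rw [Real.norm_of_nonneg (mul_nonneg (by positivity) (by linarith))]
    calc _ ≤ v ^ ((2:ℝ)/3) * v ^ (-(2:ℝ)) := by
          gcongr
          · linarith
          · calc (v^2/2)^((1:ℝ)/3) ≤ (v^2)^((1:ℝ)/3) := by gcongr; nlinarith
              _ = _ := by rw [← Real.rpow_natCast, ← Real.rpow_mul hv0.le]; norm_num
          · exact this.2
      _ = _ := by rw [← Real.rpow_add hv0]; norm_num
  set a := ∫ v in Ioi √2, Cg 1 * (v^2/2) ^ (-(2:ℝ)/3) * kf v with ha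
  set b := -∫ v in Ioi (0:ℝ), wf v with hb
  set D := ∫ v in Ioi √2, (v^2/2) ^ ((1:ℝ)/3) * (1 - kf v) with hD
  have hDn : 0 ≤ D := setIntegral_nonneg measurableSet_Ioi fun v hv => by
    have := kf_le (h2.trans hv)
    exact mul_nonneg (by positivity) (by linarith)
  refine ⟨a, b, C * √2 + C * D, ?_, by linarith [B_neg], by positivity, fun t ht => ?_⟩
  · rw [ha, setIntegral_pos_iff_support_of_nonneg_ae _ iA]
    · refine lt_of_lt_of_le ?_ (measure_mono (s := Ioo √2 (√2+1)) ?_)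
      · simp
      · intro s hs
        refine ⟨?_, hs.1⟩
        have h0 := h2.trans hs.1
        have := Cg_pos 1
        rw [Function.mem_support, kf]
        positivity
    · refine (ae_restrict_iff' measurableSet_Ioi).2 (ae_of_all _ fun s hs => ?_)
      exact mul_nonneg (mul_nonneg (Cg_pos 1).le (by positivity)) (kf_nonneg (h2.trans hs).le)
  rw [(Ij_sum ht).tsum_eq]
  have hwr : ∀ v, rho (t * (v^2/2)) = wf (√t * v) := by
    intro v; rw [wf, mul_pow, Real.sq_sqrt ht.le]; ring_nf
  have iR : IntegrableOn (fun v : ℝ => rho (t * (v^2/2))) (Ioi 0) := by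
    simp_rw [hwr]
    rw [integrableOn_Ioi_comp_mul_left_iff wf 0 (by positivity)]
    simpa using wf_int
  have vR : ∫ v in Ioi (0:ℝ), rho (t * (v^2/2)) = -b * t ^ (-(1:ℝ)/2) := by
    simp_rw [hwr]
    rw [integral_comp_mul_left_Ioi wf 0 (by positivity), hb, mul_zero, smul_eq_mul, Real.sqrt_eq_rpow,
      ← Real.rpow_neg ht.le]
    norm_num; ring
  have iR2 := iR.mono_set (Ioi_subset_Ioi h2.le : Ioi √2 ⊆ Ioi 0)
  have iR1 := iR.mono_set (Ioc_subset_Ioi_self : Ioc 0 √2 ⊆ Ioi 0)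
  have hm : AEStronglyMeasurable kf (volume.restrict (Ioi √2)) := kf_c.aestronglyMeasurable
  have iRk : IntegrableOn (fun v : ℝ => rho (t * (v^2/2)) * (1 - kf v)) (Ioi √2) := by
    refine Integrable.mono iR2 (iR2.1.mul (aestronglyMeasurable_const.sub hm)) ?_
    refine (ae_restrict_iff' measurableSet_Ioi).2 (ae_of_all _ fun v hv => ?_)
    have := kf_le (h2.trans hv)
    have h3 := kf_nonneg (h2.trans hv).le
    rw [norm_mul]
    refine mul_le_of_le_one_right (norm_nonneg _) ?_
    rw [Real.norm_of_nonneg (by linarith)]; linarith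
  have e1 : ∫ v in Ioi √2, Sg (t * (v ^ 2 / 2)) * kf v = t ^ (-(2:ℝ)/3) * a +
      ((∫ v in Ioi √2, rho (t * (v^2/2))) - ∫ v in Ioi √2, rho (t * (v^2/2)) * (1 - kf v)) := by
    have iS : IntegrableOn (fun v => rho (t * (v^2/2)) - rho (t * (v^2/2)) * (1 - kf v)) (Ioi √2) :=
      iR2.sub iRk
    rw [← integral_sub iR2 iRk, ha, ← integral_const_mul, ← integral_add (iA.const_mul _) iS]
    refine integral_congr_ae (ae_of_all _ fun v => ?_)
    simp only [rho]
    rw [Real.mul_rpow ht.le (by positivity)]; ring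
  have e2 : ∫ v in Ioi (0:ℝ), rho (t * (v^2/2)) =
      (∫ v in Ioc 0 √2, rho (t * (v^2/2))) + ∫ v in Ioi √2, rho (t * (v^2/2)) := by
    rw [← setIntegral_union (Ioc_disjoint_Ioi le_rfl) measurableSet_Ioi iR1 iR2,
      Ioc_union_Ioi_eq_Ioi h2.le]
  have e3 : |(∫ v in Ioc 0 √2, rho (t * (v^2/2))) + √2 / 12| ≤ C * √2 * t ^ ((1:ℝ)/3) := by
    have : (∫ v in Ioc 0 √2, rho (t * (v^2/2))) + √2 / 12 = ∫ v in Ioc 0 √2, (rho (t * (v^2/2)) + 1/12) := by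
      rw [integral_add iR1 (by simp)]; simp; ring
    rw [this, ← Real.norm_eq_abs]
    refine (norm_setIntegral_le_of_norm_le_const (C := C * t ^ ((1:ℝ)/3)) (by simp) fun v hv => ?_).trans (le_of_eq ?_)
    · have h0 := hv.1
      have := h (t * (v^2/2)) (by positivity)
      rw [Real.norm_eq_abs, rho, sub_add_eq_add_sub]
      refine this.trans ?_
      gcongr
      have : v^2 ≤ √2^2 := by gcongr; exact hv.2
      rw [Real.sq_sqrt (by norm_num)] at this
      nlinarith
    · simp [Measure.real]; ring
  have e4 : |(∫ v in Ioi √2, rho (t * (v^2/2)) * (1 - kf v)) + (3/2 - √2) / 12| ≤ C * D * t ^ ((1:ℝ)/3) := by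
    have : (∫ v in Ioi √2, rho (t * (v^2/2)) * (1 - kf v)) + (3/2 - √2) / 12
       = ∫ v in Ioi √2, (rho (t * (v^2/2)) * (1 - kf v) + (1 - kf v) / 12) := by
      rw [integral_add iRk (iW.div_const _), integral_div, vW]
    rw [this, show C * D * t ^ ((1:ℝ)/3) = (C * t ^ ((1:ℝ)/3)) * D by ring, hD, ← integral_const_mul,
      ← Real.norm_eq_abs]
    refine norm_integral_le_of_norm_le (iW3.const_mul _) ?_
    refine (ae_restrict_iff' measurableSet_Ioi).2 (ae_of_all _ fun v hv => ?_)
    have hv0 : 0 < v := h2.trans hv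
    have := h (t * (v^2/2)) (by positivity)
    have hk := kf_le hv0
    rw [show rho (t * (v^2/2)) * (1 - kf v) + (1 - kf v) / 12 = (Sg (t * (v^2/2)) + 1 / 12 -
      Cg 1 * (t * (v^2/2)) ^ (-(2:ℝ) / 3)) * (1 - kf v) by rw [rho]; ring, norm_mul,
      Real.norm_of_nonneg (by linarith : 0 ≤ 1 - kf v), Real.norm_eq_abs, ← mul_assoc]
    refine mul_le_mul_of_nonneg_right (this.trans (le_of_eq ?_)) (by linarith)
    rw [Real.mul_rpow ht.le (by positivity)]; ring
  rw [e1]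
  rw [e2] at vR
  rw [abs_le] at e3 e4 ⊢
  constructor <;> nlinarith [e3.1, e3.2, e4.1, e4.2]

end SU3

namespace SU3
open MeasureTheory Set Topology

/-- half of (j+1)(l+1)(j+l+2) -/
def dn (p : ℕ × ℕ) : ℕ := (p.1 + 1) * (p.2 + 1) * (p.1 + p.2 + 2) / 2

theorem dn_two (p : ℕ × ℕ) : 2 * dn p = (p.1 + 1) * (p.2 + 1) * (p.1 + p.2 + 2) := by
  refine Nat.mul_div_cancel' ?_
  rcases Nat.even_or_odd p.1 with h1 | h1 <;> rcases Nat.even_or_odd p.2 with h2 | h2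
  · exact Dvd.dvd.mul_left (by obtain ⟨a, ha⟩ := h1; obtain ⟨b, hb⟩ := h2; omega) _
  · exact Dvd.dvd.mul_right (Dvd.dvd.mul_left (by obtain ⟨b, hb⟩ := h2; omega) _) _
  · exact Dvd.dvd.mul_right (Dvd.dvd.mul_right (by obtain ⟨b, hb⟩ := h1; omega) _) _
  · exact Dvd.dvd.mul_left (by obtain ⟨a, ha⟩ := h1; obtain ⟨b, hb⟩ := h2; omega) _

theorem dn_cast (p : ℕ × ℕ) : (dn p : ℝ) = (p.1 + 1) * (p.2 + 1) * (p.1 + p.2 + 2) / 2 := by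
  have := dn_two p
  have h : (2:ℝ) * dn p = (p.1 + 1) * (p.2 + 1) * (p.1 + p.2 + 2) := by exact_mod_cast this
  linarith

theorem dn_ge (p : ℕ × ℕ) : p.1 + p.2 + 1 ≤ dn p := by
  have := dn_two p
  nlinarith [Nat.zero_le (p.1 * p.2), Nat.zero_le p.1, Nat.zero_le p.2,
    Nat.zero_le (p.1 * p.2 * p.1), Nat.zero_le (p.1 * p.2 * p.2), Nat.zero_le (p.1 * p.1), Nat.zero_le (p.2 * p.2)]

theorem dn_swap (a b : ℕ) : dn (a, b) = dn (b, a) := by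
  have h1 := dn_two (a, b)
  have h2 := dn_two (b, a)
  simp only at h1 h2
  have : (a + 1) * (b + 1) * (a + b + 2) = (b + 1) * (a + 1) * (b + a + 2) := by ring
  omega

/-- the theta function -/
noncomputable def Th (t : ℝ) : ℝ := ∑' p : ℕ × ℕ, Real.exp (-(t * dn p))

theorem Th_summable {t : ℝ} (ht : 0 < t) : Summable fun p : ℕ × ℕ => Real.exp (-(t * dn p)) := by
  have h1 : Summable fun n : ℕ => Real.exp (-t) ^ n :=
    summable_geometric_of_lt_one (Real.exp_pos _).le (by rw [Real.exp_lt_one_iff]; linarith)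
  have h2 := h1.mul_of_nonneg h1 (fun n => by positivity) (fun n => by positivity)
  refine Summable.of_nonneg_of_le (fun p => (Real.exp_pos _).le) (fun p => ?_) h2
  rw [← Real.exp_nat_mul, ← Real.exp_nat_mul, ← Real.exp_add]
  apply Real.exp_le_exp.2
  have : ((p.1 + p.2 + 1 : ℕ):ℝ) ≤ dn p := by exact_mod_cast dn_ge p
  push_cast at this
  nlinarith

theorem tri_split {g : ℕ × ℕ → ℝ} (hg : Summable g) (hs : ∀ a b, g (a, b) = g (b, a)) :
    HasSum (fun J : ℕ => 2 * (∑' k : ℕ, g (J, J + k)) - g (J, J)) (∑' p, g p) := by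
  let φ : ℕ × ℕ → ℕ × ℕ := fun p => (p.1, p.1 + p.2)
  let ψ : ℕ × ℕ → ℕ × ℕ := fun p => (p.1 + p.2 + 1, p.1)
  have hφ : Function.Injective φ := by
    rintro ⟨a, b⟩ ⟨c, d⟩ h
    simp only [φ, Prod.mk.injEq] at h ⊢; omega
  have hψ : Function.Injective ψ := by
    rintro ⟨a, b⟩ ⟨c, d⟩ h
    simp only [ψ, Prod.mk.injEq] at h ⊢; omega
  have hc : IsCompl (range φ) (range ψ) := by
    constructor
    · rw [Set.disjoint_left]
      rintro _ ⟨⟨a, b⟩, rfl⟩ ⟨⟨c, d⟩, h⟩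
      simp only [φ, ψ, Prod.mk.injEq] at h; omega
    · rw [codisjoint_iff_le_sup]
      rintro ⟨a, b⟩ -
      rcases le_or_gt a b with h | h
      · exact Or.inl ⟨(a, b - a), Prod.ext rfl (by change a + (b - a) = b; omega)⟩
      · exact Or.inr ⟨(b, a - b - 1), Prod.ext (by change b + (a - b - 1) + 1 = a; omega) rfl⟩
  have s1 : Summable (g ∘ φ) := hg.comp_injective hφ
  have s2 : Summable (g ∘ ψ) := hg.comp_injective hψ
  have h1 := HasSum.add_isCompl hc ((hφ.hasSum_range_iff (f := g)).2 s1.hasSum)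
    ((hψ.hasSum_range_iff (f := g)).2 s2.hasSum)
  rw [h1.tsum_eq]
  have h2 := s1.hasSum.prod_fiberwise (fun J => (s1.prod_factor J).hasSum)
  have h3 := s2.hasSum.prod_fiberwise (fun J => (s2.prod_factor J).hasSum)
  have e : (fun J : ℕ => 2 * (∑' k : ℕ, g (J, J + k)) - g (J, J)) =
      fun J => (∑' k, (g ∘ φ) (J, k)) + ∑' k, (g ∘ ψ) (J, k) := by
    funext J
    have h4 : ∑' k, (g ∘ ψ) (J, k) = ∑' k, (g ∘ φ) (J, k + 1) :=
      tsum_congr fun k => hs _ _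
    have h5 := (s1.prod_factor J).tsum_eq_zero_add
    rw [h4]
    have h6 : (g ∘ φ) (J, 0) = g (J, J) := rfl
    have h7 : ∑' k, (g ∘ φ) (J, k) = ∑' k : ℕ, g (J, J + k) := rfl
    rw [h6] at h5
    rw [← h7]; linarith
  rw [e]
  exact h2.add h3

theorem f3_bound {z : ℝ} (hz : 0 < z) :
    (27 / 8 * z ^ 3 + 9 / 2 * z ^ 2) * Real.exp (-(z / 2)) ≤ 200 * z ^ ((1:ℝ)/4) := by
  rcases le_total z 1 with h | h
  · have h1 : z ≤ z ^ ((1:ℝ)/4) := by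
      conv_lhs => rw [← Real.rpow_one z]
      exact Real.rpow_le_rpow_of_exponent_ge hz h (by norm_num)
    have h2 : Real.exp (-(z / 2)) ≤ 1 := Real.exp_le_one_iff.2 (by linarith)
    calc _ ≤ (27 / 8 * z ^ 3 + 9 / 2 * z ^ 2) * 1 := by gcongr
      _ ≤ 200 * z := by nlinarith [mul_pos hz hz, mul_nonneg (mul_pos hz hz).le (sub_nonneg.2 h)]
      _ ≤ _ := by gcongr
  · have h1 : 1 ≤ z ^ ((1:ℝ)/4) := Real.one_le_rpow h (by norm_num)
    have h2 := Real.pow_div_factorial_le_exp (z / 2) (by positivity) 3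
    have h3 := Real.pow_div_factorial_le_exp (z / 2) (by positivity) 2
    norm_num [Nat.factorial] at h2 h3
    rw [Real.exp_neg, ← div_eq_mul_inv, div_le_iff₀ (Real.exp_pos _)]
    have : 200 * Real.exp (z/2) ≤ 200 * z ^ ((1:ℝ)/4) * Real.exp (z/2) := by
      nlinarith [Real.exp_pos (z/2)]
    nlinarith

theorem Sj_em {t j : ℝ} (ht : 0 < t) (hj : 0 < j)
    (hs : Summable fun k : ℕ => Real.exp (-(t * (j * (j + k) * (j + (j + k)) / 2)))) :
    |2 * (∑' k : ℕ, Real.exp (-(t * (j * (j + k) * (j + (j + k)) / 2)))) - Real.exp (-(t * j ^ 3))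
      - 2 * Ij t j - 1 / 4 * (t * (j ^ 2 * Real.exp (-(t * j ^ 3))))|
      ≤ 400 * (t ^ ((1:ℝ)/4) * j ^ (-(5:ℝ)/4)) := by
  let P : ℝ → ℝ := fun x => t * (j * x * (j + x) / 2)
  let P1 : ℝ → ℝ := fun x => t * j * (j + 2 * x) / 2
  have dP : ∀ x, HasDerivAt P (P1 x) x := fun x => by
    have h : HasDerivAt P (t * ((j * 1 * (j + x) + j * x * (0 + 1)) / 2)) x :=
      ((((hasDerivAt_id x).const_mul j).mul ((hasDerivAt_const x j).add (hasDerivAt_id x))).div_const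
        2).const_mul t
    exact h.congr_deriv (by simp only [P1]; ring)
  have dP1 : ∀ x, HasDerivAt P1 (t * j) x := fun x => by
    have h : HasDerivAt P1 (t * j * (0 + 2 * 1) / 2) x :=
      (((hasDerivAt_const x j).add ((hasDerivAt_id x).const_mul 2)).const_mul (t * j)).div_const 2
    exact h.congr_deriv (by ring)
  have dE : ∀ x, HasDerivAt (fun x => Real.exp (-P x)) (Real.exp (-P x) * -P1 x) x := fun x =>
    (dP x).neg.exp
  let f1 : ℝ → ℝ := fun x => -P1 x * Real.exp (-P x)
  let f2 : ℝ → ℝ := fun x => (P1 x ^ 2 - t * j) * Real.exp (-P x)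
  let f3 : ℝ → ℝ := fun x => (-P1 x ^ 3 + 3 * P1 x * (t * j)) * Real.exp (-P x)
  have hd1 : ∀ x, HasDerivAt (fun x => Real.exp (-P x)) (f1 x) x := fun x =>
    (dE x).congr_deriv (by simp only [f1]; ring)
  have hd2 : ∀ x, HasDerivAt f1 (f2 x) x := fun x => by
    have h : HasDerivAt f1 (-(t * j) * Real.exp (-P x) + -P1 x * (Real.exp (-P x) * -P1 x)) x :=
      (dP1 x).neg.mul (dE x)
    exact h.congr_deriv (by simp only [f2]; ring)
  have hd3 : ∀ x, HasDerivAt f2 (f3 x) x := fun x => by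
    have h : HasDerivAt f2 ((2 * P1 x ^ (2 - 1) * (t * j)) * Real.exp (-P x)
      + (P1 x ^ 2 - t * j) * (Real.exp (-P x) * -P1 x)) x :=
      (((dP1 x).pow 2).sub_const (t * j)).mul (dE x)
    exact h.congr_deriv (by simp only [f3]; norm_num; ring)
  have hc3 : Continuous f3 := by simp only [f3, P1, P]; fun_prop
  have hE : ∀ x, j ≤ x → Real.exp (-P x) ≤ Real.exp (-(t * j * x ^ 2 / 2)) := fun x hx => by
    apply Real.exp_le_exp.2
    have h0 : 0 < x := hj.trans_le hx
    have : 0 ≤ t * j * x * j := by positivity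
    simp only [P]; nlinarith
  have hP1 : ∀ x, j ≤ x → 0 ≤ P1 x ∧ P1 x ≤ 3 / 2 * (t * j * x) := fun x hx => by
    have h0 : 0 < x := hj.trans_le hx
    have : t * j * j ≤ t * j * x := by gcongr
    constructor
    · simp only [P1]; positivity
    · simp only [P1]; linarith
  have b3 : ∀ x ∈ Ioi j, ‖f3 x‖ ≤ 200 * (t ^ ((1:ℝ)/4) * j ^ ((1:ℝ)/4)) * x ^ (-(5:ℝ)/2) := by
    intro x hx
    have hx : j < x := hx
    have h0 : 0 < x := hj.trans hx
    obtain ⟨q0, q1⟩ := hP1 x hx.le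
    have hz := f3_bound (z := t * j * x ^ 2) (by positivity)
    have k1 : ‖f3 x‖ ≤ (P1 x ^ 3 + 3 * P1 x * (t * j)) * Real.exp (-(t * j * x ^ 2 / 2)) := by
      simp only [f3]
      rw [norm_mul, Real.norm_of_nonneg (Real.exp_pos _).le]
      refine mul_le_mul ?_ (hE x hx.le) (Real.exp_pos _).le (by positivity)
      have a1 : 0 ≤ P1 x ^ 3 := by positivity
      have a2 : 0 ≤ 3 * P1 x * (t * j) := by positivity
      rw [Real.norm_eq_abs, abs_le]; constructor <;> linarith
    have k2 : P1 x ^ 3 + 3 * P1 x * (t * j) ≤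
        (27 / 8 * (t * j * x ^ 2) ^ 3 + 9 / 2 * (t * j * x ^ 2) ^ 2) * x ^ (-(3:ℝ)) := by
      calc _ ≤ (3 / 2 * (t * j * x)) ^ 3 + 3 * (3 / 2 * (t * j * x)) * (t * j) := by gcongr
        _ = _ := by
          rw [Real.rpow_neg h0.le]
          norm_cast
          field_simp
          ring
    calc _ ≤ _ := k1
      _ ≤ ((27 / 8 * (t * j * x ^ 2) ^ 3 + 9 / 2 * (t * j * x ^ 2) ^ 2) * x ^ (-(3:ℝ)))
          * Real.exp (-(t * j * x ^ 2 / 2)) := by gcongr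
      _ = ((27 / 8 * (t * j * x ^ 2) ^ 3 + 9 / 2 * (t * j * x ^ 2) ^ 2)
          * Real.exp (-(t * j * x ^ 2 / 2))) * x ^ (-(3:ℝ)) := by ring
      _ ≤ (200 * (t * j * x ^ 2) ^ ((1:ℝ)/4)) * x ^ (-(3:ℝ)) := by gcongr
      _ = _ := by
        rw [Real.mul_rpow (by positivity) (by positivity), Real.mul_rpow ht.le hj.le,
          ← Real.rpow_natCast x 2, ← Real.rpow_mul h0.le]
        rw [show -(5:ℝ)/2 = ((2:ℕ):ℝ) * (1/4) + -3 by norm_num, Real.rpow_add h0]; ring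
  have ib : IntegrableOn (fun x : ℝ => 200 * (t ^ ((1:ℝ)/4) * j ^ ((1:ℝ)/4)) * x ^ (-(5:ℝ)/2)) (Ioi j) :=
    (integrableOn_Ioi_rpow_of_lt (by norm_num) hj).const_mul _
  have i3 : IntegrableOn f3 (Ioi j) := by
    refine Integrable.mono' ib hc3.aestronglyMeasurable ?_
    exact (ae_restrict_iff' measurableSet_Ioi).2 (ae_of_all _ b3)
  have hl : Tendsto (fun k : ℕ => f1 (j + k)) atTop (𝓝 0) := by
    refine squeeze_zero_norm (a := fun k : ℕ => 3 * (j + k)⁻¹) (fun k => ?_) ?_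
    · have hx : j ≤ j + k := by simp
      have h0 : 0 < j + k := hj.trans_le hx
      obtain ⟨q0, q1⟩ := hP1 _ hx
      set x := j + k
      simp only [f1]
      rw [norm_mul, Real.norm_of_nonneg (Real.exp_pos _).le, norm_neg, Real.norm_of_nonneg q0]
      calc _ ≤ 3 / 2 * (t * j * x) * Real.exp (-(t * j * x ^ 2 / 2)) := by
            exact mul_le_mul q1 (hE x hx) (Real.exp_pos _).le (by positivity)
        _ ≤ 3 / 2 * (t * j * x) * (t * j * x ^ 2 / 2)⁻¹ := by
            rw [Real.exp_neg]
            gcongr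
            linarith [Real.add_one_le_exp (t * j * x ^ 2 / 2)]
        _ = _ := by field_simp
    · have : Tendsto (fun k : ℕ => j + (k:ℝ)) atTop atTop :=
        tendsto_atTop_add_const_left _ _ tendsto_natCast_atTop_atTop
      simpa using (tendsto_inv_atTop_zero.comp this).const_mul 3
  have key := EM hd1 hd2 hd3 hc3 j ((Ij_int ht hj).mono_set Ioi_subset_Ici_self) i3 hs hl
  have r : ∫ x in Ioi j, |f3 x| ≤ 200 * (t ^ ((1:ℝ)/4) * j ^ (-(5:ℝ)/4)) := by
    calc _ ≤ ∫ x in Ioi j, 200 * (t ^ ((1:ℝ)/4) * j ^ ((1:ℝ)/4)) * x ^ (-(5:ℝ)/2) :=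
          setIntegral_mono_on i3.norm ib measurableSet_Ioi b3
      _ = 200 * (t ^ ((1:ℝ)/4) * j ^ ((1:ℝ)/4)) * (2 / 3 * j ^ (-(3:ℝ)/2)) := by
          rw [integral_const_mul, integral_Ioi_rpow_of_lt (by norm_num) hj]
          norm_num; left; ring
      _ = 2 / 3 * (200 * (t ^ ((1:ℝ)/4) * j ^ (-(5:ℝ)/4))) := by
          rw [show -(5:ℝ)/4 = 1/4 + -(3:ℝ)/2 by norm_num, Real.rpow_add hj]; ring
      _ ≤ _ := by
          have : 0 ≤ 200 * (t ^ ((1:ℝ)/4) * j ^ (-(5:ℝ)/4)) := by positivity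
          linarith
  have k := key.trans r
  simp only [f1, P1, P] at k
  have e : t * (j * j * (j + j) / 2) = t * j ^ 3 := by ring
  rw [e] at k
  change |_ - _ + _ - Ij t j| ≤ _ at k
  rw [abs_le] at k ⊢
  constructor <;> nlinarith [k.1, k.2]

theorem Th_em : ∃ a b C : ℝ, 0 < a ∧ 0 < b ∧ 0 < C ∧ ∀ t : ℝ, 0 < t → t ≤ 1 →
    |Th t - a * t ^ (-(2:ℝ)/3) + b * t ^ (-(1:ℝ)/2) - 1 / 3| ≤ C * t ^ ((1:ℝ)/4) := by
  obtain ⟨a, b, C, ha, hb, hC, h⟩ := Isum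
  obtain ⟨C', hC', h'⟩ := T_em
  have sz : Summable fun J : ℕ => ((J:ℝ) + 1) ^ (-(5:ℝ)/4) := by
    have := (summable_nat_add_iff 1).2 (Real.summable_nat_rpow.2 (by norm_num : -(5:ℝ)/4 < -1))
    simpa using this
  set Z := ∑' J : ℕ, ((J:ℝ) + 1) ^ (-(5:ℝ)/4) with hZ
  have hZ0 : 0 ≤ Z := by positivity
  refine ⟨2 * a, 2 * b, 2 * C + C' + 400 * Z, by positivity, by positivity, by positivity, fun t ht ht1 => ?_⟩
  have s0 := Th_summable ht
  have s1 := tri_split s0 (fun a b => by rw [dn_swap])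
  have s2 := (Ij_sum ht).summable.hasSum
  have s3 : HasSum (fun J : ℕ => t * (((J:ℝ)+1) ^ 2 * Real.exp (-(t * ((J:ℝ)+1) ^ 3))))
      (t * (∑' k:ℕ,(k:ℝ)^2*Real.exp (-(t*k^3)))) := by
    refine HasSum.mul_left _ ?_
    have := ((sum_pow 2 ht).hasSum)
    rw [← hasSum_nat_add_iff' 1] at this
    simpa using this
  have hd := (s1.sub (s2.mul_left 2)).sub (s3.mul_left (1/4))
  have bd : ∀ J : ℕ, ‖2 * (∑' k : ℕ, Real.exp (-(t * dn (J, J + k)))) - Real.exp (-(t * dn (J, J)))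
      - 2 * Ij t ((J:ℝ) + 1) - 1 / 4 * (t * (((J:ℝ)+1) ^ 2 * Real.exp (-(t * ((J:ℝ)+1) ^ 3))))‖
      ≤ 400 * (t ^ ((1:ℝ)/4) * ((J:ℝ)+1) ^ (-(5:ℝ)/4)) := by
    intro J
    have e1 : ∀ k : ℕ, (dn (J, J + k) : ℝ) = ((J:ℝ)+1) * ((J:ℝ) + 1 + k) * ((J:ℝ) + 1 + ((J:ℝ) + 1 + k)) / 2 := by
      intro k; rw [dn_cast]; push_cast; ring
    have e2 : (dn (J, J) : ℝ) = ((J:ℝ)+1) ^ 3 := by rw [dn_cast]; push_cast; ring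
    have hs : Summable fun k : ℕ => Real.exp (-(t * dn (J, J + k))) :=
      s0.comp_injective (i := fun k : ℕ => (J, J + k)) (fun k l hkl => by simpa using hkl)
    simp_rw [e2, e1] at hs ⊢
    exact Sj_em ht (by positivity) hs
  have tot := tsum_of_norm_bounded ((sz.hasSum.mul_left (t ^ ((1:ℝ)/4))).mul_left 400) bd
  rw [hd.tsum_eq, Real.norm_eq_abs, ← hZ] at tot
  have q1 := h t ht
  have q2 := h' t ht
  have p1 : t ^ ((1:ℝ)/3) ≤ t ^ ((1:ℝ)/4) := Real.rpow_le_rpow_of_exponent_ge ht ht1 (by norm_num)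
  have p2 : t ≤ t ^ ((1:ℝ)/4) := by
    conv_lhs => rw [← Real.rpow_one t]
    exact Real.rpow_le_rpow_of_exponent_ge ht ht1 (by norm_num)
  have p1' := mul_le_mul_of_nonneg_left p1 hC.le
  have p2' := mul_le_mul_of_nonneg_left p2 hC'.le
  have p3 : 0 ≤ C' * t ^ ((1:ℝ)/4) := by positivity
  change |Th t - _ - _| ≤ _ at tot
  rw [abs_le] at tot q1 q2 ⊢
  constructor <;> linarith [tot.1, tot.2, q1.1, q1.2, q2.1, q2.2]

theorem Th_tail {x : ℝ} (hx : 1 ≤ x) : Th x ≤ Th (1/2) * Real.exp (-(x/2)) := by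
  rw [Th, Th, ← tsum_mul_right]
  refine Summable.tsum_le_tsum (fun p => ?_) (Th_summable (by linarith))
    ((Th_summable (by norm_num)).mul_right _)
  rw [← Real.exp_add]
  apply Real.exp_le_exp.2
  have : ((p.1 + p.2 + 1 : ℕ):ℝ) ≤ dn p := by exact_mod_cast dn_ge p
  push_cast at this
  have h1 : (1:ℝ) ≤ dn p := by
    have := Nat.cast_nonneg (α := ℝ) p.1
    have := Nat.cast_nonneg (α := ℝ) p.2
    linarith
  nlinarith

theorem Th_cont : ContinuousOn Th (Ioi 0) := by
  intro x hx
  have hx : 0 < x := hx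
  have h2 : ContinuousOn Th (Ioi (x/2)) := by
    refine continuousOn_tsum (u := fun p : ℕ × ℕ => Real.exp (-(x / 2 * dn p))) (fun p => by fun_prop)
      (Th_summable (by positivity)) fun p y hy => ?_
    rw [Real.norm_of_nonneg (Real.exp_pos _).le]
    apply Real.exp_le_exp.2
    have hy : x / 2 < y := hy
    have := Nat.cast_nonneg (α := ℝ) (dn p)
    nlinarith
  exact (h2.continuousAt (Ioi_mem_nhds (by linarith))).continuousWithinAt

theorem Th_nonneg (t : ℝ) : 0 ≤ Th t := by unfold Th; positivity

end SU3

namespace SU3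
open MeasureTheory Set Topology

theorem riemann {h G : ℝ → ℝ} (hc : ContinuousOn h (Ioi 0)) (hb : ∀ x, 0 < x → |h x| ≤ G x)
    (ha : AntitoneOn G (Ioi 0)) (hi : IntegrableOn G (Ioi 0)) :
    (∀ t : ℝ, 0 < t → Summable fun k : ℕ => t * h (t * (k + 1))) ∧
    Tendsto (fun t : ℝ => ∑' k : ℕ, t * h (t * (k + 1))) (𝓝[>] 0) (𝓝 (∫ x in Ioi 0, h x)) := by
  let φ : ℝ → ℝ → ℝ := fun t x => h (t * ((⌊x / t⌋₊ : ℝ) + 1))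
  have hm : ∀ t, Measurable (φ t) := fun t => by
    have h1 : Measurable fun k : ℕ => h (t * ((k:ℝ) + 1)) := measurable_from_nat
    exact h1.comp (Nat.measurable_floor.comp (measurable_id.div_const t))
  have hbd : ∀ t, 0 < t → ∀ x ∈ Ioi (0:ℝ), ‖φ t x‖ ≤ G x := by
    intro t ht x hx
    have h1 : x ≤ t * ((⌊x / t⌋₊ : ℝ) + 1) := by
      have := (Nat.lt_floor_add_one (x / t)).le
      rw [div_le_iff₀ ht] at this; linarith
    have h2 : (0:ℝ) < t * ((⌊x / t⌋₊ : ℝ) + 1) := by positivity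
    exact (hb _ h2).trans (ha hx h2 h1)
  have hφi : ∀ t, 0 < t → IntegrableOn (φ t) (Ici 0) := fun t ht => by
    rw [integrableOn_Ici_iff_integrableOn_Ioi]
    exact Integrable.mono' hi (hm t).aestronglyMeasurable
      ((ae_restrict_iff' measurableSet_Ioi).2 (ae_of_all _ (hbd t ht)))
  have hS : ∀ t, 0 < t → HasSum (fun k : ℕ => t * h (t * (k + 1))) (∫ x in Ioi 0, φ t x) := by
    intro t ht
    have hmono : Monotone fun k : ℕ => t * (k:ℝ) := fun a b hab => by
      have : (a:ℝ) ≤ b := by exact_mod_cast hab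
      dsimp only; gcongr
    have hU : ⋃ k : ℕ, Ico (t * (k:ℝ)) (t * ((Order.succ k : ℕ):ℝ)) = Ici 0 := by
      ext x
      simp only [mem_iUnion, mem_Ico, mem_Ici, Nat.succ_eq_succ]
      constructor
      · rintro ⟨k, h1, -⟩
        exact le_trans (by positivity) h1
      · intro hx
        refine ⟨⌊x / t⌋₊, ?_, ?_⟩
        · have := Nat.floor_le (div_nonneg hx ht.le)
          rw [le_div_iff₀ ht] at this; linarith
        · have := (Nat.lt_floor_add_one (x / t))
          rw [div_lt_iff₀ ht] at this; push_cast; linarith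
    have := hasSum_integral_iUnion (f := φ t) (μ := volume)
      (s := fun k : ℕ => Ico (t * (k:ℝ)) (t * ((Order.succ k : ℕ):ℝ)))
      (fun k => measurableSet_Ico) hmono.pairwise_disjoint_on_Ico_succ (by rw [hU]; exact hφi t ht)
    rw [hU, integral_Ici_eq_integral_Ioi] at this
    have e : (fun k : ℕ => t * h (t * (k + 1))) =
      fun k : ℕ => ∫ x in Ico (t * (k:ℝ)) (t * ((Order.succ k : ℕ):ℝ)), φ t x := by
      funext k
      have : ∫ x in Ico (t * (k:ℝ)) (t * ((Order.succ k : ℕ):ℝ)), φ t x =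
          ∫ x in Ico (t * (k:ℝ)) (t * ((Order.succ k : ℕ):ℝ)), h (t * (k + 1)) := by
        refine setIntegral_congr_fun measurableSet_Ico fun x hx => ?_
        have h1 : ⌊x / t⌋₊ = k := by
          rw [Nat.floor_eq_iff (div_nonneg (le_trans (by positivity) hx.1) ht.le), le_div_iff₀ ht,
            div_lt_iff₀ ht]
          have := hx.2
          simp only [Nat.succ_eq_succ] at this
          push_cast at this
          exact ⟨by linarith [hx.1], by linarith⟩
        simp only [φ, h1]
      rw [this, setIntegral_const]
      simp only [Nat.succ_eq_succ, Measure.real, Real.volume_Ico, smul_eq_mul]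
      rw [ENNReal.toReal_ofReal (by push_cast; nlinarith)]
      push_cast; ring
    rw [e]; exact this
  refine ⟨fun t ht => (hS t ht).summable, ?_⟩
  have lim : Tendsto (fun t => ∫ x in Ioi 0, φ t x) (𝓝[>] 0) (𝓝 (∫ x in Ioi 0, h x)) := by
    refine tendsto_integral_filter_of_dominated_convergence G ?_ ?_ hi ?_
    · exact Eventually.of_forall fun t => (hm t).aestronglyMeasurable
    · filter_upwards [self_mem_nhdsWithin] with t ht
      exact (ae_restrict_iff' measurableSet_Ioi).2 (ae_of_all _ (hbd t ht))
    · refine (ae_restrict_iff' measurableSet_Ioi).2 (ae_of_all _ fun x hx => ?_)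
      refine ((hc.continuousAt (Ioi_mem_nhds hx)).tendsto).comp ?_
      have hx : 0 < x := hx
      have t1 : Tendsto (fun t : ℝ => x + t) (𝓝[>] 0) (𝓝 x) := by
        have : Tendsto (fun t : ℝ => x + t) (𝓝 0) (𝓝 (x + 0)) := by
          exact (continuous_const.add continuous_id).tendsto 0
        rw [add_zero] at this
        exact this.mono_left nhdsWithin_le_nhds
      refine tendsto_of_tendsto_of_tendsto_of_le_of_le' tendsto_const_nhds t1 ?_ ?_
      · filter_upwards [self_mem_nhdsWithin] with t ht
        have := (Nat.lt_floor_add_one (x / t)).le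
        rw [div_le_iff₀ ht] at this; linarith
      · filter_upwards [self_mem_nhdsWithin] with t ht
        have ht : 0 < t := ht
        have := Nat.floor_le (div_nonneg hx.le ht.le)
        rw [le_div_iff₀ ht] at this; linarith
  refine lim.congr' ?_
  filter_upwards [self_mem_nhdsWithin] with t ht
  exact (hS t ht).tsum_eq.symm

/-- frequencies -/
def Nf (i : (ℕ × ℕ) × ℕ) : ℕ := (i.2 + 1) * dn i.1
/-- weights -/
noncomputable def cf (i : (ℕ × ℕ) × ℕ) : ℝ := 1 / ((i.2:ℝ) + 1)
/-- log of the generating function -/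
noncomputable def Fr (t : ℝ) : ℝ := ∑' i, cf i * Real.exp (-(t * Nf i))

theorem cf_pos (i) : 0 < cf i := by unfold cf; positivity
theorem cf_le (i) : cf i ≤ 1 := by
  unfold cf; rw [div_le_one (by positivity)]; linarith [Nat.cast_nonneg (α := ℝ) i.2]

theorem Fr_summable {t : ℝ} (ht : 0 < t) : Summable fun i => cf i * Real.exp (-(t * Nf i)) := by
  have h1 : Summable fun n : ℕ => Real.exp (-t) ^ n :=
    summable_geometric_of_lt_one (Real.exp_pos _).le (by rw [Real.exp_lt_one_iff]; linarith)
  have h2 := (Th_summable ht).mul_of_nonneg h1 (fun n => by positivity) (fun n => by positivity)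
  refine Summable.of_nonneg_of_le (fun i => mul_nonneg (cf_pos i).le (Real.exp_pos _).le) (fun i => ?_) h2
  rw [← Real.exp_nat_mul, ← Real.exp_add]
  refine (mul_le_of_le_one_left (Real.exp_pos _).le (cf_le i)).trans (Real.exp_le_exp.2 ?_)
  have h3 : i.2 + dn i.1 ≤ Nf i := by
    have := dn_ge i.1
    unfold Nf
    obtain ⟨d, hd⟩ : ∃ d, dn i.1 = d + 1 := ⟨dn i.1 - 1, by omega⟩
    rw [hd]; nlinarith [Nat.zero_le (i.2 * d)]
  have h3 : (i.2:ℝ) + dn i.1 ≤ Nf i := by exact_mod_cast h3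
  nlinarith

theorem Fr_hasSum {t : ℝ} (ht : 0 < t) : HasSum (fun k : ℕ => Th (t * (k + 1)) / (k + 1)) (Fr t) := by
  have h1 := (Equiv.prodComm ℕ (ℕ × ℕ)).hasSum_iff.2 (Fr_summable ht).hasSum
  refine h1.prod_fiberwise fun k => ?_
  have h2 := (Th_summable (t := t * (k + 1)) (by positivity)).hasSum.div_const ((k:ℝ) + 1)
  have e : ((fun i => cf i * Real.exp (-(t * Nf i))) ∘ (Equiv.prodComm ℕ (ℕ × ℕ))) ∘ (fun p => (k, p)) =
      fun p : ℕ × ℕ => Real.exp (-(t * (k + 1) * dn p)) / ((k:ℝ) + 1) := by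
    funext p
    simp only [Function.comp, Equiv.prodComm_apply, Prod.swap, cf, Nf]
    push_cast
    rw [mul_assoc]; ring
  rw [← e] at h2
  exact h2

theorem log_lim : Tendsto (fun t : ℝ => -Real.log (1 - Real.exp (-t)) + Real.log t) (𝓝[>] 0) (𝓝 0) := by
  have h1 : HasDerivAt (fun t : ℝ => 1 - Real.exp (-t)) 1 0 := by
    have h : HasDerivAt (fun t : ℝ => 1 - Real.exp (-t)) (-(Real.exp (-0) * -1)) 0 :=
      ((hasDerivAt_neg (0:ℝ)).exp).const_sub 1
    exact h.congr_deriv (by simp)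
  have h2 := h1.tendsto_slope_zero_right
  have h3 := (Real.continuousAt_log one_ne_zero).tendsto.comp h2
  rw [Real.log_one] at h3
  have h4 := h3.neg
  rw [neg_zero] at h4
  refine h4.congr' ?_
  filter_upwards [self_mem_nhdsWithin] with t ht
  have ht : 0 < t := ht
  have h5 : 0 < 1 - Real.exp (-t) := by
    have : Real.exp (-t) < 1 := by rw [Real.exp_lt_one_iff]; linarith
    linarith
  simp only [Function.comp, zero_add, Real.exp_zero, sub_self, sub_zero, smul_eq_mul]
  rw [Real.log_mul (by positivity) h5.ne', Real.log_inv]; ring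

theorem Fr_asy : ∃ a b d : ℝ, 0 < a ∧ 0 < b ∧
    Tendsto (fun t => Fr t - (a * t ^ (-(2:ℝ)/3) - b * t ^ (-(1:ℝ)/2) - 1/3 * Real.log t)) (𝓝[>] 0) (𝓝 d) := by
  obtain ⟨a, b, C, ha, hb, hC, h⟩ := Th_em
  let ρ : ℝ → ℝ := fun x => Th x - a * x ^ (-(2:ℝ)/3) + b * x ^ (-(1:ℝ)/2) - Real.exp (-x) / 3
  let D : ℝ := C + 1 + (Th (1/2) * 2 + a + b + 1)
  have hT := Th_nonneg (1/2)
  have hD : 0 < D := by positivity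
  let G : ℝ → ℝ := fun x => D * min (x ^ (-(3:ℝ)/4)) (x ^ (-(3:ℝ)/2))
  have hGb : ∀ x, 0 < x → |ρ x / x| ≤ G x := by
    intro x hx
    rw [abs_div, abs_of_pos hx, div_le_iff₀ hx]
    rcases le_total x 1 with h1 | h1
    · have e1 : min (x ^ (-(3:ℝ)/4)) (x ^ (-(3:ℝ)/2)) = x ^ (-(3:ℝ)/4) :=
        min_eq_left (Real.rpow_le_rpow_of_exponent_ge hx h1 (by norm_num))
      have e2 : x ^ (-(3:ℝ)/4) * x = x ^ ((1:ℝ)/4) := by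
        rw [← Real.rpow_add_one hx.ne']; norm_num
      have p2 : x ≤ x ^ ((1:ℝ)/4) := by
        conv_lhs => rw [← Real.rpow_one x]
        exact Real.rpow_le_rpow_of_exponent_ge hx h1 (by norm_num)
      simp only [G]
      rw [e1, mul_assoc, e2]
      have q1 := h x hx h1
      have q2 := Real.add_one_le_exp (-x)
      have q3 : Real.exp (-x) ≤ 1 := Real.exp_le_one_iff.2 (by linarith)
      have q4 : (C + 1) * x ^ ((1:ℝ)/4) ≤ D * x ^ ((1:ℝ)/4) := by
        gcongr; simp only [D]; linarith
      simp only [ρ]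
      rw [abs_le] at q1 ⊢
      constructor <;> linarith [q1.1, q1.2]
    · have e1 : min (x ^ (-(3:ℝ)/4)) (x ^ (-(3:ℝ)/2)) = x ^ (-(3:ℝ)/2) :=
        min_eq_right (Real.rpow_le_rpow_of_exponent_le h1 (by norm_num))
      have e2 : x ^ (-(3:ℝ)/2) * x = x ^ (-(1:ℝ)/2) := by
        rw [← Real.rpow_add_one hx.ne']; norm_num
      simp only [G]
      rw [e1, mul_assoc, e2]
      set y := x ^ (-(1:ℝ)/2) with hy
      have hy0 : 0 < y := by positivity
      have p0 : x⁻¹ ≤ y := by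
        rw [← Real.rpow_neg_one, hy]
        exact Real.rpow_le_rpow_of_exponent_le h1 (by norm_num)
      have p1 : Real.exp (-(x/2)) ≤ 2 * y := by
        refine le_trans ?_ (mul_le_mul_of_nonneg_left p0 zero_le_two)
        rw [Real.exp_neg, show 2 * x⁻¹ = (x/2)⁻¹ by field_simp]
        gcongr
        linarith [Real.add_one_le_exp (x/2)]
      have p2 : Real.exp (-x) ≤ y := by
        refine le_trans ?_ p0
        rw [Real.exp_neg]
        gcongr
        linarith [Real.add_one_le_exp x]
      have p3 : x ^ (-(2:ℝ)/3) ≤ y := Real.rpow_le_rpow_of_exponent_le h1 (by norm_num)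
      have p4 : 0 < x ^ (-(2:ℝ)/3) := by positivity
      have p5 := Th_nonneg x
      have p6 := (Th_tail h1).trans (mul_le_mul_of_nonneg_left p1 hT)
      have p7 := Real.exp_pos (-x)
      have p8 := mul_le_mul_of_nonneg_left p3 ha.le
      have p9 := mul_pos ha p4
      simp only [ρ, D]
      rw [← hy, abs_le]
      have := mul_pos hC hy0
      have := mul_pos ha hy0
      have := mul_pos hb hy0
      have := mul_nonneg hT hy0.le
      constructor <;> nlinarith
  have hGa : AntitoneOn G (Ioi 0) := by
    intro x hx y hy hxy
    have hx : 0 < x := hx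
    simp only [G]
    refine mul_le_mul_of_nonneg_left (min_le_min ?_ ?_) hD.le
    · exact Real.rpow_le_rpow_of_nonpos hx hxy (by norm_num)
    · exact Real.rpow_le_rpow_of_nonpos hx hxy (by norm_num)
  have hGi : IntegrableOn G (Ioi 0) := by
    refine Integrable.const_mul ?_ _
    have hme : Measurable fun x : ℝ => min (x ^ (-(3:ℝ)/4)) (x ^ (-(3:ℝ)/2)) := by fun_prop
    change IntegrableOn (fun x : ℝ => min (x ^ (-(3:ℝ)/4)) (x ^ (-(3:ℝ)/2))) (Ioi 0)
    rw [← Ioc_union_Ioi_eq_Ioi (show (0:ℝ) ≤ 1 by norm_num)]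
    refine IntegrableOn.union ?_ ?_
    · have i1 : IntegrableOn (fun x : ℝ => x ^ (-(3:ℝ)/4)) (Ioc 0 1) := by
        rw [← intervalIntegrable_iff_integrableOn_Ioc_of_le zero_le_one]
        exact intervalIntegral.intervalIntegrable_rpow' (by norm_num)
      refine Integrable.mono' i1 hme.aestronglyMeasurable ?_
      refine (ae_restrict_iff' measurableSet_Ioc).2 (ae_of_all _ fun x hx => ?_)
      have := hx.1
      rw [Real.norm_of_nonneg (by positivity)]
      exact min_le_left _ _
    · have i1 : IntegrableOn (fun x : ℝ => x ^ (-(3:ℝ)/2)) (Ioi 1) :=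
        integrableOn_Ioi_rpow_of_lt (by norm_num) one_pos
      refine Integrable.mono' i1 hme.aestronglyMeasurable ?_
      refine (ae_restrict_iff' measurableSet_Ioi).2 (ae_of_all _ fun x hx => ?_)
      have : 0 < x := one_pos.trans hx
      rw [Real.norm_of_nonneg (by positivity)]
      exact min_le_right _ _
  have hcr : ∀ q : ℝ, ContinuousOn (fun x : ℝ => x ^ q) (Ioi 0) := fun q x hx =>
    (Real.continuousAt_rpow_const _ _ (Or.inl (ne_of_gt hx))).continuousWithinAt
  have hhc : ContinuousOn (fun x => ρ x / x) (Ioi 0) := by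
    refine ContinuousOn.div ?_ continuousOn_id fun x hx => ne_of_gt hx
    exact ((Th_cont.sub (continuousOn_const.mul (hcr _))).add (continuousOn_const.mul (hcr _))).sub
      (by fun_prop)
  obtain ⟨r1, r2⟩ := riemann hhc hGb hGa hGi
  have sz : ∀ q : ℝ, q < -1 → Summable fun J : ℕ => ((J:ℝ) + 1) ^ q := fun q hq => by
    have := (summable_nat_add_iff 1).2 (Real.summable_nat_rpow.2 hq)
    simpa using this
  have zp : ∀ q : ℝ, q < -1 → 0 < ∑' J : ℕ, ((J:ℝ) + 1) ^ q := fun q hq =>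
    (sz q hq).tsum_pos (fun J => by positivity) 0 (by norm_num)
  refine ⟨a * ∑' J : ℕ, ((J:ℝ) + 1) ^ (-(5:ℝ)/3), b * ∑' J : ℕ, ((J:ℝ) + 1) ^ (-(3:ℝ)/2),
    ∫ x in Ioi 0, ρ x / x, mul_pos ha (zp _ (by norm_num)), mul_pos hb (zp _ (by norm_num)), ?_⟩
  have fin := r2.add (log_lim.const_mul (1/3))
  rw [mul_zero, add_zero] at fin
  refine fin.congr' ?_
  filter_upwards [self_mem_nhdsWithin] with t ht
  have ht : 0 < t := ht
  have hx : |Real.exp (-t)| < 1 := by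
    rw [abs_of_pos (Real.exp_pos _), Real.exp_lt_one_iff]; linarith
  have hl := (Real.hasSum_pow_div_log_of_abs_lt_one hx).mul_left (1/3)
  have hA := (sz (-(5:ℝ)/3) (by norm_num)).hasSum.mul_left (a * t ^ (-(2:ℝ)/3))
  have hB := (sz (-(3:ℝ)/2) (by norm_num)).hasSum.mul_left (b * t ^ (-(1:ℝ)/2))
  have hR := (r1 t ht).hasSum
  have tot := ((hA.sub hB).add hl).add hR
  have e : (fun k : ℕ => Th (t * (k + 1)) / (k + 1)) = fun k : ℕ =>
      a * t ^ (-(2:ℝ)/3) * ((k:ℝ) + 1) ^ (-(5:ℝ)/3) - b * t ^ (-(1:ℝ)/2) * ((k:ℝ) + 1) ^ (-(3:ℝ)/2)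
      + 1 / 3 * (Real.exp (-t) ^ (k + 1) / ((k:ℝ) + 1)) + t * (ρ (t * (k + 1)) / (t * (k + 1))) := by
    funext k
    have hk : (0:ℝ) < k + 1 := by positivity
    simp only [ρ]
    rw [Real.mul_rpow ht.le hk.le, Real.mul_rpow ht.le hk.le, ← Real.exp_nat_mul,
      show -(5:ℝ)/3 = -(2:ℝ)/3 - 1 by norm_num, show -(3:ℝ)/2 = -(1:ℝ)/2 - 1 by norm_num,
      Real.rpow_sub_one hk.ne', Real.rpow_sub_one hk.ne',
      show ((k + 1 : ℕ):ℝ) * -t = -(t * (k + 1)) by push_cast; ring]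
    field_simp
    ring
  have key := Fr_hasSum ht
  rw [e] at key
  have := key.unique tot
  rw [this]
  ring

end SU3

namespace SU3
open MeasureTheory Set Topology

noncomputable def Fc (z : ℂ) : ℂ := ∑' i, (cf i : ℂ) * Complex.exp (-(z * Nf i))
noncomputable def M1 (t : ℝ) : ℝ := ∑' i, cf i * (Nf i * Real.exp (-(t * Nf i)))
noncomputable def M2 (t : ℝ) : ℝ := ∑' i, cf i * ((Nf i : ℝ) ^ 2 * Real.exp (-(t * Nf i)))

theorem norm_term (z : ℂ) (i) : ‖(cf i : ℂ) * Complex.exp (-(z * Nf i))‖ = cf i * Real.exp (-(z.re * Nf i)) := by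
  rw [norm_mul, Complex.norm_real, Real.norm_of_nonneg (cf_pos i).le, Complex.norm_exp]
  simp

theorem Fc_summable {z : ℂ} (hz : 0 < z.re) : Summable fun i => (cf i : ℂ) * Complex.exp (-(z * Nf i)) := by
  refine Summable.of_norm ?_
  simp_rw [norm_term]
  exact Fr_summable hz

theorem Fc_ofReal (t : ℝ) : Fc t = Fr t := by
  rw [Fc, Fr, Complex.ofReal_tsum]
  refine tsum_congr fun i => ?_
  push_cast; rfl

theorem pow_exp_bound {u : ℝ} (hu : 0 ≤ u) (k : ℕ) : u ^ k ≤ k.factorial * 2 ^ k * Real.exp (u / 2) := by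
  have h := Real.pow_div_factorial_le_exp (u / 2) (by positivity) k
  rw [div_le_iff₀ (by positivity), div_pow, div_le_iff₀ (by positivity)] at h
  linarith

theorem M_summable (k : ℕ) {t : ℝ} (ht : 0 < t) :
    Summable fun i => cf i * ((Nf i : ℝ) ^ k * Real.exp (-(t * Nf i))) := by
  refine Summable.of_nonneg_of_le (fun i => mul_nonneg (cf_pos i).le (by positivity)) (fun i => ?_)
    ((Fr_summable (half_pos ht)).mul_left (k.factorial * 2 ^ k / t ^ k))
  have h := pow_exp_bound (u := t * Nf i) (by positivity) k
  rw [mul_left_comm (k.factorial * 2 ^ k / t ^ k : ℝ)]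
  refine mul_le_mul_of_nonneg_left ?_ (cf_pos i).le
  have e : Real.exp (-(t * Nf i)) = Real.exp (-(t * Nf i / 2)) * Real.exp (-(t * Nf i / 2)) := by
    rw [← Real.exp_add]; congr 1; ring
  have e2 : Real.exp (t * Nf i / 2) * Real.exp (-(t * Nf i / 2)) = 1 := by
    rw [← Real.exp_add]; simp
  rw [e, show t / 2 * (Nf i:ℝ) = t * Nf i / 2 by ring, ← mul_assoc]
  refine mul_le_mul_of_nonneg_right ?_ (Real.exp_pos _).le
  rw [le_div_iff₀ (by positivity)]
  calc _ = (t * Nf i) ^ k * Real.exp (-(t * Nf i / 2)) := by ring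
    _ ≤ (k.factorial * 2 ^ k * Real.exp (t * Nf i / 2)) * Real.exp (-(t * Nf i / 2)) := by gcongr
    _ = _ := by rw [mul_assoc, e2, mul_one]

theorem cubic {t : ℝ} (ht : 0 < t) {w : ℂ} (hw : ‖w‖ ≤ t / 4) :
    ‖Fc (t + w) - Fr t + w * M1 t - w ^ 2 / 2 * M2 t‖ ≤ 48 * ‖w‖ ^ 3 / t ^ 3 * Fr (t / 4) := by
  have hre : 0 < ((t:ℂ) + w).re := by
    have := (abs_le.1 (Complex.abs_re_le_norm w)).1
    simp only [Complex.add_re, Complex.ofReal_re]; linarith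
  have s0 := (Fc_summable hre).hasSum
  have s1 : HasSum _ ((Fr t : ℝ) : ℂ) := Complex.hasSum_ofReal.2 (Fr_summable ht).hasSum
  have m1 : Summable fun i => cf i * (Nf i * Real.exp (-(t * Nf i))) := by
    simpa using (M_summable 1 ht)
  have s2 : HasSum _ ((M1 t : ℝ) : ℂ) := Complex.hasSum_ofReal.2 m1.hasSum
  have s3 : HasSum _ ((M2 t : ℝ) : ℂ) := Complex.hasSum_ofReal.2 (M_summable 2 ht).hasSum
  have tot := ((s0.sub s1).add (s2.mul_left w)).sub (s3.mul_left (w ^ 2 / 2))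
  have hb := tsum_of_norm_bounded (((Fr_summable (show 0 < t / 4 by positivity)).hasSum.mul_left (48 * ‖w‖ ^ 3 / t ^ 3)))
    (f := fun i => (cf i : ℂ) * Complex.exp (-((t + w) * Nf i)) - ((cf i * Real.exp (-(t * Nf i)) : ℝ) : ℂ)
      + w * ((cf i * (Nf i * Real.exp (-(t * Nf i))) : ℝ) : ℂ)
      - w ^ 2 / 2 * ((cf i * ((Nf i : ℝ) ^ 2 * Real.exp (-(t * Nf i))) : ℝ) : ℂ)) (fun i => ?_)
  · rw [tot.tsum_eq] at hb
    exact hb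
  · have h := Complex.norm_exp_sub_sum_le_norm_mul_exp (-(w * Nf i)) 3
    have e : (cf i : ℂ) * Complex.exp (-((t + w) * Nf i)) - ((cf i * Real.exp (-(t * Nf i)) : ℝ) : ℂ)
      + w * ((cf i * (Nf i * Real.exp (-(t * Nf i))) : ℝ) : ℂ)
      - w ^ 2 / 2 * ((cf i * ((Nf i : ℝ) ^ 2 * Real.exp (-(t * Nf i))) : ℝ) : ℂ) =
      ((cf i * Real.exp (-(t * Nf i)) : ℝ) : ℂ) * (Complex.exp (-(w * Nf i)) -
        ∑ m ∈ Finset.range 3, (-(w * Nf i)) ^ m / (m.factorial : ℂ)) := by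
      rw [show -(((t:ℂ) + w) * Nf i) = -(t * Nf i) + -(w * Nf i) by ring, Complex.exp_add]
      simp only [Finset.sum_range_succ, Finset.sum_range_zero, Nat.factorial]
      push_cast
      ring
    have hn : ‖-(w * Nf i)‖ = ‖w‖ * Nf i := by simp
    rw [e, norm_mul, Complex.norm_real, Real.norm_of_nonneg (mul_nonneg (cf_pos i).le (Real.exp_pos _).le)]
    rw [hn] at h
    have h3 := pow_exp_bound (u := t * Nf i) (by positivity) 3
    norm_num [Nat.factorial] at h3
    have h4 : Real.exp (‖w‖ * Nf i) ≤ Real.exp (t * Nf i / 4) := by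
      apply Real.exp_le_exp.2
      have := mul_le_mul_of_nonneg_right hw (Nat.cast_nonneg (α := ℝ) (Nf i))
      linarith
    have e4 : Real.exp (-(t * Nf i)) * Real.exp (t * Nf i / 4) * Real.exp (t * Nf i / 2) = Real.exp (-(t / 4 * Nf i)) := by
      rw [← Real.exp_add, ← Real.exp_add]; congr 1; ring
    have c0 := (cf_pos i).le
    calc _ ≤ cf i * Real.exp (-(t * Nf i)) * ((‖w‖ * Nf i) ^ 3 * Real.exp (t * Nf i / 4)) := by
          refine mul_le_mul_of_nonneg_left (h.trans ?_) (mul_nonneg c0 (Real.exp_pos _).le)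
          gcongr
      _ = cf i * (‖w‖ ^ 3 / t ^ 3) * (Real.exp (-(t * Nf i)) * Real.exp (t * Nf i / 4)) * (t * Nf i) ^ 3 := by
          field_simp
      _ ≤ cf i * (‖w‖ ^ 3 / t ^ 3) * (Real.exp (-(t * Nf i)) * Real.exp (t * Nf i / 4)) * (48 * Real.exp (t * Nf i / 2)) := by
          gcongr
      _ = _ := by rw [← e4]; ring

theorem taylor2 (q : ℝ) : Tendsto (fun h : ℝ => ((1 + h) ^ q - 1 - q * h) / h ^ 2) (𝓝[≠] 0) (𝓝 (q * (q - 1) / 2)) := by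
  have hd : ∀ r h : ℝ, -1 < h → HasDerivAt (fun h : ℝ => (1 + h) ^ r) (r * (1 + h) ^ (r - 1)) h := by
    intro r h hh
    have h1 : HasDerivAt (fun h : ℝ => (1 + h) ^ r) ((0 + 1) * r * (1 + h) ^ (r - 1)) h :=
      ((hasDerivAt_const h (1:ℝ)).add (hasDerivAt_id h)).rpow_const (Or.inl (by simp; linarith))
    exact h1.congr_deriv (by ring)
  refine HasDerivAt.lhopital_zero_nhdsNE (f' := fun h => q * (1 + h) ^ (q - 1) - q) (g' := fun h => 2 * h) ?_ ?_ ?_ ?_ ?_ ?_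
  · have : ∀ᶠ h in 𝓝[≠] (0:ℝ), -1 < h := nhdsWithin_le_nhds (Ioi_mem_nhds (by norm_num))
    filter_upwards [this] with h hh
    have := ((hd q h hh).sub_const 1).sub ((hasDerivAt_id h).const_mul q)
    exact this.congr_deriv (by ring)
  · refine Eventually.of_forall fun h => ?_
    exact (hasDerivAt_pow 2 h).congr_deriv (by norm_num)
  · filter_upwards [self_mem_nhdsWithin] with h hh
    simpa using hh
  · refine Tendsto.mono_left ?_ nhdsWithin_le_nhds
    have h1 := (hd q 0 (by norm_num)).continuousAt.tendsto
    have h2 : Tendsto (fun h : ℝ => q * h) (𝓝 0) (𝓝 (q * 0)) := tendsto_id.const_mul q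
    have := (h1.sub_const 1).sub h2
    simpa using this
  · refine Tendsto.mono_left ?_ nhdsWithin_le_nhds
    have := (continuous_pow 2 (M := ℝ)).tendsto 0
    simpa using this
  · have h1 := (hd (q - 1) 0 (by norm_num)).tendsto_slope_zero
    have h2 := h1.const_mul (q / 2)
    simp only [add_zero, Real.one_rpow, mul_one, zero_add, smul_eq_mul] at h2
    rw [show q * (q - 1) / 2 = q / 2 * (q - 1) by ring]
    refine h2.congr' ?_
    filter_upwards [self_mem_nhdsWithin] with h hh
    have : h ≠ 0 := hh
    field_simp

/-- the main part -/
noncomputable def Pm (a b t : ℝ) : ℝ := a * t ^ (-(2:ℝ)/3) - b * t ^ (-(1:ℝ)/2) - 1/3 * Real.log t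
noncomputable def Qm (a b t : ℝ) : ℝ := -(2/3) * a * t ^ (-(5:ℝ)/3) + b / 2 * t ^ (-(3:ℝ)/2)
noncomputable def om (t : ℝ) : ℝ := t * t ^ ((1:ℝ)/3)

theorem rp_lim {q : ℝ} (hq : 0 < q) : Tendsto (fun t : ℝ => t ^ q) (𝓝[>] 0) (𝓝 0) := by
  have := (Real.continuousAt_rpow_const 0 q (Or.inr hq.le)).tendsto
  rw [Real.zero_rpow hq.ne'] at this
  exact this.mono_left nhdsWithin_le_nhds

theorem Pm_shift (a b ε : ℝ) (hε : ε ≠ 0) :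
    Tendsto (fun t => Pm a b (t + ε * om t) - Pm a b t - ε * om t * Qm a b t) (𝓝[>] 0)
      (𝓝 (ε ^ 2 * (5 / 9 * a))) := by
  have hh : Tendsto (fun t : ℝ => ε * t ^ ((1:ℝ)/3)) (𝓝[>] 0) (𝓝 0) := by
    simpa using (rp_lim (q := 1/3) (by norm_num)).const_mul ε
  have hh' : Tendsto (fun t : ℝ => ε * t ^ ((1:ℝ)/3)) (𝓝[>] 0) (𝓝[≠] 0) := by
    refine tendsto_nhdsWithin_iff.2 ⟨hh, ?_⟩
    filter_upwards [self_mem_nhdsWithin] with t ht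
    have ht : 0 < t := ht
    exact mul_ne_zero hε (by positivity)
  have l1 := ((taylor2 (-(2:ℝ)/3)).comp hh').const_mul (a * ε ^ 2)
  have l2 := (((taylor2 (-(1:ℝ)/2)).comp hh').mul (rp_lim (q := 1/6) (by norm_num))).const_mul (b * ε ^ 2)
  have l3 : Tendsto (fun t : ℝ => 1/3 * Real.log (1 + ε * t ^ ((1:ℝ)/3))) (𝓝[>] 0) (𝓝 0) := by
    have := ((Real.continuousAt_log one_ne_zero).tendsto.comp (by simpa using hh.const_add 1)).const_mul (1/3)
    simpa using this
  have l := (l1.sub l2).sub l3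
  have e : a * ε ^ 2 * (-(2:ℝ)/3 * (-(2:ℝ)/3 - 1) / 2) - b * ε ^ 2 * (-(1:ℝ)/2 * (-(1:ℝ)/2 - 1) / 2 * 0) - 0
    = ε ^ 2 * (5 / 9 * a) := by ring
  rw [e] at l
  refine l.congr' ?_
  have h1 : ∀ᶠ t : ℝ in 𝓝[>] 0, -1 < ε * t ^ ((1:ℝ)/3) := hh.eventually (Ioi_mem_nhds (by norm_num))
  filter_upwards [self_mem_nhdsWithin, h1] with t ht h1
  have ht : 0 < t := ht
  have h2 : 0 < 1 + ε * t ^ ((1:ℝ)/3) := by linarith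
  simp only [Function.comp, Pm, Qm, om]
  rw [show t + ε * (t * t ^ ((1:ℝ)/3)) = t * (1 + ε * t ^ ((1:ℝ)/3)) by ring,
    Real.mul_rpow ht.le h2.le, Real.mul_rpow ht.le h2.le, Real.log_mul ht.ne' h2.ne']
  have e1 : t ^ ((1:ℝ)/6) = t ^ (-(1:ℝ)/2) * (t ^ ((1:ℝ)/3)) ^ 2 := by
    rw [← Real.rpow_natCast, ← Real.rpow_mul ht.le, ← Real.rpow_add ht]; norm_num
  have e2 : t ^ (-(2:ℝ)/3) * (t ^ ((1:ℝ)/3)) ^ 2 = 1 := by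
    rw [← Real.rpow_natCast, ← Real.rpow_mul ht.le, ← Real.rpow_add ht]; norm_num
  have e3 : t ^ (-(5:ℝ)/3) = t ^ (-(2:ℝ)/3) / t := by rw [← Real.rpow_sub_one ht.ne']; norm_num
  have e4 : t ^ (-(3:ℝ)/2) = t ^ (-(1:ℝ)/2) / t := by rw [← Real.rpow_sub_one ht.ne']; norm_num
  have e5 : t ^ (-(2:ℝ)/3) = ((t ^ ((1:ℝ)/3)) ^ 2)⁻¹ := eq_inv_of_mul_eq_one_left e2
  rw [e1, e3, e4, e5]
  have : 0 < t ^ ((1:ℝ)/3) := by positivity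
  generalize (1 + ε * t ^ ((1:ℝ)/3)) ^ (-(2:ℝ)/3) = A
  generalize (1 + ε * t ^ ((1:ℝ)/3)) ^ (-(1:ℝ)/2) = B
  field_simp
  ring

theorem om_pos {t : ℝ} (ht : 0 < t) : 0 < om t := by unfold om; positivity

theorem central {a b d : ℝ} (hF : Tendsto (fun t => Fr t - Pm a b t) (𝓝[>] 0) (𝓝 d)) :
    (∀ z : ℂ, Tendsto (fun t : ℝ => Fc (t + z * om t) - Fr t + z * om t * M1 t - (z * om t) ^ 2 / 2 * M2 t)
      (𝓝[>] 0) (𝓝 0)) ∧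
    Tendsto (fun t => om t * (M1 t + Qm a b t)) (𝓝[>] 0) (𝓝 0) ∧
    Tendsto (fun t => om t ^ 2 * M2 t) (𝓝[>] 0) (𝓝 (10 / 9 * a)) := by
  have hcub : ∀ z : ℂ, Tendsto (fun t : ℝ => Fc (t + z * om t) - Fr t + z * om t * M1 t - (z * om t) ^ 2 / 2 * M2 t)
      (𝓝[>] 0) (𝓝 0) := by
    intro z
    have hq : Tendsto (fun t : ℝ => t / 4) (𝓝[>] 0) (𝓝[>] 0) := by
      refine tendsto_nhdsWithin_iff.2 ⟨?_, ?_⟩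
      · have : Tendsto (fun t : ℝ => t / 4) (𝓝 0) (𝓝 (0 / 4)) := tendsto_id.div_const 4
        rw [zero_div] at this
        exact this.mono_left nhdsWithin_le_nhds
      · filter_upwards [self_mem_nhdsWithin] with t ht
        have ht : 0 < t := ht
        simp only [mem_Ioi]; positivity
    have k1 : Tendsto (fun t : ℝ => t * Fr t) (𝓝[>] 0) (𝓝 0) := by
      have h0 : Tendsto (fun t : ℝ => t) (𝓝[>] 0) (𝓝 0) := tendsto_id.mono_left nhdsWithin_le_nhds
      have h1 := h0.mul hF
      have h2 := ((rp_lim (q := 1/3) (by norm_num)).const_mul a).sub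
        ((rp_lim (q := 1/2) (by norm_num)).const_mul b)
      have h3 : Tendsto (fun t : ℝ => 1/3 * (Real.log t * t ^ (1:ℝ))) (𝓝[>] 0) (𝓝 (1/3 * 0)) :=
        (tendsto_log_mul_rpow_nhdsGT_zero one_pos).const_mul _
      have h4 := h1.add (h2.sub h3)
      simp only [mul_zero, zero_mul, sub_zero, add_zero] at h4
      refine h4.congr' ?_
      filter_upwards [self_mem_nhdsWithin] with t ht
      have ht : 0 < t := ht
      have e1 : t ^ ((1:ℝ)/3) = t * t ^ (-(2:ℝ)/3) := by
        rw [mul_comm, ← Real.rpow_add_one ht.ne']; norm_num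
      have e2 : t ^ ((1:ℝ)/2) = t * t ^ (-(1:ℝ)/2) := by
        rw [mul_comm, ← Real.rpow_add_one ht.ne']; norm_num
      simp only [Pm, e1, e2, Real.rpow_one]; ring
    have k2 := (k1.comp hq).const_mul (192 * ‖z‖ ^ 3)
    rw [mul_zero] at k2
    refine squeeze_zero_norm' ?_ k2
    have hs : ∀ᶠ t : ℝ in 𝓝[>] 0, ‖z‖ * t ^ ((1:ℝ)/3) < 1 / 4 := by
      have := (rp_lim (q := 1/3) (by norm_num)).const_mul ‖z‖
      rw [mul_zero] at this
      exact this.eventually (Iio_mem_nhds (by norm_num))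
    filter_upwards [self_mem_nhdsWithin, hs] with t ht hs
    have ht : 0 < t := ht
    have hn : ‖z * (om t : ℂ)‖ = ‖z‖ * om t := by
      rw [norm_mul, Complex.norm_real, Real.norm_of_nonneg (om_pos ht).le]
    have := cubic ht (w := z * om t) (by rw [hn, om]; nlinarith)
    refine this.trans (le_of_eq ?_)
    have e3 : (t ^ ((1:ℝ)/3)) ^ 3 = t := by
      rw [← Real.rpow_natCast, ← Real.rpow_mul ht.le]; norm_num
    rw [hn, om]
    simp only [Function.comp]
    rw [mul_pow, mul_pow, e3]
    field_simp
    ring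
  have hr : ∀ ε : ℝ, Tendsto (fun t : ℝ => Fr (t + ε * om t) - Fr t + ε * om t * M1 t - (ε * om t) ^ 2 / 2 * M2 t)
      (𝓝[>] 0) (𝓝 0) := by
    intro ε
    have h := (Complex.continuous_re.tendsto 0).comp (hcub ε)
    rw [Complex.zero_re] at h
    refine h.congr fun t => ?_
    simp only [Function.comp]
    rw [← Complex.ofReal_re (Fr (t + ε * om t) - Fr t + ε * om t * M1 t - (ε * om t) ^ 2 / 2 * M2 t)]
    congr 1
    push_cast
    rw [← Fc_ofReal (t + ε * om t)]
    push_cast; rfl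
  have hP : ∀ ε : ℝ, ε ≠ 0 → Tendsto (fun t : ℝ => Fr (t + ε * om t) - Fr t - ε * om t * Qm a b t) (𝓝[>] 0)
      (𝓝 (ε ^ 2 * (5 / 9 * a))) := by
    intro ε hε
    have hh : Tendsto (fun t : ℝ => 1 + ε * t ^ ((1:ℝ)/3)) (𝓝[>] 0) (𝓝 1) := by
      simpa using ((rp_lim (q := 1/3) (by norm_num)).const_mul ε).const_add 1
    have h0 : Tendsto (fun t : ℝ => t) (𝓝[>] 0) (𝓝 0) := tendsto_id.mono_left nhdsWithin_le_nhds
    have hs : Tendsto (fun t : ℝ => t + ε * om t) (𝓝[>] 0) (𝓝[>] 0) := by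
      refine tendsto_nhdsWithin_iff.2 ⟨?_, ?_⟩
      · have := h0.mul hh
        rw [zero_mul] at this
        refine this.congr fun t => ?_
        rw [om]; ring
      · filter_upwards [self_mem_nhdsWithin, hh.eventually (Ioi_mem_nhds one_pos)] with t ht h1
        have ht : 0 < t := ht
        have h1 : 0 < 1 + ε * t ^ ((1:ℝ)/3) := h1
        have := mul_pos ht h1
        simp only [mem_Ioi, om]; linarith
    have := ((hF.comp hs).sub hF).add (Pm_shift a b ε hε)
    rw [sub_self, zero_add] at this
    refine this.congr fun t => ?_
    simp only [Function.comp]; ring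
  refine ⟨hcub, ?_, ?_⟩
  · have h := (((hr 1).sub (hr (-1))).sub ((hP 1 one_ne_zero).sub (hP (-1) (by norm_num)))).div_const 2
    norm_num at h
    refine h.congr fun t => ?_
    ring
  · have h := (((hP 1 one_ne_zero).add (hP (-1) (by norm_num)))).sub ((hr 1).add (hr (-1)))
    have e : (1:ℝ) ^ 2 * (5 / 9 * a) + (-1) ^ 2 * (5 / 9 * a) - (0 + 0) = 10 / 9 * a := by ring
    rw [e] at h
    refine h.congr fun t => ?_
    ring

end SU3

namespace SU3
open MeasureTheory Set Topology

theorem drop {t : ℝ} (ht : 0 < t) (θ : ℝ) (S : Finset (ℕ × ℕ)) :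
    ∑ p ∈ S, Real.exp (-(t * dn p)) * (1 - Real.cos (|θ| * dn p)) ≤ Fr t - (Fc (t + θ * Complex.I)).re := by
  have hre : 0 < ((t:ℂ) + θ * Complex.I).re := by simpa using ht
  have s1 := Complex.hasSum_re (Fc_summable hre).hasSum
  have s2 : HasSum _ (Fr t - (Fc (t + θ * Complex.I)).re) := (Fr_summable ht).hasSum.sub s1
  have e : ∀ i, cf i * Real.exp (-(t * Nf i)) - ((cf i : ℂ) * Complex.exp (-((t + θ * Complex.I) * Nf i))).re
      = cf i * (Real.exp (-(t * Nf i)) * (1 - Real.cos (|θ| * Nf i))) := by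
    intro i
    rw [Complex.re_ofReal_mul, Complex.exp_re]
    have e1 : (-(((t:ℂ) + θ * Complex.I) * Nf i)).re = -(t * Nf i) := by simp
    have e2 : (-(((t:ℂ) + θ * Complex.I) * Nf i)).im = -(θ * Nf i) := by simp
    have e3 : Real.cos (θ * Nf i) = Real.cos (|θ| * Nf i) := by
      rw [← Real.cos_abs (θ * Nf i), abs_mul, Nat.abs_cast]
    rw [e1, e2, Real.cos_neg, e3]; ring
  simp_rw [e] at s2
  have hinj : Function.Injective fun p : ℕ × ℕ => (p, 0) := fun p q h => by simpa using h
  have := sum_le_hasSum (S.map ⟨fun p => (p, 0), hinj⟩) (fun i _ =>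
    mul_nonneg (cf_pos i).le (mul_nonneg (Real.exp_pos _).le (by linarith [Real.cos_le_one (|θ| * Nf i)]))) s2
  rw [Finset.sum_map] at this
  simpa [cf, Nf] using this

theorem minorB : ∃ c : ℝ, 0 < c ∧ ∀ t : ℝ, 0 < t → t ≤ 1 / 64 → ∀ θ : ℝ, |θ| ≤ t →
    c * (θ / om t) ^ 2 ≤ Fr t - (Fc (t + θ * Complex.I)).re := by
  refine ⟨Real.exp (-1) * (2 / Real.pi ^ 2) / 4 ^ 8, by positivity, fun t ht ht1 θ hθ => ?_⟩
  set s := t ^ (-(1:ℝ)/3) with hs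
  have hs0 : 0 < s := by positivity
  have hs3 : s ^ 3 * t = 1 := by
    rw [hs, ← Real.rpow_natCast, ← Real.rpow_mul ht.le, ← Real.rpow_add_one ht.ne']; norm_num
  have hs8 : s ^ 8 * om t ^ 2 = 1 := by
    rw [hs, om, mul_pow, ← Real.rpow_natCast, ← Real.rpow_natCast, ← Real.rpow_natCast, ← Real.rpow_mul ht.le,
      ← Real.rpow_mul ht.le, ← Real.rpow_add ht, ← Real.rpow_add ht]; norm_num
  have hs4 : 4 ≤ s := by
    by_contra hh
    push Not at hh
    have : s ^ 3 < 4 ^ 3 := by gcongr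
    nlinarith
  set n := ⌊s / 2⌋₊ with hn
  have n1 : (n:ℝ) ≤ s / 2 := Nat.floor_le (by positivity)
  have n2 : s / 4 ≤ n := by
    have := Nat.lt_floor_add_one (s / 2)
    rw [← hn] at this; linarith
  have h := drop ht θ (Finset.Ico n (2 * n) ×ˢ Finset.Ico n (2 * n))
  refine le_trans ?_ h
  have hb : ∀ p ∈ Finset.Ico n (2 * n) ×ˢ Finset.Ico n (2 * n), Real.exp (-1) * (2 / Real.pi ^ 2 * (θ ^ 2 * (n:ℝ) ^ 6))
      ≤ Real.exp (-(t * dn p)) * (1 - Real.cos (|θ| * dn p)) := by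
    intro p hp
    rw [Finset.mem_product, Finset.mem_Ico, Finset.mem_Ico] at hp
    obtain ⟨⟨a1, a2⟩, b1, b2⟩ := hp
    have a1' : (n:ℝ) ≤ p.1 := by exact_mod_cast a1
    have a2' : (p.1:ℝ) + 1 ≤ 2 * n := by exact_mod_cast a2
    have b1' : (n:ℝ) ≤ p.2 := by exact_mod_cast b1
    have b2' : (p.2:ℝ) + 1 ≤ 2 * n := by exact_mod_cast b2
    have d1 : (dn p:ℝ) ≤ s ^ 3 := by
      rw [dn_cast]
      calc ((p.1:ℝ) + 1) * (p.2 + 1) * (p.1 + p.2 + 2) / 2 ≤ (2 * (s/2)) * (2 * (s/2)) * (4 * (s / 2)) / 2 := by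
            gcongr <;> linarith
        _ = _ := by ring
    have d2 : (n:ℝ) ^ 3 ≤ dn p := by
      rw [dn_cast]
      calc (n:ℝ) ^ 3 = n * n * (2 * n) / 2 := by ring
        _ ≤ _ := by gcongr <;> linarith
    have d3 : t * dn p ≤ 1 := by nlinarith
    have d4 : |θ| * dn p ≤ 1 := le_trans (by gcongr) d3
    have d5 : |(|θ| * dn p)| ≤ Real.pi := by
      rw [abs_of_nonneg (by positivity)]; linarith [Real.pi_gt_three]
    have d6 := Real.cos_le_one_sub_mul_cos_sq d5
    refine mul_le_mul (Real.exp_le_exp.2 (by linarith)) ?_ (by positivity) (Real.exp_pos _).le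
    have d7 : θ ^ 2 * (n:ℝ) ^ 6 ≤ (|θ| * dn p) ^ 2 := by
      rw [mul_pow, sq_abs, show (n:ℝ) ^ 6 = ((n:ℝ) ^ 3) ^ 2 by ring]
      gcongr
    have d8 : 2 / Real.pi ^ 2 * (θ ^ 2 * (n:ℝ) ^ 6) ≤ 2 / Real.pi ^ 2 * (|θ| * dn p) ^ 2 := by gcongr
    linarith
  have := Finset.card_nsmul_le_sum _ _ _ hb
  refine le_trans ?_ this
  rw [Finset.card_product, Nat.card_Ico, show 2 * n - n = n by omega, nsmul_eq_mul]
  push_cast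
  have e1 : (θ / om t) ^ 2 = θ ^ 2 * s ^ 8 := by
    rw [div_pow, div_eq_iff (pow_pos (om_pos ht) 2).ne', mul_assoc, hs8, mul_one]
  rw [e1]
  have e2 : s ^ 8 / 4 ^ 8 ≤ (n:ℝ) ^ 8 := by rw [← div_pow]; gcongr
  calc _ = Real.exp (-1) * (2 / Real.pi ^ 2) * θ ^ 2 * (s ^ 8 / 4 ^ 8) := by ring
    _ ≤ Real.exp (-1) * (2 / Real.pi ^ 2) * θ ^ 2 * (n:ℝ) ^ 8 := by gcongr
    _ = _ := by ring

theorem sin_sub_le (a b : ℝ) : |Real.sin (a + b)| ≤ |Real.sin a| + |Real.sin b| := by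
  rw [Real.sin_add]
  refine (abs_add_le _ _).trans ?_
  rw [abs_mul, abs_mul]
  have := Real.abs_cos_le_one a
  have := Real.abs_cos_le_one b
  nlinarith [abs_nonneg (Real.sin a), abs_nonneg (Real.sin b)]

theorem six_ineq {X Y Z : ℝ} (h : 1 / 4 ≤ X + Z + (Y + Y)) : 1 / 48 ≤ 2 * X ^ 2 + 2 * Y ^ 2 + 2 * Z ^ 2 := by
  have h2 : (1 / 4) ^ 2 ≤ (X + Z + (Y + Y)) ^ 2 := by gcongr
  nlinarith [sq_nonneg (X - Z), sq_nonneg (2 * X - Y), sq_nonneg (2 * Z - Y)]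

theorem minorC : ∃ c : ℝ, 0 < c ∧ ∀ t : ℝ, 0 < t → t ≤ 1 / 64 → ∀ θ : ℝ, t ≤ |θ| → |θ| ≤ Real.pi →
    c * t ^ (-(1:ℝ)/2) ≤ Fr t - (Fc (t + θ * Complex.I)).re := by
  refine ⟨Real.exp (-25) / 144, by positivity, fun t ht ht1 θ hθ1 hθ2 => ?_⟩
  set σ := t ^ (-(1:ℝ)/2) with hσ
  have hσ0 : 0 < σ := by positivity
  have hσ2 : σ ^ 2 * t = 1 := by
    rw [hσ, ← Real.rpow_natCast, ← Real.rpow_mul ht.le, ← Real.rpow_add_one ht.ne']; norm_num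
  have hσ8 : 8 ≤ σ := by
    by_contra hh
    push Not at hh
    have : σ ^ 2 < 8 ^ 2 := by gcongr
    nlinarith
  have hθ0 : 0 < |θ| := ht.trans_le hθ1
  set r := √(Real.pi / |θ|) with hr
  have hr1 : 1 ≤ r := by
    rw [hr, Real.one_le_sqrt, one_le_div hθ0]; exact hθ2
  have hr2 : r ^ 2 * |θ| = Real.pi := by
    rw [hr, Real.sq_sqrt (by positivity)]; field_simp
  set h := ⌊r⌋₊ with hh
  have h1 : (h:ℝ) ≤ r := Nat.floor_le (by positivity)
  have h2 : r / 2 ≤ h := by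
    have a1 := Nat.lt_floor_add_one r
    rw [← hh] at a1
    have a2 : 1 ≤ h := by rw [hh, Nat.one_le_floor_iff]; exact hr1
    have a3 : (1:ℝ) ≤ h := by exact_mod_cast a2
    linarith
  have hrσ : r ≤ 2 * σ := by
    by_contra hc
    push Not at hc
    have : (2 * σ) ^ 2 < r ^ 2 := by gcongr
    nlinarith [Real.pi_lt_four]
  set m := ⌈σ⌉₊ with hm
  have m1 : σ ≤ m := Nat.le_ceil _
  have m2 : (m:ℝ) ≤ 2 * σ := by
    have := (Nat.ceil_lt_add_one hσ0.le).le
    rw [← hm] at this; linarith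
  have hinj : Function.Injective fun J : ℕ => (J, 0) := fun p q h => by simpa using h
  have hd := drop ht θ ((Finset.range (m + 2 * h)).map ⟨fun J => (J, 0), hinj⟩)
  rw [Finset.sum_map] at hd
  simp only [Function.Embedding.coeFn_mk] at hd
  refine le_trans ?_ hd
  let g : ℕ → ℝ := fun J => 1 - Real.cos (|θ| * dn (J, 0))
  have g0 : ∀ J, 0 ≤ g J := fun J => by simp only [g]; linarith [Real.cos_le_one (|θ| * dn (J, 0))]
  have dT : ∀ J : ℕ, (dn (J, 0) : ℝ) = ((J:ℝ) + 1) * (J + 2) / 2 := fun J => by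
    rw [dn_cast]; simp
  have b1 : Real.exp (-25) * ∑ J ∈ Finset.range (m + 2 * h), g J ≤
      ∑ J ∈ Finset.range (m + 2 * h), Real.exp (-(t * dn (J, 0))) * (1 - Real.cos (|θ| * dn (J, 0))) := by
    rw [Finset.mul_sum]
    refine Finset.sum_le_sum fun J hJ => mul_le_mul_of_nonneg_right (Real.exp_le_exp.2 ?_) (g0 J)
    rw [Finset.mem_range] at hJ
    have hJ' : (J:ℝ) + 1 ≤ m + 2 * h := by exact_mod_cast hJ
    have hJ2 : (J:ℝ) + 2 ≤ 7 * σ := by linarith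
    have : (dn (J, 0) : ℝ) ≤ 25 * σ ^ 2 := by
      rw [dT]
      have : ((J:ℝ) + 1) * (J + 2) ≤ (7 * σ) * (7 * σ) := by gcongr; linarith
      nlinarith
    nlinarith
  refine le_trans ?_ b1
  have b2 : ∀ J : ℕ, 1 / 48 ≤ g J + g (J + h) + g (J + 2 * h) := by
    intro J
    have gs : ∀ J, g J = 2 * Real.sin (|θ| * dn (J, 0) / 2) ^ 2 := fun J => by
      have := Real.cos_two_mul (|θ| * dn (J, 0) / 2)
      have e := Real.sin_sq_add_cos_sq (|θ| * dn (J, 0) / 2)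
      rw [show 2 * (|θ| * dn (J, 0) / 2) = |θ| * dn (J, 0) by ring] at this
      simp only [g]; linarith
    rw [gs, gs, gs]
    set x := |θ| * dn (J, 0) / 2 with hx
    set y := |θ| * dn (J + h, 0) / 2 with hy
    set z := |θ| * dn (J + 2 * h, 0) / 2 with hz
    set u := |θ| * (h:ℝ) ^ 2 / 2 with hu
    have eu : u = (x + z) + (-y + -y) := by
      rw [hu, hx, hy, hz, dT, dT, dT]; push_cast; ring
    have u1 : u ≤ Real.pi / 2 := by
      have : (h:ℝ) ^ 2 ≤ r ^ 2 := by gcongr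
      rw [hu]; nlinarith
    have u2 : Real.pi / 8 ≤ u := by
      have : (r / 2) ^ 2 ≤ (h:ℝ) ^ 2 := by gcongr
      rw [hu]; nlinarith
    have u3 := Real.mul_le_sin (by linarith [Real.pi_pos]) u1
    have u4 : 1 / 4 ≤ Real.sin u := by
      refine le_trans ?_ u3
      rw [div_mul_eq_mul_div, le_div_iff₀ Real.pi_pos]; linarith
    have u5 : Real.sin u ≤ |Real.sin x| + |Real.sin z| + (|Real.sin y| + |Real.sin y|) := by
      refine (le_abs_self _).trans ?_
      rw [eu]
      refine (sin_sub_le _ _).trans (add_le_add (sin_sub_le _ _) ?_)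
      have := sin_sub_le (-y) (-y)
      rwa [Real.sin_neg, abs_neg] at this
    rw [← sq_abs (Real.sin x), ← sq_abs (Real.sin y), ← sq_abs (Real.sin z)]
    exact six_ineq (by linarith)
  have sh : ∀ k, k ≤ 2 * h → ∑ J ∈ Finset.range m, g (J + k) ≤ ∑ J ∈ Finset.range (m + 2 * h), g J := by
    intro k hk
    have : ∑ J ∈ Finset.range m, g (J + k) = ∑ J ∈ (Finset.range m).map (addRightEmbedding k), g J := by
      rw [Finset.sum_map]; rfl
    rw [this]
    refine Finset.sum_le_sum_of_subset_of_nonneg ?_ fun J _ _ => g0 J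
    intro J hJ
    simp only [Finset.mem_map, Finset.mem_range, addRightEmbedding_apply] at hJ ⊢
    omega
  have b3 := Finset.card_nsmul_le_sum (Finset.range m) _ _ (fun J _ => b2 J)
  rw [Finset.sum_add_distrib, Finset.sum_add_distrib, Finset.card_range, nsmul_eq_mul] at b3
  have q1 := sh 0 (by omega)
  have q2 := sh h (by omega)
  have q3 := sh (2 * h) le_rfl
  simp only [add_zero] at q1
  have q4 : σ / 144 ≤ ∑ J ∈ Finset.range (m + 2 * h), g J := by linarith
  calc _ = Real.exp (-25) * (σ / 144) := by ring
    _ ≤ _ := by gcongr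

theorem minor : ∃ C : ℝ, 0 < C ∧ ∀ t : ℝ, 0 < t → t ≤ 1 / 64 → ∀ θ : ℝ, |θ| ≤ Real.pi →
    Real.exp ((Fc (t + θ * Complex.I)).re - Fr t) ≤ C * (1 + (θ / om t) ^ 2)⁻¹ := by
  obtain ⟨c1, hc1, h1⟩ := minorB
  obtain ⟨c2, hc2, h2⟩ := minorC
  refine ⟨(1 + 1 / c1) + 720 / c2 ^ 6 * (1 + Real.pi ^ 2), by positivity, fun t ht ht1 θ hθ => ?_⟩
  rw [← div_eq_mul_inv, le_div_iff₀ (by positivity)]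
  set v := (θ / om t) ^ 2 with hv
  have hv0 : 0 ≤ v := by positivity
  rcases le_total |θ| t with h | h
  · have q := h1 t ht ht1 θ h
    have q2 : Real.exp ((Fc (t + θ * Complex.I)).re - Fr t) ≤ (1 + c1 * v)⁻¹ := by
      rw [show (Fc (t + θ * Complex.I)).re - Fr t = -(Fr t - (Fc (t + θ * Complex.I)).re) by ring, Real.exp_neg]
      gcongr
      linarith [Real.add_one_le_exp (Fr t - (Fc (t + θ * Complex.I)).re)]
    calc _ ≤ (1 + c1 * v)⁻¹ * (1 + v) := by gcongr
      _ ≤ 1 + 1 / c1 := by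
        rw [inv_mul_le_iff₀ (by positivity)]
        have : (1 + c1 * v) * (1 + 1 / c1) = 1 + v + (c1 * v + 1 / c1) := by field_simp; ring
        rw [this]
        have : 0 ≤ c1 * v + 1 / c1 := by positivity
        linarith
      _ ≤ _ := by
        have : 0 ≤ 720 / c2 ^ 6 * (1 + Real.pi ^ 2) := by positivity
        linarith
  · have q := h2 t ht ht1 θ h hθ
    set σ := t ^ (-(1:ℝ)/2) with hσ
    have hσ0 : 0 < σ := by positivity
    have hσ6 : σ ^ 6 = (t ^ 3)⁻¹ := by
      rw [hσ, ← Real.rpow_natCast, ← Real.rpow_mul ht.le, ← Real.rpow_natCast, ← Real.rpow_neg ht.le]; norm_num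
    have q2 : Real.exp ((Fc (t + θ * Complex.I)).re - Fr t) ≤ 720 / c2 ^ 6 * t ^ 3 := by
      rw [show (Fc (t + θ * Complex.I)).re - Fr t = -(Fr t - (Fc (t + θ * Complex.I)).re) by ring, Real.exp_neg]
      have e := Real.pow_div_factorial_le_exp (c2 * σ) (by positivity) 6
      have e2 := e.trans (Real.exp_le_exp.2 q)
      rw [mul_pow, hσ6] at e2
      norm_num [Nat.factorial] at e2
      rw [show 720 / c2 ^ 6 * t ^ 3 = (c2 ^ 6 * (t ^ 3)⁻¹ / 720)⁻¹ by field_simp]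
      gcongr
    have o1 : t ^ 3 ≤ om t ^ 2 := by
      rw [om, mul_pow, show t ^ 3 = t ^ 2 * t by ring, ← Real.rpow_natCast (t ^ ((1:ℝ)/3)), ← Real.rpow_mul ht.le]
      gcongr
      conv_lhs => rw [← Real.rpow_one t]
      exact Real.rpow_le_rpow_of_exponent_ge ht (by linarith) (by norm_num)
    have o2 : v ≤ Real.pi ^ 2 / t ^ 3 := by
      rw [hv, div_pow]
      have : θ ^ 2 ≤ Real.pi ^ 2 := by rw [← sq_abs]; gcongr
      exact div_le_div₀ (by positivity) this (by positivity) o1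
    have o3 : t ^ 3 ≤ 1 := pow_le_one₀ ht.le (by linarith)
    calc _ ≤ 720 / c2 ^ 6 * t ^ 3 * (1 + Real.pi ^ 2 / t ^ 3) := by gcongr
      _ = 720 / c2 ^ 6 * (t ^ 3 + Real.pi ^ 2) := by field_simp
      _ ≤ 720 / c2 ^ 6 * (1 + Real.pi ^ 2) := by gcongr
      _ ≤ _ := by
        have : 0 ≤ 1 + 1 / c1 := by positivity
        linarith

end SU3

namespace SU3
open MeasureTheory Set Topology

lemma Fc_cont (t : ℝ) (ht : 0 < t) : Continuous (fun θ : ℝ => Fc (t + θ * Complex.I)) := by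
  unfold Fc
  refine continuous_tsum (u := fun i => cf i * Real.exp (-(t * Nf i))) (fun i => by fun_prop)
    (Fr_summable ht) (fun i θ => ?_)
  rw [norm_mul, Complex.norm_exp, Complex.norm_real, Real.norm_of_nonneg (cf_pos i).le]
  simp

lemma saddle {a b d : ℝ} (ha : 0 < a)
    (hF : Tendsto (fun t => Fr t - Pm a b t) (𝓝[>] 0) (𝓝 d)) (t : ℕ → ℝ)
    (ht : Tendsto t atTop (𝓝[>] 0))
    (hN : Tendsto (fun n : ℕ => om (t n) * (n + Qm a b (t n))) atTop (𝓝 0)) :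
    Tendsto (fun n : ℕ => (om (t n) : ℂ)⁻¹ * ∫ θ in (-Real.pi)..Real.pi,
      Complex.exp (Fc (t n + θ * Complex.I) - Fr (t n) + n * θ * Complex.I)) atTop
      (𝓝 ((√(Real.pi / (5 / 9 * a)) : ℝ) : ℂ)) := by
  obtain ⟨C, hC, hmin⟩ := minor
  obtain ⟨h1, h2, h3⟩ := central hF
  have htpos : ∀ᶠ n in atTop, 0 < t n := ht self_mem_nhdsWithin
  have ht0 : Tendsto t atTop (𝓝 0) := ht.mono_right nhdsWithin_le_nhds
  have hts : ∀ᶠ n in atTop, t n ≤ 1 / 64 := by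
    filter_upwards [ht0.eventually (gt_mem_nhds (show (0:ℝ) < 1/64 by norm_num))] with n hn
    exact hn.le
  have hom0 : Tendsto (fun n => om (t n)) atTop (𝓝 0) := by
    have := rp_lim (q := 4/3) (by norm_num)
    refine (this.comp ht).congr' ?_
    filter_upwards [htpos] with n hn
    simp only [Function.comp, om]
    rw [show (4/3:ℝ) = 1 + 1/3 by norm_num, Real.rpow_add hn, Real.rpow_one]
  set g : ℕ → ℝ → ℂ := fun n y => (Ioc (-Real.pi / om (t n)) (Real.pi / om (t n))).indicator
    (fun y : ℝ => Complex.exp (Fc (t n + (y * om (t n) : ℝ) * Complex.I) - Fr (t n)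
      + n * (y * om (t n) : ℝ) * Complex.I)) y with hg
  have key : Tendsto (fun n => ∫ y, g n y) atTop
      (𝓝 (∫ y : ℝ, ((Real.exp (-(5/9*a) * y^2) : ℝ) : ℂ))) := by
    refine tendsto_integral_filter_of_dominated_convergence (fun y => C * (1 + y^2)⁻¹) ?_ ?_ ?_ ?_
    · filter_upwards [htpos] with n hn
      refine AEStronglyMeasurable.indicator ?_ measurableSet_Ioc
      refine Continuous.aestronglyMeasurable ?_
      have := (Fc_cont (t n) hn).comp (continuous_id.mul continuous_const : Continuous fun y : ℝ => y * om (t n))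
      simp only [Function.comp_def] at this
      fun_prop
    · filter_upwards [htpos, hts] with n hn hn2
      refine ae_of_all _ fun y => ?_
      have ho := om_pos hn
      by_cases hy : y ∈ Ioc (-Real.pi / om (t n)) (Real.pi / om (t n))
      · simp only [hg, indicator_of_mem hy]
        have hy1 : -Real.pi ≤ y * om (t n) := by
          have := hy.1
          rw [div_lt_iff₀ ho] at this
          exact this.le
        have hy2 : y * om (t n) ≤ Real.pi := by
          have := hy.2
          rwa [le_div_iff₀ ho] at this
        have := hmin (t n) hn hn2 (y * om (t n)) (abs_le.2 ⟨hy1, hy2⟩)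
        rw [mul_div_cancel_right₀ _ ho.ne'] at this
        rw [Complex.norm_exp]
        convert this using 2
        simp
      · simp only [hg, indicator_of_notMem hy, norm_zero]
        positivity
    · exact integrable_inv_one_add_sq.const_mul C
    · refine ae_of_all _ fun y => ?_
      have hev : ∀ᶠ n in atTop, y ∈ Ioc (-Real.pi / om (t n)) (Real.pi / om (t n)) := by
        have : Tendsto (fun n => y * om (t n)) atTop (𝓝 0) := by simpa using hom0.const_mul y
        have hp := Real.pi_pos
        filter_upwards [this.eventually (Ioo_mem_nhds (neg_lt_zero.2 hp) hp), htpos] with n hn hn2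
        have ho := om_pos hn2
        exact ⟨by rw [div_lt_iff₀ ho]; exact hn.1, by rw [le_div_iff₀ ho]; exact hn.2.le⟩
      have l1 := (h1 (y * Complex.I)).comp ht
      have l2 := (Complex.continuous_ofReal.tendsto _).comp (h2.comp ht)
      have l3 := (Complex.continuous_ofReal.tendsto _).comp (h3.comp ht)
      have l4 := (Complex.continuous_ofReal.tendsto _).comp hN
      have l5 := (l1.add ((l4.sub l2).const_mul (y * Complex.I))).add
        (l3.const_mul ((y * Complex.I)^2/2))
      have l6 := (Complex.continuous_exp.tendsto _).comp l5
      have e : Complex.exp (0 + y * Complex.I * (((0:ℝ):ℂ) - ((0:ℝ):ℂ)) + (y * Complex.I)^2/2 * ((10/9*a : ℝ) : ℂ)) = ((Real.exp (-(5/9*a) * y^2) : ℝ) : ℂ) := by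
        push_cast
        congr 1
        rw [mul_pow, Complex.I_sq]; ring
      rw [e] at l6
      refine l6.congr' ?_
      filter_upwards [hev] with n hn
      simp only [hg, indicator_of_mem hn, Function.comp]
      congr 1
      push_cast
      rw [show (y * om (t n) : ℂ) * Complex.I = y * Complex.I * om (t n) by ring]
      ring
  rw [integral_complex_ofReal, integral_gaussian] at key
  refine key.congr' ?_
  filter_upwards [htpos] with n hn
  have ho := om_pos hn
  have hp := Real.pi_pos
  have e := intervalIntegral.smul_integral_comp_mul_right (a := -Real.pi / om (t n))
    (b := Real.pi / om (t n)) (fun θ : ℝ => Complex.exp (Fc (t n + θ * Complex.I) - Fr (t n) + n * θ * Complex.I)) (om (t n))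
  rw [div_mul_cancel₀ _ ho.ne', div_mul_cancel₀ _ ho.ne'] at e
  rw [← e, Complex.real_smul, inv_mul_cancel_left₀ (by exact_mod_cast ho.ne'),
    intervalIntegral.integral_of_le (by gcongr; linarith), ← integral_indicator measurableSet_Ioc]
end SU3

namespace SU3
open MeasureTheory Set Topology

noncomputable def wt (f : (ℕ × ℕ) →₀ ℕ) : ℕ := f.sum fun p m => m * dn p

noncomputable def Gp (p : ℕ × ℕ) (z : ℂ) : ℂ :=
  ∑' k : ℕ, (cf (p, k) : ℂ) * Complex.exp (-(z * Nf (p, k)))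

lemma geo (p : ℕ × ℕ) (z : ℂ) (hz : 0 < z.re) :
    HasSum (fun k : ℕ => Complex.exp (-(z * (k * dn p : ℕ)))) (Complex.exp (Gp p z)) := by
  have hd : (0:ℝ) < dn p := by
    have := dn_ge p
    exact_mod_cast (by omega : 0 < dn p)
  set u := Complex.exp (-(z * dn p)) with hu
  have hn : ‖u‖ < 1 := by
    rw [hu, Complex.norm_exp, Real.exp_lt_one_iff]
    simp only [Complex.neg_re, Complex.mul_re, Complex.natCast_re, Complex.natCast_im]
    nlinarith [mul_pos hz hd]
  have h1 := hasSum_geometric_of_norm_lt_one hn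
  have hpow : ∀ k : ℕ, u ^ k = Complex.exp (-(z * (k * dn p : ℕ))) := by
    intro k
    rw [hu, ← Complex.exp_nat_mul]; push_cast; ring_nf
  have h2 := Complex.hasSum_taylorSeries_neg_log hn
  have h3 : HasSum (fun k : ℕ => u ^ (k+1) / ((k+1 : ℕ) : ℂ)) (-Complex.log (1 - u)) := by
    have := (hasSum_nat_add_iff' 1).2 h2
    simpa using this
  have h4 : Gp p z = -Complex.log (1 - u) := by
    rw [← h3.tsum_eq, Gp]
    refine tsum_congr fun k => ?_
    rw [hpow]
    simp only [cf, Nf]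
    push_cast
    ring
  have h5 : (1 - u) ≠ 0 := by
    intro h
    have : u = 1 := by linear_combination -h
    rw [this] at hn; simp at hn
  rw [h4, Complex.exp_neg, Complex.exp_log h5]
  simpa only [hpow] using h1

open Classical in
lemma finS (z : ℂ) (hz : 0 < z.re) (S : Finset (ℕ × ℕ)) :
    HasSum (fun f : (ℕ × ℕ) →₀ ℕ => if f.support ⊆ S then Complex.exp (-(z * wt f)) else 0)
      (Complex.exp (∑ p ∈ S, Gp p z)) := by
  induction S using Finset.induction_on with
  | empty =>
    have := hasSum_ite_eq (0 : (ℕ × ℕ) →₀ ℕ) (1:ℂ)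
    simp only [Finset.sum_empty, Complex.exp_zero]
    convert this using 1
    funext f
    by_cases h : f = 0
    · subst h; simp [wt]
    · simp [h]
  | insert p S hp ih =>
    have hg := geo p z hz
    have hmul : ∀ {A : ℕ → ℂ} {B : ((ℕ × ℕ) →₀ ℕ) → ℂ} {x y : ℂ}, HasSum A x → HasSum B y →
        HasSum (fun q : ℕ × ((ℕ × ℕ) →₀ ℕ) => A q.1 * B q.2) (x * y) := fun {A B x y} hA hB =>
      hA.mul hB (summable_mul_of_summable_norm (f := A) (g := B) hA.summable.norm hB.summable.norm)
    have h1 := hmul hg ih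
    rw [← Complex.exp_add, ← Finset.sum_insert (f := fun p => Gp p z) hp] at h1
    have hinj : Function.Injective (fun f : (ℕ × ℕ) →₀ ℕ => (f p, f.erase p)) := by
      intro f g hfg
      simp only [Prod.mk.injEq] at hfg
      rw [← Finsupp.single_add_erase p f, ← Finsupp.single_add_erase p g, hfg.1, hfg.2]
    have h2 := (hinj.hasSum_iff (a := Complex.exp (∑ p ∈ insert p S, Gp p z)) ?_).2 h1
    · convert h2 using 1
      funext f
      simp only [Function.comp, Finsupp.support_erase, Finset.subset_insert_iff]
      split_ifs with h
      · rw [← Complex.exp_add]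
        congr 1
        have : wt f = f p * dn p + wt (f.erase p) :=
          (Finsupp.add_sum_erase' f p (fun p m => m * dn p) (by simp)).symm
        rw [this]; push_cast; ring
      · simp
    · rintro ⟨k, g⟩ hx
      have : ¬ g.support ⊆ S := by
        intro hS
        apply hx
        have hgp : g p = 0 := by
          by_contra h
          exact hp (hS (Finsupp.mem_support_iff.2 h))
        refine ⟨Finsupp.single p k + g, ?_⟩
        simp only [Finsupp.coe_add, Pi.add_apply, Finsupp.single_eq_same, hgp, add_zero, Finsupp.erase_add, Finsupp.erase_single, zero_add, Prod.mk.injEq, true_and]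
        exact Finsupp.erase_of_notMem_support (by simpa using hgp)
      simp [this]

lemma Gp_sum (z : ℂ) (hz : 0 < z.re) : HasSum (fun p => Gp p z) (Fc z) :=
  (Fc_summable hz).hasSum.prod_fiberwise fun p => ((Fc_summable hz).prod_factor p).hasSum

lemma wt_norm (z : ℂ) (f : (ℕ × ℕ) →₀ ℕ) :
    ‖Complex.exp (-(z * wt f))‖ = Real.exp (-(z.re * wt f)) := by
  rw [Complex.norm_exp]; simp

open Classical in
lemma all_summable (t : ℝ) (ht : 0 < t) :
    Summable (fun f : (ℕ × ℕ) →₀ ℕ => Real.exp (-(t * wt f))) := by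
  have h := (Complex.continuous_exp.tendsto _).comp (Gp_sum t (by simpa using ht))
  have h' := h.norm.eventually (gt_mem_nhds (lt_add_one _))
  obtain ⟨S0, hS0⟩ := eventually_atTop.1 h'
  refine summable_of_sum_le (c := ‖Complex.exp (Fc t)‖ + 1) (fun f => (Real.exp_pos _).le) fun u => ?_
  set S := S0 ∪ u.biUnion Finsupp.support with hS
  have h1 := finS t (by simpa using ht) S
  have h2 := hS0 S Finset.subset_union_left
  simp only [Function.comp] at h2
  have h3 := (Complex.reCLM.hasSum h1)
  have h4 : ∑ f ∈ u, Real.exp (-(t * wt f)) ≤ (Complex.exp (∑ p ∈ S, Gp p t)).re := by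
    refine le_trans (le_of_eq ?_) (sum_le_hasSum u ?_ h3)
    · refine Finset.sum_congr rfl fun f hf => ?_
      have : f.support ⊆ S := (Finset.subset_biUnion_of_mem _ hf).trans Finset.subset_union_right
      simp only [Function.comp, if_pos this, Complex.reCLM_apply]
      rw [← Complex.ofReal_re (Real.exp (-(t * wt f)))]; push_cast; rfl
    · intro f _
      simp only [Function.comp, Complex.reCLM_apply]
      split_ifs
      · have : (Complex.exp (-(t * wt f))).re = Real.exp (-(t * wt f)) := by
          rw [← Complex.ofReal_re (Real.exp (-(t * wt f)))]; push_cast; rfl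
        rw [this]; positivity
      · simp
  exact h4.trans ((Complex.re_le_norm _).trans h2.le)

open Classical in
lemma all_tsum (z : ℂ) (hz : 0 < z.re) :
    ∑' f : (ℕ × ℕ) →₀ ℕ, Complex.exp (-(z * wt f)) = Complex.exp (Fc z) := by
  have h := (Complex.continuous_exp.tendsto _).comp (Gp_sum z hz)
  have h2 : Tendsto (fun S : Finset (ℕ × ℕ) => ∑' f : (ℕ × ℕ) →₀ ℕ,
      if f.support ⊆ S then Complex.exp (-(z * wt f)) else 0) atTop
      (𝓝 (∑' f : (ℕ × ℕ) →₀ ℕ, Complex.exp (-(z * wt f)))) := by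
    refine tendsto_tsum_of_dominated_convergence (all_summable z.re hz) ?_ ?_
    · intro f
      refine tendsto_const_nhds.congr' ?_
      filter_upwards [eventually_ge_atTop f.support] with S hS
      rw [if_pos hS]
    · refine Eventually.of_forall fun S f => ?_
      split_ifs
      · exact (wt_norm z f).le
      · simpa using (Real.exp_pos _).le
  refine tendsto_nhds_unique h2 (h.congr fun S => ?_)
  exact ((finS z hz S).tsum_eq).symm

lemma fourier (m n : ℕ) : ∫ θ in (-Real.pi)..Real.pi, Complex.exp ((n - m : ℂ) * (θ * Complex.I))
    = if m = n then 2 * (Real.pi : ℂ) else 0 := by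
  split_ifs with h
  · subst h
    simp; ring
  · have hc : ((n:ℂ) - m) * Complex.I ≠ 0 := by
      refine mul_ne_zero (sub_ne_zero.2 ?_) Complex.I_ne_zero
      exact fun h' => h (Nat.cast_injective h').symm
    have := integral_exp_mul_complex (a := -Real.pi) (b := Real.pi) hc
    rw [show (fun θ : ℝ => Complex.exp ((n - m : ℂ) * (θ * Complex.I))) = fun θ : ℝ => Complex.exp ((n - m : ℂ) * Complex.I * θ) by funext θ; ring_nf]
    rw [this]
    rw [div_eq_zero_iff]; left
    rw [sub_eq_zero, Complex.exp_eq_exp_iff_exists_int]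
    refine ⟨n - m, ?_⟩
    push_cast; ring

lemma card_int (t : ℝ) (ht : 0 < t) (n : ℕ) :
    ∫ θ in (-Real.pi)..Real.pi, Complex.exp (Fc (t + θ * Complex.I) + n * (t + θ * Complex.I)) =
      (Nat.card {f : (ℕ × ℕ) →₀ ℕ // wt f = n} : ℂ) * (2 * Real.pi) := by
  have hre : ∀ θ : ℝ, 0 < ((t : ℂ) + θ * Complex.I).re := by intro θ; simpa using ht
  set F : ((ℕ × ℕ) →₀ ℕ) → C(ℝ, ℂ) := fun f =>
    ⟨fun θ => Complex.exp (-((t + θ * Complex.I) * wt f)) * Complex.exp (n * (t + θ * Complex.I)), by fun_prop⟩ with hFd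
  have hs : HasSum (fun f => ∫ θ in (-Real.pi)..Real.pi, F f θ) (∫ θ in (-Real.pi)..Real.pi, ∑' f, F f θ) := by
    refine intervalIntegral.hasSum_integral_of_dominated_convergence
      (fun f _ => Real.exp (-(t * wt f)) * Real.exp (n * t)) ?_ ?_ ?_ ?_ ?_
    · intro f; exact (F f).continuous.aestronglyMeasurable
    · intro f
      refine ae_of_all _ fun θ _ => ?_
      simp only [hFd, ContinuousMap.coe_mk, norm_mul, wt_norm]
      rw [Complex.norm_exp]
      simp
    · exact ae_of_all _ fun θ _ => (all_summable t ht).mul_right _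
    · exact _root_.intervalIntegrable_const
    · refine ae_of_all _ fun θ _ => Summable.hasSum ?_
      refine Summable.of_norm_bounded ((all_summable t ht).mul_right (Real.exp (n * t))) fun f => ?_
      simp only [hFd, ContinuousMap.coe_mk, norm_mul, wt_norm]
      rw [Complex.norm_exp]
      simp
  have e1 : ∀ θ : ℝ, ∑' f, F f θ = Complex.exp (Fc (t + θ * Complex.I) + n * (t + θ * Complex.I)) := by
    intro θ
    simp only [hFd, ContinuousMap.coe_mk]
    rw [tsum_mul_right, all_tsum _ (hre θ), Complex.exp_add]
  have e2 : ∀ f, ∫ θ in (-Real.pi)..Real.pi, F f θ = ({f | wt f = n} : Set ((ℕ × ℕ) →₀ ℕ)).indicator (fun _ => 2 * (Real.pi : ℂ)) f := by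
    intro f
    have : ∀ θ : ℝ, F f θ = Complex.exp ((n - wt f) * t) * Complex.exp ((n - wt f : ℂ) * (θ * Complex.I)) := by
      intro θ
      simp only [hFd, ContinuousMap.coe_mk]
      rw [← Complex.exp_add, ← Complex.exp_add]; ring_nf
    simp only [this]
    rw [intervalIntegral.integral_const_mul, fourier]
    by_cases h : wt f = n
    · simp [h]
    · simp [h]
  simp only [e1] at hs
  rw [← hs.tsum_eq]
  simp only [e2]
  rw [← tsum_subtype, tsum_const, nsmul_eq_mul]
  rfl

def sh : (ℕ × ℕ) ↪ (ℕ × ℕ) := ⟨fun p => (p.1 + 1, p.2 + 1), fun p q h => by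
  simp only [Prod.mk.injEq] at h; ext <;> omega⟩

lemma sh_apply (p : ℕ × ℕ) : sh p = (p.1 + 1, p.2 + 1) := rfl

lemma card_eq (n : ℕ) : suThreeRep n = Nat.card {f : (ℕ × ℕ) →₀ ℕ // wt f = n} := by
  have hw : ∀ f : (ℕ × ℕ) →₀ ℕ, ((f.embDomain sh).sum fun p m => m * (p.1 * p.2 * (p.1 + p.2))) = 2 * wt f := by
    intro f
    rw [Finsupp.sum_embDomain, wt, Finsupp.mul_sum]
    refine Finsupp.sum_congr fun p _ => ?_
    have := dn_two p
    simp only [sh_apply]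
    rw [show 2 * (f p * dn p) = f p * (2 * dn p) by ring, this]; ring
  unfold suThreeRep
  symm
  refine Nat.card_eq_of_bijective (fun f => ⟨f.1.embDomain sh, ?_, ?_⟩) ⟨?_, ?_⟩
  · intro p hp
    rw [Finsupp.support_embDomain, Finset.mem_map] at hp
    obtain ⟨q, _, rfl⟩ := hp
    simp [sh_apply]
  · rw [hw, f.2]
  · intro f g h
    exact Subtype.ext (Finsupp.embDomain_injective _ (Subtype.ext_iff.1 h))
  · rintro ⟨g, hg1, hg2⟩
    have hsub : (g.support : Set (ℕ × ℕ)) ⊆ Set.range sh := by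
      intro p hp
      have := hg1 p hp
      exact ⟨(p.1 - 1, p.2 - 1), by simp only [sh_apply]; ext <;> dsimp only <;> omega⟩
    have he := Finsupp.embDomain_comapDomain hsub
    refine ⟨⟨Finsupp.comapDomain sh g sh.injective.injOn, ?_⟩, Subtype.ext he⟩
    have := hw (Finsupp.comapDomain sh g sh.injective.injOn)
    rw [he, hg2] at this
    omega

end SU3

namespace SU3
open MeasureTheory Set Topology

noncomputable def R1 (s : ℝ) : ℝ := (240)*s^0 + (5355/4)*s^1 + (8568)*s^2 + (32640)*s^3 + (125460)*s^4 + (2832795/8)*s^5 + (979370)*s^6 + (2105280)*s^7 + (4407165)*s^8 + (229456395/32)*s^9 + (22865085/2)*s^10 + (13384440)*s^11 + (63241479/4)*s^12 + (2845866555/256)*s^13 + (71744535/8)*s^14 + (-3486784401/1024)*s^17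

noncomputable def R2 (s : ℝ) : ℝ := (-4959/2)*s^0 + (-10365)*s^1 + (-287055/4)*s^2 + (-7157745/32)*s^3 + (-13903105/16)*s^4 + (-33081525/16)*s^5 + (-177592905/32)*s^6 + (-1278774135/128)*s^7 + (-155893005/8)*s^8 + (-811825335/32)*s^9 + (-569881899/16)*s^10 + (-15084952785/512)*s^11 + (-7102708965/256)*s^12 + (-1937102445/256)*s^13 + (-1937102445/512)*s^14 + (10460353203/2048)*s^15

noncomputable def Xs (s : ℝ) : ℝ := 1 + s + 9 / 2 * s ^ 2

lemma R1_eq (s : ℝ) : 1 - Xs s ^ 10 + 10 * s * Xs s ^ 9 = s ^ 3 * R1 s := by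
  unfold Xs R1; ring

lemma R2_eq (s : ℝ) : 1 + 3 / 2 * Xs s ^ 10 - 20 * s * Xs s ^ 9 =
    (5 / 2 - 20 * s - 30 * s ^ 2 - 110 * s ^ 3 - 500 * s ^ 4) * Xs s ^ 6 + s ^ 5 * R2 s := by
  unfold Xs R2; ring

lemma Xs_pos {s : ℝ} (hs : 0 ≤ s) : 0 < Xs s := by unfold Xs; positivity

lemma alg1 {a b κ α w X R : ℝ} (hκ : 0 < κ) (hw : 0 < w) (hX : 0 < X) (ha : a * κ ^ 10 = 3 / 2)
    (hb : b * κ ^ 9 = 20 * α) (h : 1 - X ^ 10 + 10 * (α * w) * X ^ 9 = (α * w) ^ 3 * R) :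
    ((κ * X / w) ^ 6)⁻¹ * ((κ * X / w) ^ 2)⁻¹ * ((w ^ 10)⁻¹ +
      (-(2 / 3) * a * (κ * X / w) ^ 10 + b / 2 * (κ * X / w) ^ 9)) =
    (κ ^ 8)⁻¹ * (X ^ 8)⁻¹ * α ^ 3 * w * R := by
  have e : (w ^ 10)⁻¹ + (-(2 / 3) * a * (κ * X / w) ^ 10 + b / 2 * (κ * X / w) ^ 9) =
      (w ^ 10)⁻¹ * ((α * w) ^ 3 * R) := by
    rw [← h, div_pow, div_pow, mul_pow, mul_pow,
      show -(2 / 3) * a * (κ ^ 10 * X ^ 10 / w ^ 10) = -(2 / 3) * (a * κ ^ 10) * X ^ 10 / w ^ 10 by ring,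
      show b / 2 * (κ ^ 9 * X ^ 9 / w ^ 9) = 1 / 2 * (b * κ ^ 9) * X ^ 9 / w ^ 9 by ring, ha, hb]
    field_simp
    ring
  rw [e]
  field_simp

lemma alg2 {a b κ α w X R : ℝ} (hκ : 0 < κ) (hw : 0 < w) (hX : 0 < X) (ha : a * κ ^ 10 = 3 / 2)
    (hb : b * κ ^ 9 = 20 * α)
    (h : 1 + 3 / 2 * X ^ 10 - 20 * (α * w) * X ^ 9 =
    (5 / 2 - 20 * (α * w) - 30 * (α * w) ^ 2 - 110 * (α * w) ^ 3 - 500 * (α * w) ^ 4) * X ^ 6 + (α * w) ^ 5 * R) :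
    (w ^ 10)⁻¹ * ((κ * X / w) ^ 6)⁻¹ + a * (κ * X / w) ^ 4 - b * (κ * X / w) ^ 3 =
    ((5 / 2 * (κ ^ 6)⁻¹) * (w ^ 4)⁻¹ - 20 * α * (κ ^ 6)⁻¹ * (w ^ 3)⁻¹ - 30 * α ^ 2 * (κ ^ 6)⁻¹ * (w ^ 2)⁻¹
      - 110 * α ^ 3 * (κ ^ 6)⁻¹ * w⁻¹) + (κ ^ 6)⁻¹ * (-500 * α ^ 4 + α ^ 5 * w * R / X ^ 6) := by
  have e1 : a * (κ * X / w) ^ 4 = 3 / 2 * X ^ 4 / (κ ^ 6 * w ^ 4) := by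
    rw [← ha]; field_simp
  have e2 : b * (κ * X / w) ^ 3 = 20 * α * X ^ 3 / (κ ^ 6 * w ^ 3) := by
    rw [← hb]; field_simp
  rw [e1, e2]
  have e3 : (w ^ 10)⁻¹ * ((κ * X / w) ^ 6)⁻¹ + 3 / 2 * X ^ 4 / (κ ^ 6 * w ^ 4) - 20 * α * X ^ 3 / (κ ^ 6 * w ^ 3)
      = (1 + 3 / 2 * X ^ 10 - 20 * (α * w) * X ^ 9) / (κ ^ 6 * w ^ 4 * X ^ 6) := by
    field_simp
  rw [e3, h]
  field_simp
  ring

lemma tpow {θ : ℝ} (hθ : 0 < θ) (q : ℝ) (m : ℕ) (h : -6 * q = m) : ((θ ^ 6)⁻¹) ^ q = θ ^ m := by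
  rw [← Real.rpow_natCast θ m, ← h, Real.rpow_mul hθ.le]
  congr 1
  rw [Real.rpow_neg hθ.le]
  norm_cast

lemma om_eq {θ : ℝ} (hθ : 0 < θ) : om ((θ ^ 6)⁻¹) = (θ ^ 6)⁻¹ * (θ ^ 2)⁻¹ := by
  unfold om
  congr 1
  have := tpow hθ (-(1/3)) 2 (by norm_num)
  rw [← this, Real.rpow_neg (by positivity), inv_inv]

lemma Qm_eq {θ : ℝ} (hθ : 0 < θ) (a b : ℝ) : Qm a b ((θ ^ 6)⁻¹) = -(2 / 3) * a * θ ^ 10 + b / 2 * θ ^ 9 := by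
  unfold Qm
  rw [tpow hθ _ 10 (by norm_num), tpow hθ _ 9 (by norm_num)]

lemma Pm_eq {θ : ℝ} (hθ : 0 < θ) (a b : ℝ) : Pm a b ((θ ^ 6)⁻¹) = a * θ ^ 4 - b * θ ^ 3 + 2 * Real.log θ := by
  unfold Pm
  rw [tpow hθ _ 4 (by norm_num), tpow hθ _ 3 (by norm_num), Real.log_inv, Real.log_pow]
  push_cast; ring

lemma rep_eq (t : ℝ) (ht : 0 < t) (n : ℕ) : (suThreeRep n : ℝ) = (2 * Real.pi)⁻¹ *
    (Real.exp (Fr t + n * t) * (om t * ((om t : ℂ)⁻¹ * ∫ θ in (-Real.pi)..Real.pi,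
      Complex.exp (Fc (t + θ * Complex.I) - Fr t + n * θ * Complex.I)).re)) := by
  have h := card_int t ht n
  have ho := om_pos ht
  rw [← card_eq] at h
  have e : ∀ θ : ℝ, Complex.exp (Fc (t + θ * Complex.I) + n * (t + θ * Complex.I)) =
      ((Real.exp (Fr t + n * t) : ℝ) : ℂ) * Complex.exp (Fc (t + θ * Complex.I) - Fr t + n * θ * Complex.I) := by
    intro θ
    push_cast
    rw [← Complex.exp_add]; ring_nf
  simp only [e] at h
  rw [intervalIntegral.integral_const_mul] at h
  have h2 := congrArg Complex.re h
  rw [Complex.re_ofReal_mul, show ((suThreeRep n : ℂ) * (2 * Real.pi)) = (((suThreeRep n : ℝ) * (2 * Real.pi) : ℝ) : ℂ) by push_cast; ring,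
    Complex.ofReal_re] at h2
  rw [← Complex.ofReal_inv, Complex.re_ofReal_mul, mul_inv_cancel_left₀ ho.ne', h2]
  have := Real.pi_pos
  field_simp

lemma wpow {n : ℕ} (hn : 0 < n) (q : ℝ) (m : ℕ) (h : q = m / 10) :
    (n : ℝ) ^ q = (((n : ℝ) ^ (-(1:ℝ) / 10)) ^ m)⁻¹ := by
  have hn' : (0:ℝ) ≤ n := by positivity
  rw [← Real.rpow_natCast, ← Real.rpow_mul hn', ← Real.rpow_neg hn', h]
  congr 1; ring

theorem final :
    ∃ A₁ A₂ A₃ A₄ K : ℝ, 0 < A₁ ∧ 0 < A₂ ∧ 0 < A₃ ∧ 0 < A₄ ∧ 0 < K ∧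
      (fun n : ℕ => (suThreeRep n : ℝ)) ~[atTop]
        fun n : ℕ => K / (n : ℝ) ^ ((3 : ℝ) / 5) *
          Real.exp (A₁ * (n : ℝ) ^ ((2 : ℝ) / 5) - A₂ * (n : ℝ) ^ ((3 : ℝ) / 10)
            - A₃ * (n : ℝ) ^ ((1 : ℝ) / 5) - A₄ * (n : ℝ) ^ ((1 : ℝ) / 10)) := by
  obtain ⟨a, b, d, ha, hb, hF'⟩ := Fr_asy
  have hF : Tendsto (fun t => Fr t - Pm a b t) (𝓝[>] 0) (𝓝 d) := hF'
  set κ : ℝ := (3 / (2 * a)) ^ ((1:ℝ) / 10) with hκd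
  have hκ : 0 < κ := by positivity
  have haκ : a * κ ^ 10 = 3 / 2 := by
    rw [hκd, ← Real.rpow_natCast, ← Real.rpow_mul (by positivity)]
    norm_num
    field_simp
  set α : ℝ := b * κ ^ 9 / 20 with hαd
  have hα : 0 < α := by positivity
  have hbκ : b * κ ^ 9 = 20 * α := by rw [hαd]; ring
  set w : ℕ → ℝ := fun n => (n : ℝ) ^ (-(1:ℝ) / 10) with hwd
  have hw0 : Tendsto w atTop (𝓝 0) := by
    have := (tendsto_rpow_neg_atTop (y := (1:ℝ)/10) (by norm_num)).comp tendsto_natCast_atTop_atTop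
    refine this.congr fun n => ?_
    simp only [hwd, Function.comp]; congr 1; ring
  have hwpos : ∀ n : ℕ, 0 < n → 0 < w n := fun n hn => by
    have : (0:ℝ) < n := by exact_mod_cast hn
    simp only [hwd]; positivity
  have hs0 : Tendsto (fun n => α * w n) atTop (𝓝 0) := by simpa using hw0.const_mul α
  set X : ℕ → ℝ := fun n => Xs (α * w n) with hXd
  have hcX : Continuous Xs := by unfold Xs; fun_prop
  have hcR1 : Continuous R1 := by unfold R1; fun_prop
  have hcR2 : Continuous R2 := by unfold R2; fun_prop
  have hX : Tendsto X atTop (𝓝 1) := by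
    have := (hcX.tendsto 0).comp hs0
    rw [show Xs 0 = 1 by simp [Xs]] at this
    exact this
  have hR1 := (hcR1.tendsto 0).comp hs0
  have hR2 := (hcR2.tendsto 0).comp hs0
  have hXpos : ∀ n : ℕ, 0 < n → 0 < X n := fun n hn => Xs_pos (mul_pos hα (hwpos n hn)).le
  set th : ℕ → ℝ := fun n => κ * X n / w n with hthd
  have hth : ∀ n : ℕ, 0 < n → 0 < th n := fun n hn => div_pos (mul_pos hκ (hXpos n hn)) (hwpos n hn)
  set t : ℕ → ℝ := fun n => (th n ^ 6)⁻¹ with htd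
  have htpos : ∀ n : ℕ, 0 < n → 0 < t n := fun n hn => by
    have := hth n hn
    simp only [htd]; positivity
  have hlim : Tendsto t atTop (𝓝[>] 0) := by
    refine tendsto_nhdsWithin_iff.2 ⟨?_, ?_⟩
    · have := (hw0.div (hX.const_mul κ) (by simpa using hκ.ne')).pow 6
      rw [zero_div, zero_pow (by norm_num)] at this
      refine this.congr fun n => ?_
      simp only [htd, hthd, Pi.div_apply]
      rw [← inv_pow, inv_div]
    · filter_upwards [eventually_gt_atTop 0] with n hn
      exact htpos n hn
  have hn10 : ∀ n : ℕ, 0 < n → (n : ℝ) = (w n ^ 10)⁻¹ := fun n hn => by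
    have := wpow hn 1 10 (by norm_num)
    rwa [Real.rpow_one] at this
  have hN : Tendsto (fun n : ℕ => om (t n) * (n + Qm a b (t n))) atTop (𝓝 0) := by
    have h1 : Tendsto (fun n => (κ ^ 8)⁻¹ * (X n ^ 8)⁻¹ * α ^ 3 * w n * R1 (α * w n)) atTop (𝓝 ((κ ^ 8)⁻¹ * (1 ^ 8)⁻¹ * α ^ 3 * 0 * R1 0)) :=
      (((((hX.pow 8).inv₀ (by norm_num)).const_mul _).mul_const _).mul hw0).mul hR1
    rw [mul_zero, zero_mul] at h1
    refine h1.congr' ?_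
    filter_upwards [eventually_gt_atTop 0] with n hn
    simp only [htd]
    rw [om_eq (hth n hn), Qm_eq (hth n hn), hn10 n hn]
    exact (alg1 hκ (hwpos n hn) (hXpos n hn) haκ hbκ (R1_eq _)).symm
  have hS := saddle ha hF t hlim hN
  have hSre := (Complex.continuous_re.tendsto _).comp hS
  rw [Complex.ofReal_re] at hSre
  set G := √(Real.pi / (5 / 9 * a)) with hG
  have hGpos : 0 < G := by have := Real.pi_pos; positivity
  have hFt := (Real.continuous_exp.tendsto _).comp (hF.comp hlim)
  have hrem : Tendsto (fun n => Real.exp ((κ ^ 6)⁻¹ * (-500 * α ^ 4 + α ^ 5 * w n * R2 (α * w n) / X n ^ 6))) atTop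
      (𝓝 (Real.exp ((κ ^ 6)⁻¹ * (-500 * α ^ 4 + α ^ 5 * 0 * R2 0 / 1 ^ 6)))) :=
    (Real.continuous_exp.tendsto _).comp (((((hw0.const_mul _).mul hR2).div (hX.pow 6) (by norm_num)).const_add _).const_mul _)
  have hX6 : Tendsto (fun n => (κ ^ 6)⁻¹ * (X n ^ 6)⁻¹) atTop (𝓝 ((κ ^ 6)⁻¹ * (1 ^ 6)⁻¹)) :=
    ((hX.pow 6).inv₀ (by norm_num)).const_mul _
  have hprod := (((hFt.mul hrem).mul hX6).mul hSre).const_mul (2 * Real.pi)⁻¹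
  set K := (2 * Real.pi)⁻¹ * (Real.exp d * Real.exp ((κ ^ 6)⁻¹ * (-500 * α ^ 4 + α ^ 5 * 0 * R2 0 / 1 ^ 6)) * ((κ ^ 6)⁻¹ * (1 ^ 6)⁻¹) * G) with hK
  have hKpos : 0 < K := by have := Real.pi_pos; positivity
  refine ⟨5 / 2 * (κ ^ 6)⁻¹, 20 * α * (κ ^ 6)⁻¹, 30 * α ^ 2 * (κ ^ 6)⁻¹, 110 * α ^ 3 * (κ ^ 6)⁻¹, K,
    by positivity, by positivity, by positivity, by positivity, hKpos, ?_⟩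
  have heq := ((isEquivalent_const_iff_tendsto hKpos.ne').2 hprod).mul
    (IsEquivalent.refl (u := fun n : ℕ => ((n : ℝ) ^ ((3 : ℝ) / 5))⁻¹ *
          Real.exp (5 / 2 * (κ ^ 6)⁻¹ * (n : ℝ) ^ ((2 : ℝ) / 5) - 20 * α * (κ ^ 6)⁻¹ * (n : ℝ) ^ ((3 : ℝ) / 10)
            - 30 * α ^ 2 * (κ ^ 6)⁻¹ * (n : ℝ) ^ ((1 : ℝ) / 5) - 110 * α ^ 3 * (κ ^ 6)⁻¹ * (n : ℝ) ^ ((1 : ℝ) / 10))) (l := atTop))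
  refine (heq.congr_left ?_).congr_right ?_
  · filter_upwards [eventually_gt_atTop 0] with n hn
    have hx := hXpos n hn
    have hw := hwpos n hn
    rw [rep_eq (t n) (htpos n hn) n]
    simp only [Pi.mul_apply, Function.comp]
    generalize Complex.re _ = J
    have hV := alg2 hκ hw hx haκ hbκ (R2_eq (α * w n))
    have hP : Fr (t n) + n * t n = (Fr (t n) - Pm a b (t n)) +
       (((5 / 2 * (κ ^ 6)⁻¹) * (w n ^ 4)⁻¹ - 20 * α * (κ ^ 6)⁻¹ * (w n ^ 3)⁻¹ - 30 * α ^ 2 * (κ ^ 6)⁻¹ * (w n ^ 2)⁻¹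
      - 110 * α ^ 3 * (κ ^ 6)⁻¹ * (w n ^ 1)⁻¹) + (κ ^ 6)⁻¹ * (-500 * α ^ 4 + α ^ 5 * w n * R2 (α * w n) / X n ^ 6)) + (Real.log (th n) + Real.log (th n)) := by
      rw [pow_one, ← hV]
      have : Pm a b (t n) = _ := Pm_eq (hth n hn) a b
      rw [this, hn10 n hn]
      simp only [htd, hthd]
      ring
    have homt : om (t n) = (th n ^ 6)⁻¹ * (th n ^ 2)⁻¹ := om_eq (hth n hn)
    rw [hP, Real.exp_add _ (Real.log (th n) + Real.log (th n)), Real.exp_add (Real.log (th n)),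
      Real.exp_log (hth n hn), Real.exp_add (Fr (t n) - Pm a b (t n)), Real.exp_add _ ((κ ^ 6)⁻¹ * _), homt]
    rw [wpow hn (3/5) 6 (by norm_num), wpow hn (2/5) 4 (by norm_num), wpow hn (3/10) 3 (by norm_num),
      wpow hn (1/5) 2 (by norm_num), wpow hn (1/10) 1 (by norm_num)]
    have hth' := hth n hn
    have e6 : th n * th n * ((th n ^ 6)⁻¹ * (th n ^ 2)⁻¹) = (κ ^ 6)⁻¹ * (X n ^ 6)⁻¹ * w n ^ 6 := by
      have : th n * th n * ((th n ^ 6)⁻¹ * (th n ^ 2)⁻¹) = (th n ^ 6)⁻¹ := by field_simp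
      rw [this]; simp only [hthd]; field_simp
    simp only [inv_inv]
    generalize Real.exp (Fr (t n) - Pm a b (t n)) = E1
    generalize Real.exp ((κ ^ 6)⁻¹ * _) = E2
    change _ * (E1 * E2 * _ * J) * (w n ^ 6 * Real.exp (_ * (w n ^ 4)⁻¹ - _ * (w n ^ 3)⁻¹ - _ * (w n ^ 2)⁻¹ - _ * (w n ^ 1)⁻¹)) = _
    generalize Real.exp _ = E3
    linear_combination (-(2 * Real.pi)⁻¹ * E1 * E2 * E3 * J) * e6
  · refine Eventually.of_forall fun n => ?_
    simp only [Pi.mul_apply]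
    rw [div_eq_mul_inv K]
    exact (mul_assoc _ _ _).symm
end SU3

theorem suThreeRep_asymptotic :
    ∃ A₁ A₂ A₃ A₄ K : ℝ, 0 < A₁ ∧ 0 < A₂ ∧ 0 < A₃ ∧ 0 < A₄ ∧ 0 < K ∧
      (fun n : ℕ => (suThreeRep n : ℝ)) ~[atTop]
        fun n : ℕ => K / (n : ℝ) ^ ((3 : ℝ) / 5) *
          Real.exp (A₁ * (n : ℝ) ^ ((2 : ℝ) / 5) - A₂ * (n : ℝ) ^ ((3 : ℝ) / 10)
            - A₃ * (n : ℝ) ^ ((1 : ℝ) / 5) - A₄ * (n : ℝ) ^ ((1 : ℝ) / 10)) := by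
  exact SU3.final
end

section
/- For every real $x \ge 1$, the number of pairs $(m,n)$ of positive integers with $mn(m+n) \le 2x$ equals $2\sum_{1 \le n \le x^{1/3}} \left\lfloor \frac{-n^2 + \sqrt{n^4 + 8nx}}{2n} \right\rfloor - \lfloor x^{1/3} \rfloor^2$. -/
theorem comb_aux (N K : ℕ) (f : ℕ → ℕ) (hK : ∀ n, n ≤ K ↔ 2 * n ^ 3 ≤ N)
    (hf : ∀ n, 1 ≤ n → ∀ m, m ≤ f n ↔ m * n * (m + n) ≤ N) :
    Nat.card {p : ℕ × ℕ // 0 < p.1 ∧ 0 < p.2 ∧ p.1 * p.2 * (p.1 + p.2) ≤ N} + K ^ 2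
      = 2 * ∑ n ∈ Finset.Icc 1 K, f n := by
  classical
  let S : Finset (ℕ × ℕ) := (Finset.Icc 1 N ×ˢ Finset.Icc 1 N).filter
    (fun p => p.1 * p.2 * (p.1 + p.2) ≤ N)
  have bd : ∀ m n : ℕ, 0 < m → 0 < n → m * n * (m + n) ≤ N → m ≤ N ∧ n ≤ N := by
    intro m n hm hn h
    have h1 : 1 ≤ m * n := Nat.mul_pos hm hn
    have : m + n ≤ m * n * (m + n) := Nat.le_mul_of_pos_left _ h1
    omega
  have hS : ∀ p : ℕ × ℕ, p ∈ S ↔ (0 < p.1 ∧ 0 < p.2 ∧ p.1 * p.2 * (p.1 + p.2) ≤ N) := by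
    intro p
    simp only [S, Finset.mem_filter, Finset.mem_product, Finset.mem_Icc]
    constructor
    · rintro ⟨⟨⟨a, b⟩, c, d⟩, e⟩
      exact ⟨a, c, e⟩
    · rintro ⟨a, b, c⟩
      have := bd _ _ a b c
      exact ⟨⟨⟨a, this.1⟩, b, this.2⟩, c⟩
  have hcard : Nat.card {p : ℕ × ℕ // 0 < p.1 ∧ 0 < p.2 ∧ p.1 * p.2 * (p.1 + p.2) ≤ N}
      = S.card := Nat.subtype_card S hS
  have hA : (S.filter (fun p => p.2 ≤ K)).card = ∑ n ∈ Finset.Icc 1 K, f n := by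
    rw [Finset.card_eq_sum_card_fiberwise (f := Prod.snd) (t := Finset.Icc 1 K)]
    · apply Finset.sum_congr rfl
      intro n hn
      rw [Finset.mem_Icc] at hn
      have : ((S.filter (fun p => p.2 ≤ K)).filter (fun p => p.2 = n))
          = (Finset.Icc 1 (f n)).image (fun m => (m, n)) := by
        ext ⟨m, k⟩
        simp only [Finset.mem_filter, hS, Finset.mem_image, Finset.mem_Icc, Prod.mk.injEq]
        constructor
        · rintro ⟨⟨⟨a, b, c⟩, d⟩, rfl⟩
          exact ⟨m, ⟨a, (hf _ b _).2 c⟩, rfl, rfl⟩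
        · rintro ⟨m', ⟨a, b⟩, rfl, rfl⟩
          exact ⟨⟨⟨a, hn.1, (hf _ hn.1 _).1 b⟩, hn.2⟩, rfl⟩
      rw [this, Finset.card_image_of_injective _ (fun a b h => (Prod.mk.inj h).1)]
      simp
    · intro p hp
      simp only [Finset.coe_filter, Set.mem_ofPred_eq, hS] at hp
      simp only [Finset.coe_Icc, Set.mem_Icc]
      exact ⟨hp.1.2.1, hp.2⟩
  have hB : (S.filter (fun p => p.1 ≤ K)).card = (S.filter (fun p => p.2 ≤ K)).card := by
    apply Finset.card_bij (fun p _ => p.swap)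
    · rintro ⟨m, n⟩ h
      simp only [Finset.mem_filter, hS, Prod.swap] at h ⊢
      obtain ⟨⟨a, b, c⟩, d⟩ := h
      exact ⟨⟨b, a, by rw [mul_comm n m, add_comm n m]; exact c⟩, d⟩
    · intro a _ b _ h
      exact Prod.swap_injective h
    · rintro ⟨m, n⟩ h
      refine ⟨(n, m), ?_, rfl⟩
      simp only [Finset.mem_filter, hS] at h ⊢
      obtain ⟨⟨a, b, c⟩, d⟩ := h
      exact ⟨⟨b, a, by rw [mul_comm n m, add_comm n m]; exact c⟩, d⟩
  have hU : S.filter (fun p => p.2 ≤ K) ∪ S.filter (fun p => p.1 ≤ K) = S := by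
    rw [← Finset.filter_or]
    apply Finset.filter_true_of_mem
    rintro ⟨m, n⟩ h
    rw [hS] at h
    obtain ⟨a, b, c⟩ := h
    simp only at a b c ⊢
    rw [hK, hK]
    rcases le_total m n with h | h
    · right
      calc 2 * m ^ 3 = m * m * (m + m) := by ring
        _ ≤ m * n * (m + n) := by gcongr
        _ ≤ N := c
    · left
      calc 2 * n ^ 3 = n * n * (n + n) := by ring
        _ ≤ m * n * (m + n) := by gcongr
        _ ≤ N := c
  have hI : S.filter (fun p => p.2 ≤ K) ∩ S.filter (fun p => p.1 ≤ K)
      = Finset.Icc 1 K ×ˢ Finset.Icc 1 K := by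
    ext ⟨m, n⟩
    simp only [Finset.mem_inter, Finset.mem_filter, hS, Finset.mem_product, Finset.mem_Icc]
    constructor
    · rintro ⟨⟨⟨a, b, c⟩, d⟩, ⟨_, e⟩⟩
      exact ⟨⟨a, e⟩, b, d⟩
    · rintro ⟨⟨a, e⟩, b, d⟩
      have : m * n * (m + n) ≤ N := by
        calc m * n * (m + n) ≤ K * K * (K + K) := by gcongr
          _ = 2 * K ^ 3 := by ring
          _ ≤ N := (hK K).1 le_rfl
      exact ⟨⟨⟨a, b, this⟩, d⟩, ⟨a, b, this⟩, e⟩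
  have := Finset.card_union_add_card_inter (S.filter (fun p => p.2 ≤ K))
    (S.filter (fun p => p.1 ≤ K))
  rw [hU, hI, hB, hA, Finset.card_product, Nat.card_Icc] at this
  rw [hcard, sq, two_mul]
  simpa using this

theorem lattice_count_hyperbola (x : ℝ) (hx : 1 ≤ x) :
    ((Nat.card {p : ℕ × ℕ //
        0 < p.1 ∧ 0 < p.2 ∧ ((p.1 * p.2 * (p.1 + p.2) : ℕ) : ℝ) ≤ 2 * x} : ℤ))
      = 2 * ∑ n ∈ Finset.Icc 1 ⌊x ^ ((1 : ℝ) / 3)⌋₊,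
            ⌊(-(n : ℝ) ^ 2 + Real.sqrt ((n : ℝ) ^ 4 + 8 * n * x)) / (2 * n)⌋
        - (⌊x ^ ((1 : ℝ) / 3)⌋₊ : ℤ) ^ 2 := by
  have hx0 : 0 ≤ x := by linarith
  have hN : ∀ k : ℕ, (k : ℝ) ≤ 2 * x ↔ k ≤ ⌊2 * x⌋₊ := fun k =>
    (Nat.le_floor_iff (by linarith)).symm
  have hpos : ∀ n : ℕ, 0 ≤ (-(n : ℝ) ^ 2 + Real.sqrt ((n : ℝ) ^ 4 + 8 * n * x)) / (2 * n) := by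
    intro n
    have : (n : ℝ) ^ 2 ≤ Real.sqrt ((n : ℝ) ^ 4 + 8 * n * x) := by
      apply Real.le_sqrt_of_sq_le
      have : 0 ≤ 8 * (n : ℝ) * x := by positivity
      nlinarith
    apply div_nonneg _ (by positivity)
    linarith
  have key := comb_aux ⌊2 * x⌋₊ ⌊x ^ ((1 : ℝ) / 3)⌋₊
    (fun n => ⌊(-(n : ℝ) ^ 2 + Real.sqrt ((n : ℝ) ^ 4 + 8 * n * x)) / (2 * n)⌋₊) ?_ ?_
  · simp only [hN]
    have hs : ∑ n ∈ Finset.Icc 1 ⌊x ^ ((1 : ℝ) / 3)⌋₊,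
            ⌊(-(n : ℝ) ^ 2 + Real.sqrt ((n : ℝ) ^ 4 + 8 * n * x)) / (2 * n)⌋
        = ((∑ n ∈ Finset.Icc 1 ⌊x ^ ((1 : ℝ) / 3)⌋₊,
            ⌊(-(n : ℝ) ^ 2 + Real.sqrt ((n : ℝ) ^ 4 + 8 * n * x)) / (2 * n)⌋₊ : ℕ) : ℤ) := by
      rw [Nat.cast_sum]
      exact Finset.sum_congr rfl fun n _ => (Int.natCast_floor_eq_floor (hpos n)).symm
    rw [hs]
    have key2 := congrArg (Nat.cast : ℕ → ℤ) key
    rw [Nat.cast_add, Nat.cast_mul, Nat.cast_pow] at key2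
    rw [eq_sub_iff_add_eq]
    exact key2
  · intro n
    rw [Nat.le_floor_iff (by positivity), ← hN, one_div,
      Real.le_rpow_inv_iff_of_pos (by positivity) hx0 (by norm_num)]
    have : (n : ℝ) ^ (3 : ℝ) = (n : ℝ) ^ 3 := by exact_mod_cast Real.rpow_natCast (n : ℝ) 3
    rw [this]
    push_cast
    constructor <;> intro h <;> linarith
  · intro n hn m
    have hn' : (0 : ℝ) < n := by exact_mod_cast hn
    rw [Nat.le_floor_iff (hpos n), ← hN, le_div_iff₀ (by positivity)]
    have e : (m : ℝ) * (2 * n) ≤ -(n : ℝ) ^ 2 + Real.sqrt ((n : ℝ) ^ 4 + 8 * n * x)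
        ↔ (m : ℝ) * (2 * n) + (n : ℝ) ^ 2 ≤ Real.sqrt ((n : ℝ) ^ 4 + 8 * n * x) := by
      constructor <;> intro h <;> linarith
    rw [e, Real.le_sqrt' (by positivity)]
    push_cast
    have e2 : ((m : ℝ) * (2 * n) + (n : ℝ) ^ 2) ^ 2
        = (n : ℝ) ^ 4 + 4 * n * (m * n * (m + n)) := by ring
    rw [e2]
    constructor
    · intro h
      have : 4 * (n : ℝ) * (m * n * (m + n)) ≤ 4 * n * (2 * x) := by linarith
      exact le_of_mul_le_mul_left this (by positivity)
    · intro h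
      have : 4 * (n : ℝ) * (m * n * (m + n)) ≤ 4 * n * (2 * x) := by gcongr
      linarith
end

section
/- As $x \to \infty$, $\sum_{1 \le n \le x} \varrho(n) = -\frac{3}{2} x^{2/3} + \sum_{1 \le n \le x^{1/3}} \sqrt{n^2 + \frac{8x}{n}} + O(x^{1/3})$, where the second sum ranges over positive integers $n$ with $n \le x^{1/3}$. -/
open Filter Asymptotics

/-- `varrho n` is the number of pairs `(j, k)` of positive integers with
`j * k * (j + k) / 2 = n`, i.e. with `j * k * (j + k) = 2 * n`. -/
noncomputable def varrho (n : ℕ) : ℕ :=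
  Nat.card {p : ℕ × ℕ // 0 < p.1 ∧ 0 < p.2 ∧ p.1 * p.2 * (p.1 + p.2) = 2 * n}

lemma vr_even (j k : ℕ) : 2 ∣ j * k * (j + k) := by
  rw [← even_iff_two_dvd]
  simp only [Nat.even_mul, Nat.even_add]
  tauto

lemma vr_bound (j k : ℕ) (hj : 0 < j) (hk : 0 < k) :
    j ≤ j * k * (j + k) ∧ k ≤ j * k * (j + k) := by
  constructor
  · have : 1 ≤ k * (j + k) := Nat.mul_pos hk (by omega)
    nlinarith
  · have : 1 ≤ j * (j + k) := Nat.mul_pos hj (by omega)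
    nlinarith

lemma vr_card (M n : ℕ) (h : 2 * n ≤ M) :
    varrho n = (((Finset.Icc 1 M) ×ˢ (Finset.Icc 1 M)).filter
      (fun p : ℕ × ℕ => p.1 * p.2 * (p.1 + p.2) = 2 * n)).card := by
  unfold varrho
  apply Nat.subtype_card
  rintro ⟨j, k⟩
  simp only [Finset.mem_filter, Finset.mem_product, Finset.mem_Icc]
  constructor
  · rintro ⟨h1, h2⟩
    exact ⟨by omega, by omega, h2⟩
  · rintro ⟨h1, h2, h3⟩
    have := vr_bound j k h1 h2
    refine ⟨⟨⟨?_, ?_⟩, ?_, ?_⟩, h3⟩ <;> omega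

lemma vr_sum (N : ℕ) :
    ∑ n ∈ Finset.Icc 1 N, varrho n = (((Finset.Icc 1 (2 * N)) ×ˢ (Finset.Icc 1 (2 * N))).filter
      (fun p : ℕ × ℕ => p.1 * p.2 * (p.1 + p.2) ≤ 2 * N)).card := by
  rw [Finset.card_eq_sum_card_fiberwise (f := fun p : ℕ × ℕ => p.1 * p.2 * (p.1 + p.2) / 2)
    (t := Finset.Icc 1 N)]
  · refine Finset.sum_congr rfl fun n hn => ?_
    rw [Finset.mem_Icc] at hn
    rw [vr_card (2 * N) n (by omega), Finset.filter_filter]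
    congr 1
    ext ⟨j, k⟩
    have := vr_even j k
    simp only [Finset.mem_filter, and_congr_right_iff]
    intro _
    omega
  · rintro ⟨j, k⟩ h
    simp only [Finset.coe_filter, Finset.mem_product, Finset.mem_Icc, Set.mem_ofPred_eq] at h
    have := vr_even j k
    have h2 : 0 < j * k * (j + k) :=
      Nat.mul_pos (Nat.mul_pos (by omega) (by omega)) (by omega)
    simp only [Finset.coe_Icc, Set.mem_Icc]
    omega

lemma vr_split (N Y : ℕ) (h1 : Y ^ 3 ≤ N) (h2 : N < (Y + 1) ^ 3) :
    (((Finset.Icc 1 (2 * N)) ×ˢ (Finset.Icc 1 (2 * N))).filter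
      (fun p : ℕ × ℕ => p.1 * p.2 * (p.1 + p.2) ≤ 2 * N)).card + Y ^ 2 =
    2 * ∑ j ∈ Finset.Icc 1 Y, ((Finset.Icc 1 (2 * N)).filter
      (fun k => j * k * (j + k) ≤ 2 * N)).card := by
  have hY : Y ≤ 2 * N := by
    have : Y ≤ Y ^ 3 := Nat.le_self_pow (by norm_num) Y
    omega
  set P : ℕ × ℕ → Prop := fun p : ℕ × ℕ => p.1 * p.2 * (p.1 + p.2) ≤ 2 * N with hP
  set S1 := ((Finset.Icc 1 Y) ×ˢ (Finset.Icc 1 (2 * N))).filter P with hS1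
  set S2 := ((Finset.Icc 1 (2 * N)) ×ˢ (Finset.Icc 1 Y)).filter P with hS2
  have hc1 : S1.card = ∑ j ∈ Finset.Icc 1 Y, ((Finset.Icc 1 (2 * N)).filter
      (fun k => j * k * (j + k) ≤ 2 * N)).card := by
    simp only [hS1, hP, Finset.card_filter, Finset.sum_product]
  have hc2 : S2.card = ∑ j ∈ Finset.Icc 1 Y, ((Finset.Icc 1 (2 * N)).filter
      (fun k => j * k * (j + k) ≤ 2 * N)).card := by
    simp only [hS2, hP, Finset.card_filter, Finset.sum_product_right]
    refine Finset.sum_congr rfl fun j _ => Finset.sum_congr rfl fun k _ => ?_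
    rw [mul_comm k j, add_comm k j]
  have hu : S1 ∪ S2 = ((Finset.Icc 1 (2 * N)) ×ˢ (Finset.Icc 1 (2 * N))).filter P := by
    ext ⟨j, k⟩
    simp only [hS1, hS2, hP, Finset.mem_union, Finset.mem_filter, Finset.mem_product,
      Finset.mem_Icc]
    constructor
    · rintro (h | h) <;> refine ⟨⟨⟨?_, ?_⟩, ?_, ?_⟩, h.2⟩ <;> omega
    · rintro ⟨h, hp⟩
      by_cases hj : j ≤ Y
      · left; exact ⟨⟨⟨by omega, hj⟩, h.2⟩, hp⟩
      · by_cases hk : k ≤ Y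
        · right; exact ⟨⟨h.1, by omega, hk⟩, hp⟩
        · exfalso
          have a : Y + 1 ≤ j := by omega
          have b : Y + 1 ≤ k := by omega
          have : (Y + 1) * (Y + 1) * ((Y + 1) + (Y + 1)) ≤ j * k * (j + k) := by gcongr
          nlinarith
  have hi : S1 ∩ S2 = (Finset.Icc 1 Y) ×ˢ (Finset.Icc 1 Y) := by
    ext ⟨j, k⟩
    simp only [hS1, hS2, hP, Finset.mem_inter, Finset.mem_filter, Finset.mem_product,
      Finset.mem_Icc]
    constructor
    · rintro ⟨h, h'⟩
      exact ⟨h.1.1, h'.1.2⟩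
    · rintro ⟨h, h'⟩
      have : j * k * (j + k) ≤ Y * Y * (Y + Y) := by
        have := h.2
        have := h'.2
        gcongr
      have hp : j * k * (j + k) ≤ 2 * N := by nlinarith
      refine ⟨⟨⟨h, ?_, ?_⟩, hp⟩, ⟨⟨?_, ?_⟩, h'⟩, hp⟩ <;> omega
  have := Finset.card_union_add_card_inter S1 S2
  rw [hu, hi, hc1, hc2, Finset.card_product, Nat.card_Icc] at this
  rw [two_mul (∑ j ∈ Finset.Icc 1 Y, _), ← this]
  rw [Nat.add_sub_cancel, pow_two]

lemma vr_fiber (x : ℝ) (hx : 0 ≤ x) (j : ℕ) (hj : 1 ≤ j) :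
    ((Finset.Icc 1 (2 * ⌊x⌋₊)).filter (fun k => j * k * (j + k) ≤ 2 * ⌊x⌋₊)).card =
      ⌊(Real.sqrt ((j : ℝ) ^ 2 + 8 * x / j) - j) / 2⌋₊ := by
  have hj0 : (0 : ℝ) < j := by exact_mod_cast hj
  have hs : (j : ℝ) ≤ Real.sqrt ((j : ℝ) ^ 2 + 8 * x / j) := by
    apply Real.le_sqrt_of_sq_le
    have : 0 ≤ 8 * x / j := by positivity
    linarith
  have key : (Finset.Icc 1 (2 * ⌊x⌋₊)).filter (fun k => j * k * (j + k) ≤ 2 * ⌊x⌋₊) =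
      Finset.Icc 1 ⌊(Real.sqrt ((j : ℝ) ^ 2 + 8 * x / j) - j) / 2⌋₊ := by
    ext k
    simp only [Finset.mem_filter, Finset.mem_Icc]
    have e : j * k * (j + k) ≤ 2 * ⌊x⌋₊ ↔
        k ≤ ⌊(Real.sqrt ((j : ℝ) ^ 2 + 8 * x / j) - j) / 2⌋₊ := by
      obtain ⟨m, hm⟩ := vr_even j k
      have hm' : (j : ℝ) * k * (j + k) = 2 * m := by exact_mod_cast hm
      rw [hm, Nat.mul_le_mul_left_iff (by norm_num), Nat.le_floor_iff hx,
        Nat.le_floor_iff (by linarith)]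
      have : (k : ℝ) ≤ (Real.sqrt ((j : ℝ) ^ 2 + 8 * x / j) - j) / 2 ↔
          (2 * k + j : ℝ) ≤ Real.sqrt ((j : ℝ) ^ 2 + 8 * x / j) := by
        constructor <;> intro h <;> linarith
      rw [this, Real.le_sqrt' (by positivity)]
      have : (2 * k + j : ℝ) ^ 2 ≤ (j : ℝ) ^ 2 + 8 * x / j ↔
          (4 * k * (j + k) : ℝ) ≤ 8 * x / j := by
        constructor <;> intro h <;> nlinarith
      rw [this, le_div_iff₀ hj0]
      constructor <;> intro h <;> nlinarith
    rw [← e]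
    constructor
    · rintro ⟨h, h'⟩; exact ⟨h.1, h'⟩
    · rintro ⟨h, h'⟩
      exact ⟨⟨h, ((vr_bound j k hj h).2).trans h'⟩, h'⟩
  rw [key, Nat.card_Icc, Nat.add_sub_cancel]

lemma vr_gauss (Y : ℕ) : ∑ j ∈ Finset.Icc 1 Y, (j : ℝ) = Y * (Y + 1) / 2 := by
  induction Y with
  | zero => simp
  | succ n ih =>
    rw [Finset.sum_Icc_succ_top (by omega), ih]
    push_cast
    ring

theorem summatory_varrho_via_sqrt_sum :
    (fun x : ℝ =>
        (∑ n ∈ Finset.Icc 1 ⌊x⌋₊, (varrho n : ℝ))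
          - (-(3 / 2) * x ^ ((2 : ℝ) / 3)
              + ∑ n ∈ Finset.Icc 1 ⌊x ^ ((1 : ℝ) / 3)⌋₊,
                  Real.sqrt ((n : ℝ) ^ 2 + 8 * x / n)))
      =O[atTop] fun x : ℝ => x ^ ((1 : ℝ) / 3) := by
  refine IsBigO.of_bound 6 ?_
  filter_upwards [eventually_ge_atTop (0 : ℝ)] with x hx
  set y := x ^ ((1 : ℝ) / 3) with hy
  have hy0 : 0 ≤ y := by positivity
  have hy2 : x ^ ((2 : ℝ) / 3) = y ^ 2 := by
    rw [hy, ← Real.rpow_natCast, ← Real.rpow_mul hx]; norm_num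
  have hy3 : y ^ 3 = x := by
    rw [hy, ← Real.rpow_natCast, ← Real.rpow_mul hx]; norm_num
  set Y := ⌊y⌋₊ with hY
  have hY1 : (Y : ℝ) ≤ y := Nat.floor_le hy0
  have hY2 : y < Y + 1 := Nat.lt_floor_add_one y
  have h1 : Y ^ 3 ≤ ⌊x⌋₊ := by
    apply Nat.le_floor
    push_cast
    rw [← hy3]
    gcongr
  have h2 : ⌊x⌋₊ < (Y + 1) ^ 3 := by
    rw [Nat.floor_lt hx]
    push_cast
    rw [← hy3]
    gcongr
  have hsplit := vr_split _ _ h1 h2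
  rw [← vr_sum, Finset.sum_congr rfl
    (fun j hj => vr_fiber x hx j (Finset.mem_Icc.mp hj).1)] at hsplit
  have hsR : (∑ n ∈ Finset.Icc 1 ⌊x⌋₊, (varrho n : ℝ)) + (Y : ℝ) ^ 2 =
      2 * ∑ j ∈ Finset.Icc 1 Y,
        ((⌊(Real.sqrt ((j : ℝ) ^ 2 + 8 * x / j) - j) / 2⌋₊ : ℕ) : ℝ) := by
    exact_mod_cast hsplit
  have hnn : ∀ j ∈ Finset.Icc 1 Y,
      0 ≤ (Real.sqrt ((j : ℝ) ^ 2 + 8 * x / j) - j) / 2 := by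
    intro j _
    have hs : (j : ℝ) ≤ Real.sqrt ((j : ℝ) ^ 2 + 8 * x / j) := by
      apply Real.le_sqrt_of_sq_le
      have : 0 ≤ 8 * x / j := by positivity
      linarith
    linarith
  have up := Finset.sum_le_sum fun j hj => Nat.floor_le (hnn j hj)
  have lo := Finset.sum_le_sum fun j (_ : j ∈ Finset.Icc 1 Y) =>
    (Nat.lt_floor_add_one ((Real.sqrt ((j : ℝ) ^ 2 + 8 * x / j) - j) / 2)).le
  rw [Finset.sum_add_distrib] at lo
  rw [← Finset.sum_div, Finset.sum_sub_distrib, vr_gauss] at up lo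
  simp only [Finset.sum_const, Nat.card_Icc, Nat.add_sub_cancel, nsmul_eq_mul, mul_one] at lo
  rw [hy2, Real.norm_eq_abs, Real.norm_eq_abs, abs_of_nonneg hy0, abs_le]
  have hYn : (0 : ℝ) ≤ Y := Nat.cast_nonneg _
  constructor <;> nlinarith
end
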